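/- arXiv:1608.02155 — 2 statements merged into one kernel-verified Lean document; each statement's English description precedes it below -/
import Mathlib

section
/- Assume char(K) ∉ {2,3} and the residue field k has characteristic ∉ {2,3}. Let q ∈ K with 0 < |q| < 1, let m ≥ 2 be an integer, and suppose ψ_m ∈ K(z) is a rational map of degree m² satisfying ψ_m(x(w)) = x(w^m) for all w ∈ K^× with w ∉ q^ℤ and w^m ∉ q^ℤ, where x is Tate's series for the parameter q. Then the minimal resultant iteration formula R_{[(ψ_m)ⁿ]} = ( (mⁿ)²((mⁿ)²−1) / (m²(m²−1)) ) · R_{[ψ_m]} holds for every n ≥ 1 if and only if m is odd. -/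
open MvPolynomial Matrix

noncomputable section

variable {R : Type*} [CommRing R]

def coeffVec (e : ℕ) (F : MvPolynomial (Fin 2) R) (i : Fin (e + 1)) : R :=
  MvPolynomial.coeff (Finsupp.single 0 (e - (i : ℕ)) + Finsupp.single 1 (i : ℕ)) F

def sylv (e : ℕ) (a b : Fin (e + 1) → R) : Matrix (Fin (e + e)) (Fin (e + e)) R :=
  Matrix.of fun i j =>
    if h : (i : ℕ) < e then
      if hj : (i : ℕ) ≤ (j : ℕ) ∧ (j : ℕ) ≤ (i : ℕ) + e then
        a ⟨(j : ℕ) - (i : ℕ), by omega⟩ else 0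
    else
      if hj : (i : ℕ) - e ≤ (j : ℕ) ∧ (j : ℕ) ≤ (i : ℕ) then
        b ⟨(j : ℕ) - ((i : ℕ) - e), by omega⟩ else 0

def bres (e : ℕ) (F G : MvPolynomial (Fin 2) R) : R :=
  (sylv e (coeffVec e F) (coeffVec e G)).det

def comp2 (F f g : MvPolynomial (Fin 2) R) : MvPolynomial (Fin 2) R :=
  MvPolynomial.aeval ![f, g] F

def pairIter (F G : MvPolynomial (Fin 2) R) : ℕ → MvPolynomial (Fin 2) R × MvPolynomial (Fin 2) R
  | 0 => (X 0, X 1)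
  | n + 1 => (comp2 F (pairIter F G n).1 (pairIter F G n).2,
              comp2 G (pairIter F G n).1 (pairIter F G n).2)

variable (K : Type) [NontriviallyNormedField K] [IsUltrametricDist K]

def ordv (x : K) : ℝ := -Real.log ‖x‖

def intRing : Subring K where
  carrier := {x : K | ‖x‖ ≤ 1}
  one_mem' := by simp
  zero_mem' := by simp
  mul_mem' := by
    intro a b ha hb
    simp only [Set.mem_setOf_eq] at *
    calc ‖a * b‖ = ‖a‖ * ‖b‖ := norm_mul a b
    _ ≤ 1 * 1 := by gcongr
    _ = 1 := by ring
  add_mem' := by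
    intro a b ha hb
    simp only [Set.mem_setOf_eq] at *
    exact (IsUltrametricDist.norm_add_le_max a b).trans (max_le ha hb)
  neg_mem' := by
    intro a ha
    simp only [Set.mem_setOf_eq, norm_neg] at *
    exact ha

def maxIdl : Ideal (intRing K) where
  carrier := {x | ‖(x : K)‖ < 1}
  zero_mem' := by simp
  add_mem' := by
    intro a b ha hb
    simp only [Set.mem_setOf_eq] at *
    exact lt_of_le_of_lt (IsUltrametricDist.norm_add_le_max (a : K) b) (max_lt ha hb)
  smul_mem' := by
    intro c x hx
    simp only [Set.mem_setOf_eq] at *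
    calc ‖((c • x : intRing K) : K)‖ = ‖(c : K)‖ * ‖(x : K)‖ := norm_mul _ _
    _ ≤ 1 * ‖(x : K)‖ := by gcongr; exact c.2
    _ < 1 := by simpa using hx

def kk := intRing K ⧸ maxIdl K

instance : CommRing (kk K) := Ideal.Quotient.commRing (maxIdl K)

def redCoeff (x : K) : kk K :=
  if h : ‖x‖ ≤ 1 then Ideal.Quotient.mk (maxIdl K) ⟨x, h⟩ else 0

def redPoly (F : MvPolynomial (Fin 2) K) : MvPolynomial (Fin 2) (kk K) :=
  ∑ m ∈ F.support, MvPolynomial.monomial m (redCoeff K (F.coeff m))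

/-- A pair of binary forms is a (homogeneous) lift of a degree-`d` rational map if both entries
are homogeneous of degree `d` and they are coprime. -/
def LiftPair (d : ℕ) (F G : MvPolynomial (Fin 2) K) : Prop :=
  F.IsHomogeneous d ∧ G.IsHomogeneous d ∧ IsRelPrime F G

/-- A pair of binary forms is normalized if all coefficients lie in `O`
and some coefficient has absolute value `1`. -/
def Normalized (F G : MvPolynomial (Fin 2) K) : Prop :=
  (∀ m, ‖F.coeff m‖ ≤ 1) ∧ (∀ m, ‖G.coeff m‖ ≤ 1) ∧
    (∃ m, ‖F.coeff m‖ = 1 ∨ ‖G.coeff m‖ = 1)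

/-- The maximum of the absolute values of the coefficients of a pair of degree-`e` binary forms. -/
def maxNorm (e : ℕ) (F G : MvPolynomial (Fin 2) K) : ℝ :=
  Finset.univ.sup' Finset.univ_nonempty
    (fun i : Fin (e + 1) => max ‖coeffVec e F i‖ ‖coeffVec e G i‖)

/-- `Rpair e F G` is the quantity `R_φ = ord(Res(F₀,G₀))` where `(F₀,G₀)` is the normalized
rescaling of the pair `(F,G)` of degree-`e` binary forms; equivalently it is
`ord(Res(F,G)) - 2·e·(minimal ord of a coefficient of F, G)`. -/
def Rpair (e : ℕ) (F G : MvPolynomial (Fin 2) K) : ℝ :=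
  ordv K (bres e F G) + 2 * e * Real.log (maxNorm K e F G)

/-- Linear substitution of a `2×2` matrix into a binary form. -/
def mobius (M : Matrix (Fin 2) (Fin 2) K) (F : MvPolynomial (Fin 2) K) :
    MvPolynomial (Fin 2) K :=
  MvPolynomial.aeval
    ![C (M 0 0) * X 0 + C (M 0 1) * X 1, C (M 1 0) * X 0 + C (M 1 1) * X 1] F

/-- The conjugate pair `γ⁻¹ ∘ (F,G) ∘ γ`, a homogeneous lift of `φ^γ = γ⁻¹ ∘ φ ∘ γ`. -/
def conjPair (M : GL (Fin 2) K) (F G : MvPolynomial (Fin 2) K) :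
    MvPolynomial (Fin 2) K × MvPolynomial (Fin 2) K :=
  (C ((M⁻¹ : GL (Fin 2) K) 0 0) * mobius K M F + C ((M⁻¹ : GL (Fin 2) K) 0 1) * mobius K M G,
   C ((M⁻¹ : GL (Fin 2) K) 1 0) * mobius K M F + C ((M⁻¹ : GL (Fin 2) K) 1 1) * mobius K M G)

/-- The minimal resultant `R_{[φ]} = inf_γ R_{φ^γ}` of (the map lifted by) a degree-`e` pair. -/
def Rmin (e : ℕ) (F G : MvPolynomial (Fin 2) K) : ℝ :=
  ⨅ M : GL (Fin 2) K, Rpair K e (conjPair K M F G).1 (conjPair K M F G).2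

/-- `Ilocus d F G` says the reduction of the normalized pair `(F,G)` lies in the indeterminacy
locus `I(d)`: the reduced pair is proportional, i.e. `(F̃, G̃) = (a·C, b·C)` with `[a:b] ∈ P¹(k)`
(so that the residue map is the constant `[a:b]`), and the constant value `[a:b]`
is a root of the common factor `C` (which is the gcd `Ã` of `F̃` and `G̃`). -/
def Ilocus (d : ℕ) (F G : MvPolynomial (Fin 2) K) : Prop :=
  ∃ (a b : kk K) (Cf : MvPolynomial (Fin 2) (kk K)),
    ¬(a = 0 ∧ b = 0) ∧ Cf.IsHomogeneous d ∧
    redPoly K F = MvPolynomial.C a * Cf ∧ redPoly K G = MvPolynomial.C b * Cf ∧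
    MvPolynomial.eval ![a, b] Cf = 0

/-- `Semistable d F G` says the reduction of the normalized pair `(F,G)` is GIT-semistable
(Silverman's numerical criterion): writing `F̃ = Ã·F̃₀`, `G̃ = Ã·G̃₀` with `F̃₀, G̃₀` coprime,
every root `h = [a:b]` of `Ã` has multiplicity `r ≤ d/2` (`d` even), resp. `r ≤ (d+1)/2`
(`d` odd), and when the bound is attained additionally `φ̃(h) ≠ h`. -/
def Semistable (d : ℕ) (F G : MvPolynomial (Fin 2) K) : Prop :=
  ∃ (A F0 G0 : MvPolynomial (Fin 2) (kk K)) (e : ℕ),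
    e ≤ d ∧ A.IsHomogeneous (d - e) ∧ F0.IsHomogeneous e ∧ G0.IsHomogeneous e ∧
    redPoly K F = A * F0 ∧ redPoly K G = A * G0 ∧ IsRelPrime F0 G0 ∧
    ∀ (a b : kk K), ¬(a = 0 ∧ b = 0) → ∀ r : ℕ,
      (MvPolynomial.C b * X 0 - MvPolynomial.C a * X 1) ^ r ∣ A →
        2 * r ≤ d + 1 ∧
          (d ≤ 2 * r →
            b * MvPolynomial.eval ![a, b] F0 ≠ a * MvPolynomial.eval ![a, b] G0)

/-- The rational map lifted by the (not necessarily normalized) pair `(F,G)` has semistable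
reduction: some normalized rescaling is `Semistable`. -/
def HasSemistableRed (d : ℕ) (F G : MvPolynomial (Fin 2) K) : Prop :=
  ∃ c : Kˣ, Normalized K ((c : K) • F) ((c : K) • G) ∧
    Semistable K d ((c : K) • F) ((c : K) • G)

/-- The reduction of (a normalized rescaling of) the pair `(F,G)` lies outside `I(d)`. -/
def RedOutsideI (d : ℕ) (F G : MvPolynomial (Fin 2) K) : Prop :=
  ∃ c : Kˣ, Normalized K ((c : K) • F) ((c : K) • G) ∧
    ¬ Ilocus K d ((c : K) • F) ((c : K) • G)

/-- The `m`-th term (`m ≥ 1`) of Tate's series `x(w)`. -/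
def tateTerm (q w : K) (m : ℕ) : K :=
  q ^ m * w / (1 - q ^ m * w) ^ 2 + q ^ m * w⁻¹ / (1 - q ^ m * w⁻¹) ^ 2
    - 2 * (q ^ m / (1 - q ^ m) ^ 2)

/-- Tate's series `x(w)` for the Tate curve with parameter `q`. -/
def xTate (q w : K) : K :=
  w / (1 - w) ^ 2 + ∑' m : ℕ, tateTerm K q w (m + 1)

namespace TateLattes

variable {K}

lemma norm_sub_eq_of_lt {x y : K} (h : ‖x‖ < ‖y‖) : ‖x - y‖ = ‖y‖ := by
  rw [norm_sub_rev, sub_eq_add_neg,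
    IsUltrametricDist.norm_add_eq_max_of_norm_ne_norm (by rw [norm_neg]; exact h.ne'), norm_neg,
    max_eq_left h.le]

lemma norm_sub_le_max' (x y : K) : ‖x - y‖ ≤ max ‖x‖ ‖y‖ := by
  simpa [sub_eq_add_neg] using IsUltrametricDist.norm_add_le_max x (-y)

lemma norm_sub_le_of_le {x y : K} {r : ℝ} (hx : ‖x‖ ≤ r) (hy : ‖y‖ ≤ r) : ‖x - y‖ ≤ r :=
  (norm_sub_le_max' x y).trans (max_le hx hy)

lemma norm_add_le_of_le {x y : K} {r : ℝ} (hx : ‖x‖ ≤ r) (hy : ‖y‖ ≤ r) : ‖x + y‖ ≤ r :=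
  (IsUltrametricDist.norm_add_le_max x y).trans (max_le hx hy)

lemma norm_sub_lt_of_lt {x y : K} {r : ℝ} (hx : ‖x‖ < r) (hy : ‖y‖ < r) : ‖x - y‖ < r :=
  (norm_sub_le_max' x y).trans_lt (max_lt hx hy)

lemma norm_add_lt_of_lt {x y : K} {r : ℝ} (hx : ‖x‖ < r) (hy : ‖y‖ < r) : ‖x + y‖ < r :=
  (IsUltrametricDist.norm_add_le_max x y).trans_lt (max_lt hx hy)

lemma norm_eq_of_norm_sub_lt {x y : K} (h : ‖x - y‖ < ‖y‖) : ‖x‖ = ‖y‖ := by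
  have := IsUltrametricDist.norm_add_eq_max_of_norm_ne_norm h.ne
  rwa [sub_add_cancel, max_eq_right h.le] at this

lemma norm_eq_one_of_norm_sub_lt {x y : K} (hy : ‖y‖ = 1) (h : ‖x - y‖ < 1) : ‖x‖ = 1 := by
  rw [← hy] at h ⊢
  exact norm_eq_of_norm_sub_lt h

lemma norm_pow_sub_pow_le {x y : K} (hx : ‖x‖ ≤ 1) (hy : ‖y‖ ≤ 1) (n : ℕ) :
    ‖x ^ n - y ^ n‖ ≤ ‖x - y‖ := by
  induction n with
  | zero => simp
  | succ n ih =>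
    rw [show x ^ (n + 1) - y ^ (n + 1) = x ^ n * (x - y) + (x ^ n - y ^ n) * y by ring]
    refine norm_add_le_of_le ?_ ?_
    · rw [norm_mul, norm_pow]
      exact mul_le_of_le_one_left (norm_nonneg _) (pow_le_one₀ (norm_nonneg _) hx)
    · rw [norm_mul]
      exact (mul_le_of_le_one_right (norm_nonneg _) hy).trans ih

/-- Over an algebraically closed field there are units in general position with respect to
finitely many points. -/
lemma exists_norm_one_generic [IsAlgClosed K] (s : Multiset K) :
    ∃ u : K, ‖u‖ = 1 ∧ ∀ a ∈ s, ‖u - a‖ = max 1 ‖a‖ := by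
  classical
  set t := s.filter (fun a => ‖a‖ ≤ 1) with ht
  set P : Polynomial K := Polynomial.X * (t.map fun a => Polynomial.X - Polynomial.C a).prod
  have hP : P.natDegree = t.card + 1 := by
    have h0 : (t.map fun a => Polynomial.X - Polynomial.C a).prod ≠ 0 :=
      (Polynomial.monic_multisetProd_X_sub_C t).ne_zero
    rw [Polynomial.natDegree_X_mul h0, Polynomial.natDegree_multiset_prod_X_sub_C_eq_card]
  obtain ⟨u, hu⟩ := IsAlgClosed.exists_root (P - Polynomial.C 1) (by
    intro h
    have := Polynomial.natDegree_eq_of_degree_eq_some h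
    rw [Polynomial.natDegree_sub_C, hP] at this
    simp at this)
  have hev : u * (t.map fun a => u - a).prod = 1 := by
    simpa [P, Polynomial.IsRoot, sub_eq_zero, Polynomial.eval_multiset_prod,
      Multiset.map_map] using hu
  have hprod_le (r : Multiset K) (hr : ∀ a ∈ r, ‖u - a‖ ≤ 1) :
      ‖(r.map fun a => u - a).prod‖ ≤ 1 := by
    induction r using Multiset.induction with
    | empty => simp
    | cons a r ih =>
      rw [Multiset.map_cons, Multiset.prod_cons, norm_mul]
      exact mul_le_one₀ (hr a (by simp)) (norm_nonneg _)
        (ih fun b hb => hr b (Multiset.mem_cons_of_mem hb))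
  have hprod_ge (r : Multiset K) (hr : ∀ a ∈ r, 1 ≤ ‖u - a‖) :
      1 ≤ ‖(r.map fun a => u - a).prod‖ := by
    induction r using Multiset.induction with
    | empty => simp
    | cons a r ih =>
      rw [Multiset.map_cons, Multiset.prod_cons, norm_mul]
      exact one_le_mul_of_one_le_of_one_le (hr a (by simp))
        (ih fun b hb => hr b (Multiset.mem_cons_of_mem hb))
  have htmem {a : K} (ha : a ∈ t) : ‖a‖ ≤ 1 := (Multiset.mem_filter.1 ha).2
  have hu1 : ‖u‖ ≤ 1 := by
    by_contra! h
    have h1 : 1 ≤ ‖(t.map fun a => u - a).prod‖ := hprod_ge t fun a ha => by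
      rw [norm_sub_rev, norm_sub_eq_of_lt ((htmem ha).trans_lt h)]
      exact h.le
    have h2 : ‖u‖ * ‖(t.map fun a => u - a).prod‖ = 1 := by rw [← norm_mul, hev, norm_one]
    nlinarith
  have hle {a : K} (ha : a ∈ t) : ‖u - a‖ ≤ 1 := norm_sub_le_of_le hu1 (htmem ha)
  have hmul_eq {x y : ℝ} (hx0 : 0 ≤ x) (hx : x ≤ 1) (hy : y ≤ 1) (h : x * y = 1) : x = 1 :=
    le_antisymm hx (h ▸ mul_le_of_le_one_right hx0 hy)
  refine ⟨u, ?_, fun a ha => ?_⟩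
  · refine hmul_eq (norm_nonneg _) hu1 (hprod_le t fun a => hle) ?_
    rw [← norm_mul, hev, norm_one]
  · by_cases h1 : ‖a‖ ≤ 1
    · rw [max_eq_left h1]
      have hat : a ∈ t := Multiset.mem_filter.2 ⟨ha, h1⟩
      obtain ⟨r, hr⟩ := Multiset.exists_cons_of_mem hat
      refine hmul_eq (y := ‖u * (r.map fun a => u - a).prod‖) (norm_nonneg _) (hle hat) ?_ ?_
      · rw [norm_mul]
        exact mul_le_one₀ hu1 (norm_nonneg _) (hprod_le r fun b hb => hle (by
          rw [hr]; exact Multiset.mem_cons_of_mem hb))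
      · rw [← norm_mul, ← norm_one (α := K), ← hev, hr, Multiset.map_cons, Multiset.prod_cons]
        congr 1
        ring
    · push Not at h1
      rw [max_eq_right h1.le, norm_sub_eq_of_lt (hu1.trans_lt h1)]

lemma norm_coeff_le_norm_eval_of_generic [IsAlgClosed K] (h : Polynomial K) {u : K}
    (hu : ∀ a ∈ h.roots, ‖u - a‖ = max 1 ‖a‖) (i : ℕ) : ‖h.coeff i‖ ≤ ‖h.eval u‖ := by
  have key (s : Multiset K) (hs : ∀ a ∈ s, ‖u - a‖ = max 1 ‖a‖) (i : ℕ) :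
      ‖((s.map fun a => Polynomial.X - Polynomial.C a).prod).coeff i‖ ≤
        ‖((s.map fun a => Polynomial.X - Polynomial.C a).prod).eval u‖ := by
    induction s using Multiset.induction generalizing i with
    | empty =>
      simp only [Multiset.map_zero, Multiset.prod_zero, Polynomial.eval_one, Polynomial.coeff_one]
      split_ifs <;> simp
    | cons a s ih =>
      rw [Multiset.map_cons, Multiset.prod_cons]
      have ih' := ih fun b hb => hs b (Multiset.mem_cons_of_mem hb)
      set p := (s.map fun a => Polynomial.X - Polynomial.C a).prod
      rw [Polynomial.eval_mul, norm_mul, sub_mul, Polynomial.coeff_sub, Polynomial.coeff_C_mul,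
        Polynomial.eval_sub, Polynomial.eval_X, Polynomial.eval_C, hs a (by simp)]
      refine norm_sub_le_of_le ?_ ?_
      · cases i with
        | zero =>
          rw [Polynomial.mul_coeff_zero, Polynomial.coeff_X_zero, zero_mul, norm_zero]
          positivity
        | succ i =>
          rw [Polynomial.coeff_X_mul]
          exact (ih' i).trans (le_mul_of_one_le_left (norm_nonneg _) (le_max_left _ _))
      · rw [norm_mul]
        exact mul_le_mul (le_max_right _ _) (ih' i) (norm_nonneg _) (by positivity)
  have hsp := (IsAlgClosed.splits h).eq_prod_roots
  rw [hsp, Polynomial.coeff_C_mul, Polynomial.eval_C_mul, norm_mul, norm_mul]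
  exact mul_le_mul_of_nonneg_left (key _ hu i) (norm_nonneg _)

/-- The maximum modulus principle on the unit circle, for two polynomials simultaneously. -/
lemma exists_norm_one_coeff_le_eval₂ [IsAlgClosed K] (f g : Polynomial K) :
    ∃ u : K, ‖u‖ = 1 ∧ (∀ i, ‖f.coeff i‖ ≤ ‖f.eval u‖) ∧ ∀ i, ‖g.coeff i‖ ≤ ‖g.eval u‖ := by
  obtain ⟨u, hu, h⟩ := exists_norm_one_generic (f.roots + g.roots)
  exact ⟨u, hu,
    norm_coeff_le_norm_eval_of_generic f fun a ha => h a (Multiset.mem_add.2 (Or.inl ha)),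
    norm_coeff_le_norm_eval_of_generic g fun a ha => h a (Multiset.mem_add.2 (Or.inr ha))⟩

lemma exists_norm_one_coeff_le_eval [IsAlgClosed K] (f : Polynomial K) :
    ∃ u : K, ‖u‖ = 1 ∧ ∀ i, ‖f.coeff i‖ ≤ ‖f.eval u‖ := by
  obtain ⟨u, hu, h, -⟩ := exists_norm_one_coeff_le_eval₂ f f
  exact ⟨u, hu, h⟩

lemma norm_eval_le {f : Polynomial K} {r : ℝ} (hr : 0 ≤ r) (hf : ∀ i, ‖f.coeff i‖ ≤ r) {x : K}
    (hx : ‖x‖ ≤ 1) : ‖f.eval x‖ ≤ r := by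
  rw [Polynomial.eval_eq_sum_range]
  refine IsUltrametricDist.norm_sum_le_of_forall_le_of_nonneg hr fun i _ => ?_
  rw [norm_mul, norm_pow]
  exact (mul_le_of_le_one_right (norm_nonneg _) (pow_le_one₀ (norm_nonneg _) hx)).trans (hf i)

lemma norm_eval_sub_eval_le {f : Polynomial K} {r : ℝ} (hr : 0 ≤ r) (hf : ∀ i, ‖f.coeff i‖ ≤ r)
    {x y : K} (hx : ‖x‖ ≤ 1) (hy : ‖y‖ ≤ 1) : ‖f.eval x - f.eval y‖ ≤ r * ‖x - y‖ := by
  rw [Polynomial.eval_eq_sum_range, Polynomial.eval_eq_sum_range, ← Finset.sum_sub_distrib]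
  refine IsUltrametricDist.norm_sum_le_of_forall_le_of_nonneg (by positivity) fun i _ => ?_
  rw [← mul_sub, norm_mul]
  exact mul_le_mul (hf i) (norm_pow_sub_pow_le hx hy i) (norm_nonneg _) hr

/-- The exponents of the dominant monomials of `f` on the circle of radius `r`. -/
def dominant (r : ℝ) (f : Polynomial K) : Set ℕ :=
  {k | ∀ i, ‖f.coeff i‖ * r ^ i ≤ ‖f.coeff k‖ * r ^ k}

omit [IsUltrametricDist K] in
lemma dominant_nonempty {r : ℝ} (hr : 0 < r) (f : Polynomial K) : (dominant r f).Nonempty := by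
  by_cases hf : f = 0
  · exact ⟨0, fun i => by simp [hf]⟩
  obtain ⟨k, hk, h⟩ := Finset.exists_max_image f.support (fun i => ‖f.coeff i‖ * r ^ i)
    (Polynomial.support_nonempty.2 hf)
  refine ⟨k, fun i => ?_⟩
  by_cases hi : i ∈ f.support
  · exact h i hi
  · rw [Polynomial.notMem_support_iff.1 hi, norm_zero, zero_mul]
    positivity

omit [IsUltrametricDist K] in
lemma coeff_ne_zero_of_mem_dominant {r : ℝ} (hr : 0 < r) {f : Polynomial K} (hf : f ≠ 0) {k : ℕ}
    (hk : k ∈ dominant r f) : f.coeff k ≠ 0 := by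
  intro h0
  refine hf (Polynomial.ext fun i => ?_)
  have := hk i
  rw [h0, norm_zero, zero_mul] at this
  have h1 : ‖f.coeff i‖ ≤ 0 := nonpos_of_mul_nonpos_left this (pow_pos hr i)
  simpa using h1

omit [IsUltrametricDist K] in
lemma dominant_mono {r r' : ℝ} (hr' : 0 < r') (h : r' < r) {f : Polynomial K} (hf : f ≠ 0)
    {k k' : ℕ} (hk : k ∈ dominant r f) (hk' : k' ∈ dominant r' f) : k' ≤ k := by
  by_contra! hlt
  have hc : 0 < ‖f.coeff k'‖ := norm_pos_iff.2 (coeff_ne_zero_of_mem_dominant hr' hf hk')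
  have h1 := hk k'
  have h2 := hk' k
  obtain ⟨j, rfl⟩ := Nat.exists_eq_add_of_lt hlt
  have hr := hr'.trans h
  rw [add_assoc, pow_add, ← mul_assoc, mul_right_comm] at h1 h2
  have h1' := le_of_mul_le_mul_right h1 (pow_pos hr k)
  have h2' := le_of_mul_le_mul_right h2 (pow_pos hr' k)
  have h3 : r' ^ (j + 1) < r ^ (j + 1) := pow_lt_pow_left₀ h hr'.le (by omega)
  rw [add_assoc] at hc
  nlinarith [mul_lt_mul_of_pos_left h3 hc]

lemma comparison [IsAlgClosed K] {P Q : Polynomial K} {A B : ℝ}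
    (hA : ∀ i, ‖P.coeff i‖ ≤ A) (hB : ∀ i, ‖Q.coeff i‖ ≤ B)
    (hA' : ∃ i, ‖P.coeff i‖ = A) (hB' : ∃ i, ‖Q.coeff i‖ = B)
    (h : ∀ u : K, ‖u‖ = 1 → ‖P.eval u - Q.eval u‖ < max A B) :
    A = B ∧ ∀ k, ‖P.coeff k‖ = A ↔ ‖Q.coeff k‖ = B := by
  obtain ⟨u, hu, hc⟩ := exists_norm_one_coeff_le_eval (P - Q)
  have hlt (i : ℕ) : ‖P.coeff i - Q.coeff i‖ < max A B := by
    rw [← Polynomial.coeff_sub]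
    refine (hc i).trans_lt ?_
    rw [Polynomial.eval_sub]
    exact h u hu
  have hAB : A = B := by
    rcases lt_trichotomy A B with hAB | hAB | hAB
    · obtain ⟨i, hi⟩ := hB'
      have := hlt i
      rw [max_eq_right hAB.le, norm_sub_eq_of_lt ((hA i).trans_lt (hi ▸ hAB)), hi] at this
      exact absurd this (lt_irrefl _)
    · exact hAB
    · obtain ⟨i, hi⟩ := hA'
      have := hlt i
      rw [max_eq_left hAB.le, norm_sub_rev, norm_sub_eq_of_lt ((hB i).trans_lt (hi ▸ hAB)),
        hi] at this
      exact absurd this (lt_irrefl _)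
  subst hAB
  refine ⟨rfl, fun k => ?_⟩
  have := hlt k
  rw [max_self] at this
  constructor <;> intro hk
  · rw [norm_sub_rev, ← hk] at this
    rw [norm_eq_of_norm_sub_lt this, hk]
  · rw [← hk] at this
    rw [norm_eq_of_norm_sub_lt this, hk]

/-- The function `w / (1 - w)²` whose translates by powers of `q` make up Tate's series. -/
def tateBase (w : K) : K := w / (1 - w) ^ 2

omit [IsUltrametricDist K] in
lemma tateTerm_eq (q w : K) (m : ℕ) :
    tateTerm K q w m = tateBase (q ^ m * w) + tateBase (q ^ m * w⁻¹) - 2 * tateBase (q ^ m) :=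
  rfl

lemma norm_one_sub_of_lt {w : K} (hw : ‖w‖ < 1) : ‖1 - w‖ = 1 := by
  rw [norm_sub_rev, norm_sub_eq_of_lt (by rwa [norm_one]), norm_one]

lemma norm_tateBase {w : K} (hw : ‖w‖ < 1) : ‖tateBase w‖ = ‖w‖ := by
  rw [tateBase, norm_div, norm_pow, norm_one_sub_of_lt hw, one_pow, div_one]

omit [IsUltrametricDist K] in
lemma tateBase_inv (w : K) : tateBase w⁻¹ = tateBase w := by
  rcases eq_or_ne w 0 with rfl | h0
  · simp
  rcases eq_or_ne w 1 with rfl | h1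
  · simp
  have : 1 - w ≠ 0 := sub_ne_zero.2 h1.symm
  have h2 : w - 1 ≠ 0 := sub_ne_zero.2 h1
  rw [tateBase, tateBase, show 1 - w⁻¹ = (w - 1) / w by field_simp]
  field_simp
  ring

lemma norm_tateBase_sub {w : K} (hw0 : w ≠ 0) (hw : ‖w‖ < 1) : ‖tateBase w - w‖ < ‖w‖ := by
  have h1 := norm_one_sub_of_lt hw
  have h2 : 1 - w ≠ 0 := norm_pos_iff.1 (by rw [h1]; exact one_pos)
  rw [tateBase, show w / (1 - w) ^ 2 - w = w * (w * (1 + (1 - w))) / (1 - w) ^ 2 by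
    field_simp; ring, norm_div, norm_pow, h1, one_pow, div_one, norm_mul, norm_mul]
  have h3 : ‖1 + (1 - w)‖ ≤ 1 := norm_add_le_of_le (by simp) h1.le
  have h4 := norm_pos_iff.2 hw0
  exact mul_lt_of_lt_one_right h4 ((mul_le_of_le_one_right h4.le h3).trans_lt hw)

lemma norm_tateTerm_le {q w : K} (hw1 : ‖w‖ ^ 2 < 1) (hqw : ‖q‖ < ‖w‖ ^ 2)
    (m : ℕ) : ‖tateTerm K q w (m + 1)‖ ≤ ‖q‖ / ‖w‖ := by
  have hw : ‖w‖ < 1 := by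
    by_contra! h
    exact absurd hw1 (not_lt.2 (one_le_pow₀ h))
  have hw0 : 0 < ‖w‖ := by
    by_contra! h
    have : ‖w‖ = 0 := le_antisymm h (norm_nonneg _)
    rw [this] at hqw
    exact absurd hqw (not_lt.2 (by simp))
  have hq : ‖q‖ < 1 := hqw.trans hw1
  have hqm : ‖q ^ (m + 1)‖ ≤ ‖q‖ := by
    rw [norm_pow, pow_succ]
    exact mul_le_of_le_one_left (norm_nonneg _) (pow_le_one₀ (norm_nonneg _) hq.le)
  have hdiv : ‖q‖ ≤ ‖q‖ / ‖w‖ := le_div_self (norm_nonneg _) hw0 hw.le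
  have h1 : ‖q ^ (m + 1) * w‖ ≤ ‖q‖ := by
    rw [norm_mul]
    exact (mul_le_of_le_one_right (norm_nonneg _) hw.le).trans hqm
  have h2 : ‖q ^ (m + 1) * w⁻¹‖ ≤ ‖q‖ / ‖w‖ := by
    rw [norm_mul, norm_inv, ← div_eq_mul_inv]
    exact div_le_div_of_nonneg_right hqm hw0.le
  have h3 : ‖q‖ / ‖w‖ < 1 := by
    rw [div_lt_one hw0]
    nlinarith
  rw [tateTerm_eq]
  refine norm_sub_le_of_le (norm_add_le_of_le ?_ ?_) ?_
  · rw [norm_tateBase (h1.trans_lt hq)]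
    exact h1.trans hdiv
  · rwa [norm_tateBase (h2.trans_lt h3)]
  · rw [norm_mul, norm_tateBase (hqm.trans_lt hq)]
    refine (mul_le_of_le_one_left (norm_nonneg _) ?_).trans (hqm.trans hdiv)
    rw [← one_add_one_eq_two]
    exact norm_add_le_of_le (by simp) (by simp)

lemma norm_xTate_sub_lt {q w : K} (hw1 : ‖w‖ ^ 2 < 1) (hqw : ‖q‖ < ‖w‖ ^ 2) :
    ‖xTate K q w - w‖ < ‖w‖ := by
  have hw : ‖w‖ < 1 := by
    by_contra! h
    exact absurd hw1 (not_lt.2 (one_le_pow₀ h))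
  have hw0 : w ≠ 0 := by
    rintro rfl
    simp only [norm_zero, ne_eq, OfNat.ofNat_ne_zero, not_false_eq_true, zero_pow] at hqw
    exact absurd hqw (not_lt.2 (norm_nonneg _))
  have hpos := norm_pos_iff.2 hw0
  have hts : ‖∑' m : ℕ, tateTerm K q w (m + 1)‖ ≤ ‖q‖ / ‖w‖ :=
    IsUltrametricDist.norm_tsum_le_of_forall_le_of_nonneg (by positivity)
      fun m => norm_tateTerm_le hw1 hqw m
  rw [show xTate K q w - w = (tateBase w - w) + ∑' m : ℕ, tateTerm K q w (m + 1) by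
    rw [xTate, tateBase]; ring]
  refine norm_add_lt_of_lt (norm_tateBase_sub hw0 hw) (hts.trans_lt ?_)
  rw [div_lt_iff₀ hpos]
  nlinarith

omit [IsUltrametricDist K] in
lemma xTate_inv (q w : K) : xTate K q w⁻¹ = xTate K q w := by
  have h (m : ℕ) : tateTerm K q w⁻¹ m = tateTerm K q w m := by
    rw [tateTerm_eq, tateTerm_eq, inv_inv]
    ring
  have h1 := tateBase_inv w
  rw [tateBase, tateBase] at h1
  simp only [xTate, h, h1]

section tate

variable [CompleteSpace K]

lemma summable_tateBase {q : K} (hq : ‖q‖ < 1) (w : K) :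
    Summable fun m : ℕ => tateBase (q ^ (m + 1) * w) := by
  refine NonarchimedeanAddGroup.summable_of_tendsto_cofinite_zero ?_
  rw [Nat.cofinite_eq_atTop]
  have h0 : Filter.Tendsto (fun m : ℕ => q ^ (m + 1) * w) Filter.atTop (nhds 0) := by
    have := (tendsto_pow_atTop_nhds_zero_of_norm_lt_one hq).comp (Filter.tendsto_add_atTop_nat 1)
    simpa using this.mul_const w
  have hc : ContinuousAt (tateBase : K → K) 0 := by
    unfold tateBase
    exact continuousAt_id.div (by fun_prop) (by simp)
  have := hc.tendsto.comp h0
  rwa [show (tateBase 0 : K) = 0 by simp [tateBase]] at this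

lemma xTate_eq {q : K} (hq : ‖q‖ < 1) (w : K) :
    xTate K q w = tateBase w + ((∑' m : ℕ, tateBase (q ^ (m + 1) * w)) +
      (∑' m : ℕ, tateBase (q ^ (m + 1) * w⁻¹)) - 2 * ∑' m : ℕ, tateBase (q ^ (m + 1))) := by
  have h1 : Summable fun m : ℕ => tateBase (q ^ (m + 1)) := by
    simpa using summable_tateBase hq (1 : K)
  rw [xTate, ← tateBase, ← tsum_mul_left, ← (summable_tateBase hq w).tsum_add
    (summable_tateBase hq w⁻¹), ← ((summable_tateBase hq w).add
    (summable_tateBase hq w⁻¹)).tsum_sub (h1.mul_left 2)]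
  rfl

lemma tsum_tateBase_eq {q : K} (hq : ‖q‖ < 1) (w : K) :
    ∑' m : ℕ, tateBase (q ^ (m + 1) * w) =
      tateBase (q * w) + ∑' m : ℕ, tateBase (q ^ (m + 1) * (q * w)) := by
  rw [(summable_tateBase hq w).tsum_eq_zero_add]
  simp only [zero_add, pow_zero, one_mul, pow_succ, mul_assoc]

lemma xTate_q_mul {q : K} (hq0 : q ≠ 0) (hq : ‖q‖ < 1) (w : K) :
    xTate K q (q * w) = xTate K q w := by
  rw [xTate_eq hq, xTate_eq hq, tsum_tateBase_eq hq w, tsum_tateBase_eq hq (q * w)⁻¹,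
    mul_inv, mul_inv_cancel_left₀ hq0, tateBase_inv w]
  ring

lemma xTate_q_pow_mul {q : K} (hq0 : q ≠ 0) (hq : ‖q‖ < 1) (j : ℕ) (w : K) :
    xTate K q (q ^ j * w) = xTate K q w := by
  induction j with
  | zero => simp
  | succ j ih => rw [pow_succ', mul_assoc, xTate_q_mul hq0 hq, ih]

end tate

section Forms

variable {k : Type*} [Field k]

/-- The coefficient of `X₀ ^ (d - i) * X₁ ^ i`. -/
def formCoeff (d : ℕ) (F : MvPolynomial (Fin 2) k) (i : ℕ) : k :=
  MvPolynomial.coeff (Finsupp.single 0 (d - i) + Finsupp.single 1 i) F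

lemma eq_sum_formCoeff {d : ℕ} {F : MvPolynomial (Fin 2) k} (hF : F.IsHomogeneous d) :
    F = ∑ i ∈ Finset.range (d + 1), C (formCoeff d F i) * X 0 ^ (d - i) * X 1 ^ i := by
  ext m
  rw [MvPolynomial.coeff_sum]
  have hterm (i : ℕ) : (C (formCoeff d F i) * X 0 ^ (d - i) * X 1 ^ i : MvPolynomial (Fin 2) k) =
      MvPolynomial.monomial (Finsupp.single 0 (d - i) + Finsupp.single 1 i) (formCoeff d F i) := by
    rw [MvPolynomial.X_pow_eq_monomial, MvPolynomial.X_pow_eq_monomial,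
      MvPolynomial.C_mul_monomial, MvPolynomial.monomial_mul, mul_one, mul_one]
  simp only [hterm, MvPolynomial.coeff_monomial]
  by_cases hm : m 0 + m 1 = d
  · rw [Finset.sum_eq_single (m 1)]
    · have : Finsupp.single 0 (d - m 1) + Finsupp.single 1 (m 1) = m := by
        ext j
        fin_cases j
        · simp; omega
        · simp
      rw [if_pos this, formCoeff, this]
    · intro i _ hi
      refine if_neg fun h => hi ?_
      rw [← h]
      simp
    · intro h
      exact absurd (Finset.mem_range.2 (by omega)) h
  · rw [Finset.sum_eq_zero]
    · by_contra hne
      have := hF hne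
      rw [Finsupp.weight_apply, Finsupp.sum_fintype _ _ (by simp)] at this
      simp at this
      exact hm this
    · intro i hi
      have := Finset.mem_range.1 hi
      refine if_neg fun h => hm ?_
      rw [← h]
      simp
      omega

lemma aeval_eq_sum {A : Type*} [CommRing A] [Algebra k A] {d : ℕ} {F : MvPolynomial (Fin 2) k}
    (hF : F.IsHomogeneous d) (x y : A) :
    MvPolynomial.aeval ![x, y] F = ∑ i ∈ Finset.range (d + 1),
      algebraMap k A (formCoeff d F i) * x ^ (d - i) * y ^ i := by
  conv_lhs => rw [eq_sum_formCoeff hF]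
  simp

lemma eval_eq_sum {d : ℕ} {F : MvPolynomial (Fin 2) k} (hF : F.IsHomogeneous d) (x y : k) :
    MvPolynomial.eval ![x, y] F = ∑ i ∈ Finset.range (d + 1),
      formCoeff d F i * x ^ (d - i) * y ^ i := by
  conv_lhs => rw [eq_sum_formCoeff hF]
  simp

/-- The dehomogenization `F(1, T)`. -/
def dehom (F : MvPolynomial (Fin 2) k) : Polynomial k :=
  MvPolynomial.aeval ![1, Polynomial.X] F

lemma eval_dehom (F : MvPolynomial (Fin 2) k) (x : k) :
    (dehom F).eval x = MvPolynomial.eval ![1, x] F := by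
  rw [dehom, ← Polynomial.coe_aeval_eq_eval, MvPolynomial.comp_aeval_apply, MvPolynomial.eval,
    MvPolynomial.coe_eval₂Hom, MvPolynomial.aeval_def]
  congr 1
  ext i
  fin_cases i <;> simp

lemma dehom_coeff {d : ℕ} {F : MvPolynomial (Fin 2) k} (hF : F.IsHomogeneous d) (i : ℕ) :
    (dehom F).coeff i = if i ≤ d then formCoeff d F i else 0 := by
  rw [dehom, aeval_eq_sum hF]
  simp only [one_pow, mul_one, Polynomial.finsetSum_coeff, ← Polynomial.C_eq_algebraMap,
    Polynomial.coeff_C_mul_X_pow]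
  simp

lemma natDegree_aeval_le {d e : ℕ} {F : MvPolynomial (Fin 2) k} (hF : F.IsHomogeneous d)
    {f g : Polynomial k} (hf : f.natDegree ≤ e) (hg : g.natDegree ≤ e) :
    (MvPolynomial.aeval ![f, g] F).natDegree ≤ d * e := by
  rw [aeval_eq_sum hF]
  refine Polynomial.natDegree_sum_le_of_forall_le _ _ fun i hi => ?_
  have hi := Finset.mem_range.1 hi
  rw [mul_assoc, ← Polynomial.C_eq_algebraMap]
  refine (Polynomial.natDegree_C_mul_le _ _).trans ?_
  refine Polynomial.natDegree_mul_le.trans ?_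
  refine (add_le_add (Polynomial.natDegree_pow_le_of_le _ hf)
    (Polynomial.natDegree_pow_le_of_le _ hg)).trans ?_
  rw [← add_mul]
  exact Nat.mul_le_mul_right _ (by omega)

lemma natDegree_dehom_le {d : ℕ} {F : MvPolynomial (Fin 2) k} (hF : F.IsHomogeneous d) :
    (dehom F).natDegree ≤ d := by
  simpa [dehom] using
    natDegree_aeval_le hF (f := 1) (g := Polynomial.X) (e := 1) (by simp) (by simp)

/-- The linear form with coefficient vector `p`. -/
def linForm (p : k × k) : MvPolynomial (Fin 2) k := C p.1 * X 0 + C p.2 * X 1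

lemma exists_eq_prod_linForm [IsAlgClosed k] {d : ℕ} {F : MvPolynomial (Fin 2) k}
    (hF : F.IsHomogeneous d) :
    ∃ (c : k) (s : Multiset (k × k)), s.card = d ∧ F = C c * (s.map linForm).prod := by
  set f : Polynomial k := MvPolynomial.aeval ![Polynomial.X, 1] F with hf
  have hdeg : f.natDegree ≤ d := by
    simpa using natDegree_aeval_le hF (f := Polynomial.X) (g := 1) (e := 1) (by simp) (by simp)
  have hsp := IsAlgClosed.splits f
  have hcard : f.roots.card ≤ d := (Polynomial.card_roots' f).trans hdeg
  have hhom (s : Multiset k) :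
      ((s.map fun a => Polynomial.X - Polynomial.C a).prod).homogenize s.card =
        ((s.map fun a => ((1, -a) : k × k)).map linForm).prod := by
    induction s using Multiset.induction with
    | empty => simp
    | cons a s ih =>
      rw [Multiset.map_cons, Multiset.prod_cons, Multiset.card_cons, add_comm,
        Polynomial.homogenize_mul _ _ (Polynomial.natDegree_X_sub_C_le a), ih]
      · simp [linForm, sub_eq_add_neg]
      · rw [Polynomial.natDegree_multiset_prod_X_sub_C_eq_card]
  refine ⟨f.leadingCoeff, f.roots.map (fun a => ((1, -a) : k × k)) +
    Multiset.replicate (d - f.roots.card) (0, 1), by simp; omega, ?_⟩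
  rw [← Polynomial.homogenize_eq_of_isHomogeneous hF hf.symm]
  conv_lhs => rw [hsp.eq_prod_roots, Polynomial.homogenize_C_mul,
    ← mul_one (f.roots.map fun a => Polynomial.X - Polynomial.C a).prod,
    show d = f.roots.card + (d - f.roots.card) by omega]
  rw [Polynomial.homogenize_mul _ _
    (by rw [Polynomial.natDegree_multiset_prod_X_sub_C_eq_card]) (by simp), hhom]
  simp [linForm]

lemma resultant_mul_right' {f g₁ g₂ : Polynomial k} {m n₁ n₂ : ℕ} (hf : f.natDegree ≤ m)
    (h₁ : g₁.natDegree ≤ n₁) (h₂ : g₂.natDegree ≤ n₂) :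
    Polynomial.resultant f (g₁ * g₂) m (n₁ + n₂) =
      Polynomial.resultant f g₁ m n₁ * Polynomial.resultant f g₂ m n₂ := by
  obtain ⟨k₁, rfl⟩ := Nat.exists_eq_add_of_le h₁
  obtain ⟨k₂, rfl⟩ := Nat.exists_eq_add_of_le h₂
  rw [add_add_add_comm, Polynomial.resultant_add_right_deg _ _ _ _ _ Polynomial.natDegree_mul_le,
    Polynomial.resultant_add_right_deg _ _ _ _ _ le_rfl,
    Polynomial.resultant_add_right_deg _ _ _ _ _ le_rfl, Polynomial.resultant_mul_right _ _ _ _ hf]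
  ring

lemma natDegree_multiset_prod_le' {ι : Type*} (g : ι → Polynomial k) (e : ℕ)
    (hg : ∀ i, (g i).natDegree ≤ e) (t : Multiset ι) :
    ((t.map g).prod).natDegree ≤ t.card * e := by
  induction t using Multiset.induction with
  | empty => simp
  | cons a t ih =>
    rw [Multiset.map_cons, Multiset.prod_cons, Multiset.card_cons, add_comm, add_mul, one_mul]
    exact Polynomial.natDegree_mul_le.trans (add_le_add (hg a) ih)

lemma resultant_multiset_prod_right {ι : Type*} {f : Polynomial k} {m : ℕ} (hf : f.natDegree ≤ m)
    (g : ι → Polynomial k) (e : ℕ) (hg : ∀ i, (g i).natDegree ≤ e) (t : Multiset ι) :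
    Polynomial.resultant f (t.map g).prod m (t.card * e) =
      (t.map fun i => Polynomial.resultant f (g i) m e).prod := by
  induction t using Multiset.induction with
  | empty => simp
  | cons a t ih =>
    rw [Multiset.map_cons, Multiset.prod_cons, Multiset.card_cons, add_comm, add_mul, one_mul,
      resultant_mul_right' hf (hg a) (natDegree_multiset_prod_le' g e hg t), ih,
      Multiset.map_cons, Multiset.prod_cons]

lemma resultant_multiset_prod_left {ι : Type*} {f : Polynomial k} {m : ℕ} (hf : f.natDegree ≤ m)
    (g : ι → Polynomial k) (e : ℕ) (hg : ∀ i, (g i).natDegree ≤ e) (t : Multiset ι) :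
    Polynomial.resultant (t.map g).prod f (t.card * e) m =
      (t.map fun i => Polynomial.resultant (g i) f e m).prod := by
  rw [Polynomial.resultant_comm, resultant_multiset_prod_right hf g e hg]
  simp_rw [Polynomial.resultant_comm (g _) f e m]
  rw [Multiset.prod_map_mul, Multiset.map_const', Multiset.prod_replicate, ← pow_mul]
  congr 2
  ring

lemma resultant_linear_comb {f g : Polynomial k} {e : ℕ} (hf : f.natDegree ≤ e)
    (hg : g.natDegree ≤ e) (α β γ δ : k) :
    Polynomial.resultant (Polynomial.C α * f + Polynomial.C β * g)
      (Polynomial.C γ * f + Polynomial.C δ * g) e e =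
      (α * δ - β * γ) ^ e * Polynomial.resultant f g e e := by
  have hlin (a b : k) : (Polynomial.C a * f + Polynomial.C b * g).natDegree ≤ e :=
    (Polynomial.natDegree_add_le_of_degree_le ((Polynomial.natDegree_C_mul_le _ _).trans hf)
      ((Polynomial.natDegree_C_mul_le _ _).trans hg))
  by_cases hα : α = 0
  · subst hα
    rw [Polynomial.C_0, zero_mul, zero_add, Polynomial.resultant_C_mul_left,
      show Polynomial.C γ * f + Polynomial.C δ * g =
        Polynomial.C γ * f + g * Polynomial.C δ by ring,
      Polynomial.resultant_add_mul_right _ _ _ _ _ (by simp) hg, Polynomial.resultant_C_mul_right,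
      Polynomial.resultant_comm, zero_mul, zero_sub, neg_pow (β * γ), mul_pow]
    rcases Nat.even_or_odd e with he | he
    · rw [(he.mul_right e).neg_one_pow, he.neg_one_pow]
      ring
    · rw [(he.mul he).neg_one_pow, he.neg_one_pow]
      ring
  · rw [show Polynomial.C γ * f + Polynomial.C δ * g =
        Polynomial.C ((α * δ - β * γ) / α) * g +
          (Polynomial.C α * f + Polynomial.C β * g) * Polynomial.C (γ / α) by
        rw [show δ = (α * δ - β * γ) / α + β * (γ / α) by field_simp; ring,
          show Polynomial.C γ = Polynomial.C α * Polynomial.C (γ / α) by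
            rw [← Polynomial.C_mul]; congr 1; field_simp]
        rw [show (α * ((α * δ - β * γ) / α + β * (γ / α)) - β * γ) / α = (α * δ - β * γ) / α by
          field_simp; ring]
        simp only [Polynomial.C_add, Polynomial.C_mul]
        ring,
      Polynomial.resultant_add_mul_right _ _ _ _ _ (by simp) (hlin α β),
      Polynomial.resultant_C_mul_right,
      show Polynomial.C α * f + Polynomial.C β * g =
        Polynomial.C α * f + g * Polynomial.C β by ring,
      Polynomial.resultant_add_mul_left _ _ _ _ _ (by simp) hg, Polynomial.resultant_C_mul_left,
      ← mul_assoc, ← mul_pow]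
    congr 2
    field_simp

end Forms

section Resultant

variable {k : Type*} [Field k]

lemma bres_eq_resultant {e : ℕ} {F G : MvPolynomial (Fin 2) k} (hF : F.IsHomogeneous e)
    (hG : G.IsHomogeneous e) :
    bres e F G = Polynomial.resultant (dehom G) (dehom F) e e := by
  rw [bres, ← Matrix.det_transpose, Polynomial.resultant]
  congr 1
  ext i j
  rw [Matrix.transpose_apply, sylv, Matrix.of_apply, Polynomial.sylvester, Matrix.of_apply]
  induction j using Fin.addCases with
  | left j =>
    rw [Fin.addCases_left, dif_pos (by simp)]
    by_cases h : (j : ℕ) ≤ (i : ℕ) ∧ (i : ℕ) ≤ (j : ℕ) + e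
    · rw [dif_pos (by simpa using h), if_pos (by simpa using h), dehom_coeff hF,
        if_pos (by omega)]
      rfl
    · rw [dif_neg (by simpa using h), if_neg (by simpa using h)]
  | right j =>
    rw [Fin.addCases_right, dif_neg (by simp)]
    by_cases h : (j : ℕ) ≤ (i : ℕ) ∧ (i : ℕ) ≤ (j : ℕ) + e
    · rw [dif_pos (by simp; omega), if_pos (by simpa using h), dehom_coeff hG,
        if_pos (by omega)]
      simp [coeffVec, formCoeff]
    · rw [dif_neg (by simp; omega), if_neg (by simpa using h)]

/-- The product of all determinants of a vector in `s` and a vector in `t`. -/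
def detProd (s t : Multiset (k × k)) : k :=
  (s.map fun p => (t.map fun r => p.1 * r.2 - p.2 * r.1).prod).prod

lemma resultant_aeval {c c' : k} {s t : Multiset (k × k)} {d e : ℕ} (hs : s.card = d)
    (ht : t.card = d) {f g : Polynomial k} (hf : f.natDegree ≤ e) (hg : g.natDegree ≤ e) :
    Polynomial.resultant (MvPolynomial.aeval ![f, g] (C c * (s.map linForm).prod))
      (MvPolynomial.aeval ![f, g] (C c' * (t.map linForm).prod)) (d * e) (d * e) =
      c ^ (d * e) * c' ^ (d * e) * detProd s t ^ e * Polynomial.resultant f g e e ^ (d * d) := by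
  have hae (u : Multiset (k × k)) : MvPolynomial.aeval ![f, g] (u.map linForm).prod =
      (u.map fun p : k × k => Polynomial.C p.1 * f + Polynomial.C p.2 * g).prod := by
    rw [map_multiset_prod, Multiset.map_map]
    simp [linForm, Function.comp_def, Polynomial.C_eq_algebraMap]
  have hlin (p : k × k) : (Polynomial.C p.1 * f + Polynomial.C p.2 * g).natDegree ≤ e :=
    (Polynomial.natDegree_add_le_of_degree_le ((Polynomial.natDegree_C_mul_le _ _).trans hf)
      ((Polynomial.natDegree_C_mul_le _ _).trans hg))
  have ht' : ((t.map fun p : k × k => Polynomial.C p.1 * f + Polynomial.C p.2 * g).prod).natDegree ≤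
      d * e := ht ▸ natDegree_multiset_prod_le' _ e hlin t
  rw [map_mul, map_mul, hae, hae, MvPolynomial.algHom_C, MvPolynomial.algHom_C,
    ← Polynomial.C_eq_algebraMap, ← Polynomial.C_eq_algebraMap, Polynomial.resultant_C_mul_left,
    Polynomial.resultant_C_mul_right]
  have h1 := resultant_multiset_prod_left ht' _ e hlin s
  rw [hs] at h1
  rw [h1]
  have h2 (p : k × k) := resultant_multiset_prod_right (hlin p) _ e hlin t
  simp only [ht] at h2
  simp only [h2, resultant_linear_comb hf hg, Multiset.prod_map_mul, Multiset.prod_map_pow,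
    Multiset.map_const', Multiset.prod_replicate, ht, hs, detProd]
  ring

lemma dehom_comp2 (F f g : MvPolynomial (Fin 2) k) :
    dehom (comp2 F f g) = MvPolynomial.aeval ![dehom f, dehom g] F := by
  rw [dehom, comp2, MvPolynomial.comp_aeval_apply]
  congr 2
  ext i
  fin_cases i <;> rfl

lemma isHomogeneous_comp2 {d e : ℕ} {F f g : MvPolynomial (Fin 2) k} (hF : F.IsHomogeneous d)
    (hf : f.IsHomogeneous e) (hg : g.IsHomogeneous e) : (comp2 F f g).IsHomogeneous (d * e) := by
  rw [comp2, aeval_eq_sum hF]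
  refine MvPolynomial.IsHomogeneous.sum _ _ _ fun i hi => ?_
  have hi := Finset.mem_range.1 hi
  have := ((MvPolynomial.isHomogeneous_C (Fin 2) (formCoeff d F i)).mul (hf.pow (d - i))).mul
    (hg.pow i)
  rwa [zero_add, ← mul_add, Nat.sub_add_cancel (by omega), mul_comm e d] at this

/-- Up to sign, the resultant of a composition of pairs of binary forms. -/
lemma bres_comp2 [IsAlgClosed k] {d e : ℕ} {F G f g : MvPolynomial (Fin 2) k}
    (hF : F.IsHomogeneous d) (hG : G.IsHomogeneous d) (hf : f.IsHomogeneous e)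
    (hg : g.IsHomogeneous e) :
    ∃ s : k, s ^ 2 = 1 ∧ bres (d * e) (comp2 F f g) (comp2 G f g) =
      s * (bres d F G ^ e * bres e f g ^ (d * d)) := by
  have hsq (n : ℕ) : (((-1 : k)) ^ n) ^ 2 = 1 := by rw [← pow_mul, mul_comm, pow_mul]; simp
  obtain ⟨c, s, hs, rfl⟩ := exists_eq_prod_linForm hF
  obtain ⟨c', t, ht, rfl⟩ := exists_eq_prod_linForm hG
  have hone : Polynomial.resultant (1 : Polynomial k) Polynomial.X 1 1 = -1 := by
    rw [Polynomial.resultant_one_left]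
    simp
  have h1 := resultant_aeval (c := c) (c' := c') hs ht (f := 1) (g := Polynomial.X) (e := 1)
    (by simp) (by simp)
  have h2 := resultant_aeval (c := c) (c' := c') hs ht (natDegree_dehom_le hf)
    (natDegree_dehom_le hg)
  rw [← dehom, ← dehom, mul_one, pow_one, hone] at h1
  rw [← dehom_comp2, ← dehom_comp2] at h2
  rw [bres_eq_resultant hF hG, bres_eq_resultant hf hg, bres_eq_resultant
    (isHomogeneous_comp2 hF hf hg) (isHomogeneous_comp2 hG hf hg), Polynomial.resultant_comm,
    Polynomial.resultant_comm (dehom (C c' * _)), Polynomial.resultant_comm (dehom g), h1, h2]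
  have hsign {a b c x y : k} (n l : ℕ) (ha : a ^ 2 = 1) (hb : b ^ 2 = 1) (hc : c ^ 2 = 1) :
      ∃ s : k, s ^ 2 = 1 ∧ a * (x ^ n * y ^ l) = s * ((b * x) ^ n * (c * y) ^ l) := by
    have hb' : (b ^ n) ^ 2 = 1 := by rw [← pow_mul, mul_comm, pow_mul, hb, one_pow]
    have hc' : (c ^ l) ^ 2 = 1 := by rw [← pow_mul, mul_comm, pow_mul, hc, one_pow]
    refine ⟨a * b ^ n * c ^ l, by rw [mul_pow, mul_pow, ha, hb', hc', one_mul, one_mul], ?_⟩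
    rw [mul_pow, mul_pow]
    linear_combination -(a * x ^ n * y ^ l) * ((b ^ n) ^ 2 * hc' + hb')
  obtain ⟨s', hs', h⟩ := hsign (x := c ^ d * c' ^ d * detProd s t)
    (y := Polynomial.resultant (dehom f) (dehom g) e e) e (d * d) (hsq (d * e * (d * e)))
    (b := (-1) ^ (d * d) * (-1) ^ (d * d)) (by rw [mul_pow, hsq, one_mul]) (hsq (e * e))
  refine ⟨s', hs', ?_⟩
  convert h using 2 <;> ring

lemma exists_linForm_root (p : k × k) : ∃ x y : k, ¬(x = 0 ∧ y = 0) ∧ p.1 * x + p.2 * y = 0 := by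
  by_cases h : p.1 = 0
  · exact ⟨1, 0, by simp, by simp [h]⟩
  · exact ⟨-p.2, p.1, by simp [h], by ring⟩

lemma eval_linForm (p : k × k) (x y : k) :
    MvPolynomial.eval ![x, y] (linForm p) = p.1 * x + p.2 * y := by
  simp [linForm]

lemma linForm_dvd_of_eval_eq_zero [IsAlgClosed k] {d : ℕ}
    {F : MvPolynomial (Fin 2) k} (hF : F.IsHomogeneous d) {x y : k} (hxy : ¬(x = 0 ∧ y = 0))
    (h : MvPolynomial.eval ![x, y] F = 0) : linForm (y, -x) ∣ F := by
  obtain ⟨c, s, hs, rfl⟩ := exists_eq_prod_linForm hF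
  rw [map_mul, mul_eq_zero, MvPolynomial.eval_C] at h
  rcases h with rfl | h
  · simp
  rw [map_multiset_prod, Multiset.prod_eq_zero_iff, Multiset.map_map, Multiset.mem_map] at h
  obtain ⟨p, hp, h⟩ := h
  rw [Function.comp_apply, eval_linForm] at h
  refine Dvd.dvd.mul_left (dvd_trans ?_ (Multiset.dvd_prod (Multiset.mem_map_of_mem _ hp))) _
  by_cases hy : y = 0
  · subst hy
    have hx : x ≠ 0 := fun hx => hxy ⟨hx, rfl⟩
    have hp1 : p.1 = 0 := by simpa [hx] using h
    refine ⟨C (-p.2 / x), ?_⟩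
    simp only [linForm, hp1, C_0, zero_mul, zero_add]
    rw [mul_right_comm, ← C_mul]
    congr 2
    field_simp
  · refine ⟨C (p.1 / y), ?_⟩
    have hp2 : p.2 = -x * (p.1 / y) := by
      field_simp
      linear_combination h
    have hp1 : p.1 = y * (p.1 / y) := by field_simp
    generalize p.1 / y = z at hp1 hp2
    simp only [linForm, hp1, hp2, C_mul]
    ring

lemma no_common_zero [IsAlgClosed k] {d : ℕ} {F G : MvPolynomial (Fin 2) k}
    (hF : F.IsHomogeneous d) (hG : G.IsHomogeneous d) (hFG : IsRelPrime F G) {x y : k}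
    (hxy : ¬(x = 0 ∧ y = 0)) (h1 : MvPolynomial.eval ![x, y] F = 0)
    (h2 : MvPolynomial.eval ![x, y] G = 0) : False := by
  have hu := hFG (linForm_dvd_of_eval_eq_zero hF hxy h1)
    (linForm_dvd_of_eval_eq_zero hG hxy h2)
  have := hu.map (MvPolynomial.eval ![x, y])
  rw [eval_linForm, isUnit_iff_ne_zero] at this
  exact this (by ring)

lemma bres_ne_zero [IsAlgClosed k] {d : ℕ} (hd : 0 < d) {F G : MvPolynomial (Fin 2) k}
    (hF : F.IsHomogeneous d) (hG : G.IsHomogeneous d) (hFG : IsRelPrime F G) :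
    bres d F G ≠ 0 := by
  have hone : Polynomial.resultant (1 : Polynomial k) Polynomial.X 1 1 = -1 := by
    rw [Polynomial.resultant_one_left]
    simp
  intro h0
  rw [bres_eq_resultant hF hG, Polynomial.resultant_comm, mul_eq_zero] at h0
  replace h0 := h0.resolve_left (by simp)
  have hz {x y : k} := no_common_zero (x := x) (y := y) hF hG hFG
  clear hFG
  obtain ⟨c, s, hs, rfl⟩ := exists_eq_prod_linForm hF
  obtain ⟨c', t, ht, rfl⟩ := exists_eq_prod_linForm hG
  have hev (c : k) (s : Multiset (k × k)) (x y : k) :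
      MvPolynomial.eval ![x, y] (C c * (s.map linForm).prod) =
        c * (s.map fun p => p.1 * x + p.2 * y).prod := by
    rw [map_mul, map_multiset_prod, Multiset.map_map, MvPolynomial.eval_C]
    simp only [Function.comp_def, eval_linForm]
  have hzero {s : Multiset (k × k)} {p : k × k} (hp : p ∈ s) {x y : k}
      (h : p.1 * x + p.2 * y = 0) : (s.map fun p => p.1 * x + p.2 * y).prod = 0 :=
    Multiset.prod_eq_zero_iff.2 (Multiset.mem_map.2 ⟨p, hp, h⟩)
  have h1 := resultant_aeval (c := c) (c' := c') hs ht (f := 1) (g := Polynomial.X) (e := 1)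
    (by simp) (by simp)
  rw [← dehom, ← dehom, mul_one, pow_one, hone, h0] at h1
  simp only [hev] at hz
  obtain ⟨p₀, hp₀⟩ := Multiset.card_pos_iff_exists_mem.1 (hs ▸ hd)
  obtain ⟨r₀, hr₀⟩ := Multiset.card_pos_iff_exists_mem.1 (ht ▸ hd)
  have h2 : c = 0 ∨ c' = 0 ∨ detProd s t = 0 := by
    by_contra! hne
    have : c ^ d * c' ^ d * detProd s t * (-1) ^ (d * d) ≠ 0 := by
      simp [hne]
    exact this h1.symm
  rcases h2 with rfl | rfl | h2
  · obtain ⟨x, y, hxy, h⟩ := exists_linForm_root r₀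
    exact hz hxy (by simp) (by rw [hzero hr₀ h, mul_zero])
  · obtain ⟨x, y, hxy, h⟩ := exists_linForm_root p₀
    exact hz hxy (by rw [hzero hp₀ h, mul_zero]) (by simp)
  · rw [detProd, Multiset.prod_eq_zero_iff, Multiset.mem_map] at h2
    obtain ⟨p, hp, h2⟩ := h2
    rw [Multiset.prod_eq_zero_iff, Multiset.mem_map] at h2
    obtain ⟨r, hr, h2⟩ := h2
    by_cases hp0 : p.1 = 0 ∧ p.2 = 0
    · obtain ⟨x, y, hxy, h⟩ := exists_linForm_root r
      refine hz hxy (by rw [hzero hp (by simp [hp0]), mul_zero]) (by rw [hzero hr h, mul_zero])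
    · refine hz (x := -p.2) (y := p.1) (fun h => hp0 ⟨h.2, by simpa using h.1⟩)
        (by rw [hzero hp (by ring), mul_zero]) ?_
      rw [hzero hr (by linear_combination h2), mul_zero]

end Resultant

section Pairs

variable {k : Type*} [Field k]

/-- Pairs of polynomials in two variables. -/
abbrev FormPair (k : Type*) [Field k] := MvPolynomial (Fin 2) k × MvPolynomial (Fin 2) k

/-- Composition of pairs of binary forms. -/
def compPair (P Q : FormPair k) : FormPair k := (comp2 P.1 Q.1 Q.2, comp2 P.2 Q.1 Q.2)

/-- The pair of linear forms attached to a matrix. -/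
def linPair (M : Matrix (Fin 2) (Fin 2) k) : FormPair k :=
  (linForm (M 0 0, M 0 1), linForm (M 1 0, M 1 1))

lemma comp2_linForm (p : k × k) (f g : MvPolynomial (Fin 2) k) :
    comp2 (linForm p) f g = C p.1 * f + C p.2 * g := by
  simp [comp2, linForm, MvPolynomial.algebraMap_eq]

lemma comp2_comp2 (F f g a b : MvPolynomial (Fin 2) k) :
    comp2 (comp2 F f g) a b = comp2 F (comp2 f a b) (comp2 g a b) := by
  simp only [comp2]
  rw [MvPolynomial.comp_aeval_apply]
  congr 2
  funext i
  fin_cases i <;> rfl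

lemma compPair_assoc (P Q S : FormPair k) :
    compPair (compPair P Q) S = compPair P (compPair Q S) := by
  simp only [compPair, comp2_comp2]

lemma comp2_X (f : MvPolynomial (Fin 2) k) : comp2 f (X 0) (X 1) = f := by
  have h : (![X 0, X 1] : Fin 2 → MvPolynomial (Fin 2) k) = X := by
    funext i
    fin_cases i <;> rfl
  rw [comp2, h, MvPolynomial.aeval_X_left_apply]

lemma compPair_X (P : FormPair k) : compPair P (X 0, X 1) = P := by
  simp only [compPair, comp2_X]

lemma linPair_one : linPair (1 : Matrix (Fin 2) (Fin 2) k) = (X 0, X 1) := by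
  simp [linPair, linForm]

lemma one_compPair (P : FormPair k) : compPair (linPair 1) P = P := by
  simp [compPair, linPair_one, comp2]

lemma compPair_linPair (M N : Matrix (Fin 2) (Fin 2) k) :
    compPair (linPair M) (linPair N) = linPair (M * N) := by
  simp only [compPair, linPair, comp2_linForm, Matrix.mul_apply, Fin.sum_univ_two]
  ext1 <;> simp only [linForm, C_add, C_mul] <;> ring

lemma pairIter_succ (P : FormPair k) (n : ℕ) :
    pairIter P.1 P.2 (n + 1) = compPair P (pairIter P.1 P.2 n) := rfl

/-- Conjugation of a pair of binary forms by a matrix. -/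
def conjP (M : GL (Fin 2) k) (P : FormPair k) : FormPair k :=
  compPair (linPair (M⁻¹ : GL (Fin 2) k)) (compPair P (linPair (M : Matrix (Fin 2) (Fin 2) k)))

lemma conjP_mul (M N : GL (Fin 2) k) (P : FormPair k) : conjP (M * N) P = conjP N (conjP M P) := by
  simp only [conjP, _root_.mul_inv_rev, Units.val_mul, ← compPair_linPair, compPair_assoc]

lemma conjP_one (P : FormPair k) : conjP 1 P = P := by
  simp only [conjP, inv_one, Units.val_one, one_compPair]
  rw [linPair_one, compPair_X]

lemma pairIter_conjP (M : GL (Fin 2) k) (P : FormPair k) (n : ℕ) :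
    pairIter (conjP M P).1 (conjP M P).2 n = conjP M (pairIter P.1 P.2 n) := by
  induction n with
  | zero =>
    simp only [pairIter, conjP]
    rw [← linPair_one, one_compPair, compPair_linPair, ← Units.val_mul, inv_mul_cancel,
      Units.val_one]
  | succ n ih =>
    rw [pairIter_succ, ih, pairIter_succ]
    conv_rhs => rw [conjP, compPair_assoc]
    conv_lhs => rw [conjP, conjP, compPair_assoc, compPair_assoc, ← compPair_assoc (linPair M.1)]
    rw [compPair_linPair, ← Units.val_mul, mul_inv_cancel, Units.val_one, one_compPair]

/-- Both entries are homogeneous of degree `d`. -/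
def HomPair (d : ℕ) (P : FormPair k) : Prop := P.1.IsHomogeneous d ∧ P.2.IsHomogeneous d

lemma HomPair.comp {d e : ℕ} {P Q : FormPair k} (hP : HomPair d P) (hQ : HomPair e Q) :
    HomPair (d * e) (compPair P Q) :=
  ⟨isHomogeneous_comp2 hP.1 hQ.1 hQ.2, isHomogeneous_comp2 hP.2 hQ.1 hQ.2⟩

lemma homPair_linPair (M : Matrix (Fin 2) (Fin 2) k) : HomPair 1 (linPair M) := by
  constructor <;>
  · refine MvPolynomial.IsHomogeneous.add ?_ ?_ <;>
    · simpa using (MvPolynomial.isHomogeneous_C _ _).mul (MvPolynomial.isHomogeneous_X k _)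

lemma HomPair.conjP {d : ℕ} {P : FormPair k} (hP : HomPair d P) (M : GL (Fin 2) k) :
    HomPair d (conjP M P) := by
  simpa [TateLattes.conjP] using (homPair_linPair _).comp (hP.comp (homPair_linPair _))

lemma HomPair.pairIter {d : ℕ} {P : FormPair k} (hP : HomPair d P) (n : ℕ) :
    HomPair (d ^ n) (pairIter P.1 P.2 n) := by
  induction n with
  | zero =>
    have := homPair_linPair (1 : Matrix (Fin 2) (Fin 2) k)
    rwa [linPair_one] at this
  | succ n ih =>
    rw [pow_succ', pairIter_succ]
    exact hP.comp ih

lemma bres_linPair (M : Matrix (Fin 2) (Fin 2) k) :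
    bres 1 (linPair M).1 (linPair M).2 = M.det := by
  have h (p : k × k) : dehom (linForm p) =
      Polynomial.C p.1 * 1 + Polynomial.C p.2 * Polynomial.X := by
    simp [dehom, linForm, Polynomial.C_eq_algebraMap]
  rw [bres_eq_resultant (homPair_linPair M).1 (homPair_linPair M).2, linPair, h, h,
    resultant_linear_comb (by simp) (by simp), Polynomial.resultant_one_left, Matrix.det_fin_two]
  simp
  ring

end Pairs

section Norms

omit [IsUltrametricDist K] in
lemma conjPair_eq_conjP (M : GL (Fin 2) K) (P : FormPair K) : conjPair K M P.1 P.2 = conjP M P := by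
  simp only [conjPair, conjP, compPair, linPair, comp2_linForm]
  simp only [mobius, comp2, linForm]

omit [IsUltrametricDist K] in
lemma norm_bres_compPair [IsAlgClosed K] {d e : ℕ} {P Q : FormPair K} (hP : HomPair d P)
    (hQ : HomPair e Q) :
    ‖bres (d * e) (compPair P Q).1 (compPair P Q).2‖ =
      ‖bres d P.1 P.2‖ ^ e * ‖bres e Q.1 Q.2‖ ^ (d * d) := by
  obtain ⟨s, hs, h⟩ := bres_comp2 hP.1 hP.2 hQ.1 hQ.2
  have : ‖s‖ = 1 := by
    have := congrArg norm hs
    rw [norm_pow, norm_one] at this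
    exact (pow_eq_one_iff_of_nonneg (norm_nonneg _) two_ne_zero).1 this
  rw [compPair, h, norm_mul, this, one_mul, norm_mul, norm_pow, norm_pow]

omit [IsUltrametricDist K] in
lemma norm_bres_conjP [IsAlgClosed K] {d : ℕ} {P : FormPair K} (hP : HomPair d P) (M : GL (Fin 2) K) :
    ‖bres d (conjP M P).1 (conjP M P).2‖ * ‖M.1.det‖ ^ d =
      ‖bres d P.1 P.2‖ * ‖M.1.det‖ ^ (d * d) := by
  have h1 := norm_bres_compPair hP (homPair_linPair M.1)
  have h2 := norm_bres_compPair (homPair_linPair (M⁻¹ : GL (Fin 2) K).1)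
    (hP.comp (homPair_linPair M.1))
  rw [bres_linPair, pow_one, mul_one] at h1
  rw [bres_linPair, mul_one, one_mul, mul_one, pow_one, h1] at h2
  have hdet : ‖(M⁻¹ : GL (Fin 2) K).1.det‖ * ‖M.1.det‖ = 1 := by
    rw [← norm_mul, ← Matrix.det_mul, ← Units.val_mul, inv_mul_cancel, Units.val_one,
      Matrix.det_one, norm_one]
  rw [conjP, h2]
  calc _ = (‖(M⁻¹ : GL (Fin 2) K).1.det‖ * ‖M.1.det‖) ^ d *
        (‖bres d P.1 P.2‖ * ‖M.1.det‖ ^ (d * d)) := by rw [mul_pow]; ring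
    _ = _ := by rw [hdet, one_pow, one_mul]

omit [IsUltrametricDist K] in
lemma norm_bres_pairIter [IsAlgClosed K] {d : ℕ} {P : FormPair K} (hP : HomPair d P) (n : ℕ) :
    ∃ a : ℕ, a * (d * (d - 1) : ℝ) = (d : ℝ) ^ n * ((d : ℝ) ^ n - 1) ∧
    ‖bres (d ^ n) (pairIter P.1 P.2 n).1 (pairIter P.1 P.2 n).2‖ = ‖bres d P.1 P.2‖ ^ a := by
  induction n with
  | zero =>
    refine ⟨0, by simp, ?_⟩
    have := bres_linPair (1 : Matrix (Fin 2) (Fin 2) K)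
    rw [linPair_one, Matrix.det_one] at this
    simp only [pow_zero, pairIter]
    rw [this, norm_one]
  | succ n ih =>
    obtain ⟨a, ha, ih⟩ := ih
    refine ⟨d ^ n + a * (d * d), ?_, ?_⟩
    · push_cast
      rw [pow_succ]
      linear_combination (d * d : ℝ) * ha
    · rw [pairIter_succ, pow_succ', norm_bres_compPair hP (hP.pairIter n), ih, ← pow_mul, pow_add]

omit [IsUltrametricDist K] in
lemma norm_formCoeff_le_maxNorm (d : ℕ) (P : FormPair K) {i : ℕ} (hi : i ≤ d) :
    ‖formCoeff d P.1 i‖ ≤ maxNorm K d P.1 P.2 ∧ ‖formCoeff d P.2 i‖ ≤ maxNorm K d P.1 P.2 := by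
  have := Finset.le_sup' (fun i : Fin (d + 1) => max ‖coeffVec d P.1 i‖ ‖coeffVec d P.2 i‖)
    (Finset.mem_univ ⟨i, Nat.lt_succ_iff.2 hi⟩)
  exact ⟨(le_max_left _ _).trans this, (le_max_right _ _).trans this⟩

omit [IsUltrametricDist K] in
lemma maxNorm_nonneg (d : ℕ) (P : FormPair K) : 0 ≤ maxNorm K d P.1 P.2 :=
  (norm_nonneg _).trans (norm_formCoeff_le_maxNorm d P (Nat.zero_le d)).1

omit [IsUltrametricDist K] in
lemma maxNorm_le {d : ℕ} {P : FormPair K} {T : ℝ}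
    (h : ∀ i ≤ d, ‖formCoeff d P.1 i‖ ≤ T ∧ ‖formCoeff d P.2 i‖ ≤ T) :
    maxNorm K d P.1 P.2 ≤ T :=
  Finset.sup'_le _ _ fun i _ =>
    max_le (h i (Nat.lt_succ_iff.1 i.2)).1 (h i (Nat.lt_succ_iff.1 i.2)).2

lemma norm_eval_le_maxNorm {d : ℕ} {P : FormPair K} (hP : HomPair d P) {x y : K} (hx : ‖x‖ ≤ 1)
    (hy : ‖y‖ ≤ 1) :
    ‖MvPolynomial.eval ![x, y] P.1‖ ≤ maxNorm K d P.1 P.2 ∧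
      ‖MvPolynomial.eval ![x, y] P.2‖ ≤ maxNorm K d P.1 P.2 := by
  have hT := maxNorm_nonneg d P
  have key {F : MvPolynomial (Fin 2) K} (hF : F.IsHomogeneous d)
      (h : ∀ i ≤ d, ‖formCoeff d F i‖ ≤ maxNorm K d P.1 P.2) :
      ‖MvPolynomial.eval ![x, y] F‖ ≤ maxNorm K d P.1 P.2 := by
    rw [eval_eq_sum hF]
    refine IsUltrametricDist.norm_sum_le_of_forall_le_of_nonneg hT fun i hi => ?_
    rw [norm_mul, norm_mul, norm_pow, norm_pow]
    refine (mul_le_of_le_one_right (by positivity) (pow_le_one₀ (norm_nonneg _) hy)).trans ?_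
    exact (mul_le_of_le_one_right (by positivity) (pow_le_one₀ (norm_nonneg _) hx)).trans
      (h i (Nat.lt_succ_iff.1 (Finset.mem_range.1 hi)))
  exact ⟨key hP.1 fun i hi => (norm_formCoeff_le_maxNorm d P hi).1,
    key hP.2 fun i hi => (norm_formCoeff_le_maxNorm d P hi).2⟩

lemma maxNorm_le_of_eval [IsAlgClosed K] {d : ℕ} {P : FormPair K} (hP : HomPair d P) {T : ℝ}
    (h : ∀ x y : K, ‖x‖ ≤ 1 → ‖y‖ ≤ 1 → ‖MvPolynomial.eval ![x, y] P.1‖ ≤ T ∧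
      ‖MvPolynomial.eval ![x, y] P.2‖ ≤ T) : maxNorm K d P.1 P.2 ≤ T := by
  obtain ⟨u, hu, h1, h2⟩ := exists_norm_one_coeff_le_eval₂ (dehom P.1) (dehom P.2)
  refine maxNorm_le fun i hi => ?_
  have h1 := h1 i
  have h2 := h2 i
  rw [dehom_coeff hP.1, if_pos hi, eval_dehom] at h1
  rw [dehom_coeff hP.2, if_pos hi, eval_dehom] at h2
  have := h 1 u (by simp) hu.le
  exact ⟨h1.trans this.1, h2.trans this.2⟩

lemma norm_bres_le (d : ℕ) (P : FormPair K) :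
    ‖bres d P.1 P.2‖ ≤ maxNorm K d P.1 P.2 ^ (2 * d) := by
  have hT := maxNorm_nonneg d P
  rw [bres, Matrix.det_apply]
  refine IsUltrametricDist.norm_sum_le_of_forall_le_of_nonneg (by positivity) fun σ _ => ?_
  have hsign : ‖Equiv.Perm.sign σ • ∏ i, sylv d (coeffVec d P.1) (coeffVec d P.2) (σ i) i‖ =
      ‖∏ i, sylv d (coeffVec d P.1) (coeffVec d P.2) (σ i) i‖ := by
    rcases Int.units_eq_one_or (Equiv.Perm.sign σ) with h | h <;> simp [h]
  rw [hsign, norm_prod]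
  have : maxNorm K d P.1 P.2 ^ (2 * d) = ∏ _i : Fin (d + d), maxNorm K d P.1 P.2 := by
    rw [Finset.prod_const, Finset.card_univ, Fintype.card_fin, two_mul]
  rw [this]
  refine Finset.prod_le_prod (fun _ _ => norm_nonneg _) fun i _ => ?_
  rw [sylv, Matrix.of_apply]
  split_ifs
  · exact (norm_formCoeff_le_maxNorm d P (by simp; omega)).1
  · simpa using hT
  · exact (norm_formCoeff_le_maxNorm d P (by simp; omega)).2
  · simpa using hT

lemma maxNorm_pos {d : ℕ} (hd : 0 < d) {P : FormPair K} (h : bres d P.1 P.2 ≠ 0) :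
    0 < maxNorm K d P.1 P.2 := by
  refine (maxNorm_nonneg d P).lt_of_ne' fun h0 => h ?_
  have := norm_bres_le d P
  rw [h0, zero_pow (by omega)] at this
  exact norm_le_zero_iff.1 this

lemma Rpair_nonneg {d : ℕ} {P : FormPair K} (h : bres d P.1 P.2 ≠ 0) :
    0 ≤ Rpair K d P.1 P.2 := by
  have h1 := Real.log_le_log (norm_pos_iff.2 h) (norm_bres_le d P)
  rw [Real.log_pow] at h1
  rw [Rpair, ordv]
  push_cast at h1
  linarith

omit [IsUltrametricDist K] in
lemma det_ne_zero (M : GL (Fin 2) K) : M.1.det ≠ 0 :=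
  ((Matrix.isUnit_iff_isUnit_det _).1 M.isUnit).ne_zero

omit [IsUltrametricDist K] in
lemma bres_conjP_ne_zero [IsAlgClosed K] {d : ℕ} {P : FormPair K} (hP : HomPair d P)
    (h : bres d P.1 P.2 ≠ 0) (M : GL (Fin 2) K) : bres d (conjP M P).1 (conjP M P).2 ≠ 0 := by
  have h1 := norm_bres_conjP hP M
  intro h0
  rw [h0, norm_zero, zero_mul] at h1
  have h2 := norm_pos_iff.2 h
  have h3 := norm_pos_iff.2 (det_ne_zero M)
  exact absurd h1 (by positivity)

omit [IsUltrametricDist K] in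
lemma Rpair_conjP [IsAlgClosed K] {d : ℕ} {P : FormPair K} (hP : HomPair d P)
    (h : bres d P.1 P.2 ≠ 0) (M : GL (Fin 2) K) :
    Rpair K d (conjP M P).1 (conjP M P).2 = ordv K (bres d P.1 P.2) -
      d * (d - 1) * Real.log ‖M.1.det‖ +
      2 * d * Real.log (maxNorm K d (conjP M P).1 (conjP M P).2) := by
  have h1 := congrArg Real.log (norm_bres_conjP hP M)
  have h2 := norm_pos_iff.2 h
  have h3 := norm_pos_iff.2 (det_ne_zero M)
  have h4 := norm_pos_iff.2 (bres_conjP_ne_zero hP h M)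
  rw [Real.log_mul h4.ne' (by positivity), Real.log_mul h2.ne' (by positivity), Real.log_pow,
    Real.log_pow] at h1
  push_cast at h1
  rw [Rpair, ordv, ordv]
  linarith

omit [IsUltrametricDist K] in
lemma Rmin_eq (d : ℕ) (P : FormPair K) :
    Rmin K d P.1 P.2 = ⨅ M : GL (Fin 2) K, Rpair K d (conjP M P).1 (conjP M P).2 := by
  simp only [Rmin, conjPair_eq_conjP]

omit [IsUltrametricDist K] in
lemma Rmin_conjP (d : ℕ) (P : FormPair K) (M : GL (Fin 2) K) :
    Rmin K d (conjP M P).1 (conjP M P).2 = Rmin K d P.1 P.2 := by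
  rw [Rmin_eq, Rmin_eq]
  simp only [← conjP_mul]
  exact (Equiv.mulLeft M).iInf_congr fun _ => rfl

lemma Rmin_le [IsAlgClosed K] {d : ℕ} {P : FormPair K} (hP : HomPair d P)
    (h : bres d P.1 P.2 ≠ 0) (M : GL (Fin 2) K) :
    Rmin K d P.1 P.2 ≤ Rpair K d (conjP M P).1 (conjP M P).2 := by
  rw [Rmin_eq]
  refine ciInf_le ⟨0, ?_⟩ M
  rintro _ ⟨N, rfl⟩
  exact Rpair_nonneg (bres_conjP_ne_zero hP h N)

end Norms

lemma norm_coeff_le_of_eval [IsAlgClosed K] {f : Polynomial K} {T : ℝ}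
    (h : ∀ u : K, ‖u‖ = 1 → ‖f.eval u‖ ≤ T) (i : ℕ) : ‖f.coeff i‖ ≤ T := by
  obtain ⟨u, hu, hc⟩ := exists_norm_one_coeff_le_eval f
  exact (hc i).trans (h u hu)

lemma norm_coeff_lt_of_eval [IsAlgClosed K] {f : Polynomial K} {T : ℝ}
    (h : ∀ u : K, ‖u‖ = 1 → ‖f.eval u‖ < T) (i : ℕ) : ‖f.coeff i‖ < T := by
  obtain ⟨u, hu, hc⟩ := exists_norm_one_coeff_le_eval f
  exact (hc i).trans_lt (h u hu)

/-- The reduction of the form `F` of degree `d` is a nonzero multiple of `X ^ p * Y ^ (d - p)`. -/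
def NearMono (d p : ℕ) (F : MvPolynomial (Fin 2) K) : Prop :=
  p ≤ d ∧ ∃ a : K, ‖a‖ = 1 ∧ ∀ x y : K, ‖x‖ ≤ 1 → ‖y‖ ≤ 1 →
    ‖MvPolynomial.eval ![x, y] F - a * x ^ p * y ^ (d - p)‖ < 1

/-- Both components of a pair reduce to monomials. -/
def MonoPair (d p p' : ℕ) (P : FormPair K) : Prop := NearMono d p P.1 ∧ NearMono d p' P.2

omit [IsUltrametricDist K] in
lemma norm_monomial_le {a x y : K} (ha : ‖a‖ = 1) (hx : ‖x‖ ≤ 1) (hy : ‖y‖ ≤ 1) (i j : ℕ) :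
    ‖a * x ^ i * y ^ j‖ ≤ 1 := by
  rw [norm_mul, norm_mul, ha, one_mul, norm_pow, norm_pow]
  exact mul_le_one₀ (pow_le_one₀ (norm_nonneg _) hx) (by positivity)
    (pow_le_one₀ (norm_nonneg _) hy)

lemma NearMono.norm_eval_le {d p : ℕ} {F : MvPolynomial (Fin 2) K} (h : NearMono d p F) {x y : K}
    (hx : ‖x‖ ≤ 1) (hy : ‖y‖ ≤ 1) : ‖MvPolynomial.eval ![x, y] F‖ ≤ 1 := by
  obtain ⟨-, a, ha, h⟩ := h
  have := norm_add_le_of_le (h x y hx hy).le (norm_monomial_le ha hx hy p (d - p))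
  rwa [sub_add_cancel] at this

lemma NearMono.norm_eval_eq {d p : ℕ} {F : MvPolynomial (Fin 2) K} (h : NearMono d p F) {x y : K}
    (hx : ‖x‖ = 1) (hy : ‖y‖ = 1) : ‖MvPolynomial.eval ![x, y] F‖ = 1 := by
  obtain ⟨-, a, ha, h⟩ := h
  refine norm_eq_one_of_norm_sub_lt ?_ (h x y hx.le hy.le)
  simp [ha, hx, hy]

lemma maxNorm_eq_one [IsAlgClosed K] {d p p' : ℕ} {P : FormPair K} (hP : HomPair d P)
    (h : MonoPair d p p' P) : maxNorm K d P.1 P.2 = 1 := by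
  refine le_antisymm (maxNorm_le_of_eval hP fun x y hx hy =>
    ⟨h.1.norm_eval_le hx hy, h.2.norm_eval_le hx hy⟩) ?_
  rw [← h.1.norm_eval_eq (norm_one (α := K)) (norm_one (α := K))]
  exact (norm_eval_le_maxNorm hP norm_one.le norm_one.le).1

omit [IsUltrametricDist K] in
lemma eval_comp2 (F f g : MvPolynomial (Fin 2) K) (x y : K) :
    MvPolynomial.eval ![x, y] (comp2 F f g) =
      MvPolynomial.eval ![MvPolynomial.eval ![x, y] f, MvPolynomial.eval ![x, y] g] F := by
  rw [comp2, ← MvPolynomial.coe_aeval_eq_eval, ← MvPolynomial.coe_aeval_eq_eval]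
  simp only [RingHom.coe_coe]
  rw [MvPolynomial.comp_aeval_apply]
  congr 2
  funext i
  fin_cases i <;> rfl

lemma norm_mul_sub_mul_lt {x y x' y' : K} (hx : ‖x‖ ≤ 1) (hy' : ‖y'‖ ≤ 1) (h : ‖x - x'‖ < 1)
    (h' : ‖y - y'‖ < 1) : ‖x * y - x' * y'‖ < 1 := by
  rw [show x * y - x' * y' = x * (y - y') + (x - x') * y' by ring]
  refine norm_add_lt_of_lt ?_ ?_ <;> rw [norm_mul]
  · exact mul_lt_one_of_nonneg_of_lt_one_right hx (norm_nonneg _) h'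
  · exact mul_lt_one_of_nonneg_of_lt_one_left (norm_nonneg _) h hy'

lemma NearMono.comp {D p d q q' : ℕ} {F f g : MvPolynomial (Fin 2) K} (hF : NearMono D p F)
    (hf : NearMono d q f) (hg : NearMono d q' g) :
    NearMono (D * d) (p * q + (D - p) * q') (comp2 F f g) := by
  obtain ⟨hp, A, hA, hF⟩ := hF
  have hfx := fun x y (hx : ‖x‖ ≤ 1) (hy : ‖y‖ ≤ 1) => hf.norm_eval_le hx hy
  have hgx := fun x y (hx : ‖x‖ ≤ 1) (hy : ‖y‖ ≤ 1) => hg.norm_eval_le hx hy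
  obtain ⟨hq, a, ha, hf⟩ := hf
  obtain ⟨hq', b, hb, hg⟩ := hg
  obtain ⟨r, rfl⟩ := Nat.exists_eq_add_of_le hp
  obtain ⟨s, rfl⟩ := Nat.exists_eq_add_of_le hq
  obtain ⟨s', hs'⟩ := Nat.exists_eq_add_of_le hq'
  have e2 : q + s - q = s := by omega
  have e3 : q + s - q' = s' := by omega
  rw [Nat.add_sub_cancel_left] at hF ⊢
  have e4 : (p + r) * (q + s) = p * q + r * q' + (p * s + r * s') := by
    rw [add_mul, mul_add, hs']; ring
  refine ⟨by rw [e4]; omega, A * a ^ p * b ^ r, by simp [hA, ha, hb], fun x y hx hy => ?_⟩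
  have e5 : (p + r) * (q + s) - (p * q + r * q') = p * s + r * s' := by omega
  rw [e5, eval_comp2]
  specialize hfx x y hx hy
  specialize hgx x y hx hy
  specialize hf x y hx hy
  specialize hg x y hx hy
  rw [e2] at hf
  rw [e3] at hg
  set X := MvPolynomial.eval ![x, y] f
  set Y := MvPolynomial.eval ![x, y] g
  have h1 := hF X Y hfx hgx
  have h2 : ‖A * X ^ p * Y ^ r - A * (a * x ^ q * y ^ s) ^ p * (b * x ^ q' * y ^ s') ^ r‖ < 1 := by
    have hm := norm_monomial_le ha hx hy q s
    have hm' := norm_monomial_le hb hx hy q' s'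
    rw [mul_assoc, mul_assoc, ← mul_sub, norm_mul, hA, one_mul]
    refine norm_mul_sub_mul_lt ?_ ?_ ((norm_pow_sub_pow_le hfx hm p).trans_lt hf)
      ((norm_pow_sub_pow_le hgx hm' r).trans_lt hg) <;> rw [norm_pow]
    · exact pow_le_one₀ (norm_nonneg _) hfx
    · exact pow_le_one₀ (norm_nonneg _) hm'
  convert norm_add_lt_of_lt h1 h2 using 2
  ring

lemma MonoPair.comp {D p p' d q q' : ℕ} {P Q : FormPair K} (hP : MonoPair D p p' P)
    (hQ : MonoPair d q q' Q) :
    MonoPair (D * d) (p * q + (D - p) * q') (p' * q + (D - p') * q') (compPair P Q) :=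
  ⟨hP.1.comp hQ.1 hQ.2, hP.2.comp hQ.1 hQ.2⟩

omit [IsUltrametricDist K] in
lemma monoPair_pairIter_zero (P : FormPair K) : MonoPair 1 1 0 (pairIter P.1 P.2 0) := by
  refine ⟨⟨le_rfl, 1, norm_one, fun x y _ _ => ?_⟩, ⟨zero_le_one, 1, norm_one, fun x y _ _ => ?_⟩⟩ <;>
    simp [pairIter]

/-- Exchange the two variables. -/
def swapVars (F : MvPolynomial (Fin 2) K) : MvPolynomial (Fin 2) K := comp2 F (X 1) (X 0)

omit [IsUltrametricDist K] in
lemma eval_swapVars (F : MvPolynomial (Fin 2) K) (x y : K) :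
    MvPolynomial.eval ![x, y] (swapVars F) = MvPolynomial.eval ![y, x] F := by
  simp [swapVars, eval_comp2]

omit [IsUltrametricDist K] in
lemma isHomogeneous_swapVars {d : ℕ} {F : MvPolynomial (Fin 2) K} (hF : F.IsHomogeneous d) :
    (swapVars F).IsHomogeneous d := by
  rw [swapVars]
  simpa using isHomogeneous_comp2 hF (MvPolynomial.isHomogeneous_X K 1)
    (MvPolynomial.isHomogeneous_X K 0)

omit [IsUltrametricDist K] in
lemma NearMono.swapVars {d p : ℕ} {F : MvPolynomial (Fin 2) K} (h : NearMono d p F) :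
    NearMono d (d - p) (swapVars F) := by
  obtain ⟨hp, a, ha, h⟩ := h
  refine ⟨Nat.sub_le _ _, a, ha, fun x y hx hy => ?_⟩
  rw [eval_swapVars, Nat.sub_sub_self hp, mul_right_comm]
  exact h y x hy hx

/-- The matrix exchanging the coordinates. -/
def swapGL : GL (Fin 2) K := GeneralLinearGroup.mkOfDetNeZero !![0, 1; 1, 0] (by simp)

omit [IsUltrametricDist K] in
lemma conjP_eval (M : GL (Fin 2) K) (P : FormPair K) (x y : K) :
    M.1 0 0 * MvPolynomial.eval ![x, y] (conjP M P).1 +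
        M.1 0 1 * MvPolynomial.eval ![x, y] (conjP M P).2 =
      MvPolynomial.eval ![M.1 0 0 * x + M.1 0 1 * y, M.1 1 0 * x + M.1 1 1 * y] P.1 ∧
    M.1 1 0 * MvPolynomial.eval ![x, y] (conjP M P).1 +
        M.1 1 1 * MvPolynomial.eval ![x, y] (conjP M P).2 =
      MvPolynomial.eval ![M.1 0 0 * x + M.1 0 1 * y, M.1 1 0 * x + M.1 1 1 * y] P.2 := by
  have h : compPair (linPair M.1) (conjP M P) = compPair P (linPair M.1) := by
    rw [conjP, ← compPair_assoc, compPair_linPair, ← Units.val_mul, mul_inv_cancel, Units.val_one,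
      one_compPair]
  have h1 := congrArg (fun Q : FormPair K => MvPolynomial.eval ![x, y] Q.1) h
  have h2 := congrArg (fun Q : FormPair K => MvPolynomial.eval ![x, y] Q.2) h
  simp only [compPair, linPair, comp2_linForm, eval_comp2, eval_linForm, map_add, map_mul,
    MvPolynomial.eval_C] at h1 h2
  exact ⟨h1, h2⟩

omit [IsUltrametricDist K] in
lemma conjP_swapGL_eval (P : FormPair K) (x y : K) :
    MvPolynomial.eval ![x, y] (conjP swapGL P).1 = MvPolynomial.eval ![y, x] P.2 ∧
    MvPolynomial.eval ![x, y] (conjP swapGL P).2 = MvPolynomial.eval ![y, x] P.1 := by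
  have h := conjP_eval swapGL P x y
  simp only [swapGL, GeneralLinearGroup.mkOfDetNeZero] at h ⊢
  have h' := h
  simp at h'
  exact ⟨h'.2, h'.1⟩

omit [IsUltrametricDist K] in
lemma MonoPair.conjP_swapGL {d p p' : ℕ} {P : FormPair K} (h : MonoPair d p p' P) :
    MonoPair d (d - p') (d - p) (conjP swapGL P) := by
  obtain ⟨h1, h2⟩ := h
  obtain ⟨hp, a, ha, h1⟩ := h1.swapVars
  obtain ⟨hp', b, hb, h2⟩ := h2.swapVars
  simp only [eval_swapVars] at h1 h2
  refine ⟨⟨hp', b, hb, fun x y hx hy => ?_⟩, ⟨hp, a, ha, fun x y hx hy => ?_⟩⟩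
  · rw [(conjP_swapGL_eval P x y).1]
    exact h2 x y hx hy
  · rw [(conjP_swapGL_eval P x y).2]
    exact h1 x y hx hy

omit [IsUltrametricDist K] in
lemma eval_mul_mul {d : ℕ} {F : MvPolynomial (Fin 2) K} (hF : F.IsHomogeneous d) (s x y : K) :
    MvPolynomial.eval ![s * x, s * y] F = s ^ d * MvPolynomial.eval ![x, y] F := by
  rw [eval_eq_sum hF, eval_eq_sum hF, Finset.mul_sum]
  refine Finset.sum_congr rfl fun i hi => ?_
  obtain ⟨j, rfl⟩ := Nat.exists_eq_add_of_le (Nat.lt_succ_iff.1 (Finset.mem_range.1 hi))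
  rw [Nat.add_sub_cancel_left, pow_add]
  ring

/-- `T` bounds on the unit bidisc any pair of values which the matrix `(α, β; γ, δ)` maps to the
values of `(F, G)` at the image point. -/
def BoundedConj (F G : MvPolynomial (Fin 2) K) (α β γ δ : K) (T : ℝ) : Prop :=
  ∀ x y c₁ c₂ : K, ‖x‖ ≤ 1 → ‖y‖ ≤ 1 →
    α * c₁ + β * c₂ = MvPolynomial.eval ![α * x + β * y, γ * x + δ * y] F →
    γ * c₁ + δ * c₂ = MvPolynomial.eval ![α * x + β * y, γ * x + δ * y] G → ‖c₁‖ ≤ T ∧ ‖c₂‖ ≤ T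

omit [IsUltrametricDist K] in
lemma BoundedConj.swap_cols {F G : MvPolynomial (Fin 2) K} {α β γ δ : K} {T : ℝ}
    (h : BoundedConj F G α β γ δ T) : BoundedConj F G β α δ γ T := by
  intro x y c₁ c₂ hx hy h1 h2
  rw [add_comm, add_comm (β * x), add_comm (δ * x)] at h1 h2
  exact (h y x c₂ c₁ hy hx h1 h2).symm

omit [IsUltrametricDist K] in
lemma BoundedConj.swap_rows {F G : MvPolynomial (Fin 2) K} {α β γ δ : K} {T : ℝ}
    (h : BoundedConj F G α β γ δ T) : BoundedConj (swapVars G) (swapVars F) γ δ α β T := by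
  intro x y c₁ c₂ hx hy h1 h2
  rw [eval_swapVars] at h1 h2
  exact h x y c₁ c₂ hx hy h2 h1

omit [IsUltrametricDist K] in
lemma cramer {α β γ δ D : K} (hD : D = α * δ - β * γ) (h0 : D ≠ 0) (f g : K) :
    α * ((δ * f - β * g) / D) + β * ((α * g - γ * f) / D) = f ∧
      γ * ((δ * f - β * g) / D) + δ * ((α * g - γ * f) / D) = g := by
  constructor <;>
  · rw [mul_div_assoc', mul_div_assoc', ← add_div, div_eq_iff h0, hD]
    ring

lemma norm_pow_det_le_of_eq [IsAlgClosed K] {d p : ℕ} (hd : 0 < d) {F G : MvPolynomial (Fin 2) K}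
    (hF : F.IsHomogeneous d) (hFm : NearMono d p F) {α β γ δ : K} (hdet : α * δ - β * γ ≠ 0)
    {T : ℝ} (hT : BoundedConj F G α β γ δ T) (h : max ‖α‖ ‖β‖ = max ‖γ‖ ‖δ‖) :
    ‖α * δ - β * γ‖ ^ (d - 1) ≤ T ^ 2 := by
  set A := max ‖α‖ ‖β‖ with hA
  have hα : ‖α‖ ≤ A := le_max_left _ _
  have hβ : ‖β‖ ≤ A := le_max_right _ _
  have hγ : ‖γ‖ ≤ A := h ▸ le_max_left _ _
  have hδ : ‖δ‖ ≤ A := h ▸ le_max_right _ _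
  have hA0 : 0 ≤ A := (norm_nonneg _).trans hα
  obtain ⟨s, hs⟩ : ∃ s : K, ‖s‖ = A := by
    rcases max_choice ‖α‖ ‖β‖ with h | h
    exacts [⟨α, h.symm⟩, ⟨β, h.symm⟩]
  have hs0 : s ≠ 0 := by
    rintro rfl
    rw [norm_zero] at hs
    rw [← hs] at hα hβ
    exact hdet (by rw [norm_le_zero_iff.1 hα, norm_le_zero_iff.1 hβ]; ring)
  have hA1 : 0 < A := hs ▸ norm_pos_iff.2 hs0
  obtain ⟨u, hu, h1, h2⟩ := exists_norm_one_coeff_le_eval₂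
    (Polynomial.C α * Polynomial.X + Polynomial.C β)
    (Polynomial.C γ * Polynomial.X + Polynomial.C δ)
  have hw {a b : K} (ha : ‖a‖ ≤ A) (hb : ‖b‖ ≤ A) (hab : A = max ‖a‖ ‖b‖)
      (h : ∀ i, ‖(Polynomial.C a * Polynomial.X + Polynomial.C b).coeff i‖ ≤
        ‖(Polynomial.C a * Polynomial.X + Polynomial.C b).eval u‖) : ‖a * u + b‖ = A := by
    have h0 := h 0
    have h1 := h 1
    simp [Polynomial.coeff_X] at h0 h1
    refine le_antisymm (norm_add_le_of_le (by rw [norm_mul, hu, mul_one]; exact ha) hb) ?_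
    rw [hab]
    refine max_le ?_ h0
    simpa [Polynomial.coeff_C] using h1
  have hw1 := hw hα hβ rfl h1
  have hw2 := hw hγ hδ h h2
  have hval : ‖MvPolynomial.eval ![α * u + β * 1, γ * u + δ * 1] F‖ = A ^ d := by
    have : ![α * u + β * 1, γ * u + δ * 1] =
        ![s * (s⁻¹ * (α * u + β)), s * (s⁻¹ * (γ * u + δ))] := by
      rw [mul_inv_cancel_left₀ hs0, mul_inv_cancel_left₀ hs0, mul_one, mul_one]
    rw [this, eval_mul_mul hF, norm_mul, norm_pow, hs, hFm.norm_eval_eq, mul_one]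
    · rw [norm_mul, norm_inv, hs, hw1, inv_mul_cancel₀ hA1.ne']
    · rw [norm_mul, norm_inv, hs, hw2, inv_mul_cancel₀ hA1.ne']
  set f := MvPolynomial.eval ![α * u + β * 1, γ * u + δ * 1] F
  set g := MvPolynomial.eval ![α * u + β * 1, γ * u + δ * 1] G with hg
  obtain ⟨hc1, hc2⟩ := hT u 1 ((δ * f - β * g) / (α * δ - β * γ))
    ((α * g - γ * f) / (α * δ - β * γ)) hu.le norm_one.le (cramer rfl hdet f g).1
    (cramer rfl hdet f g).2
  have hf : f = α * ((δ * f - β * g) / (α * δ - β * γ)) +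
    β * ((α * g - γ * f) / (α * δ - β * γ)) := (cramer rfl hdet f g).1.symm
  have hT0 : 0 ≤ T := (norm_nonneg _).trans hc1
  have key : A ^ d ≤ A * T := by
    rw [← hval, hf]
    refine norm_add_le_of_le ?_ ?_ <;> rw [norm_mul] <;> gcongr
  obtain ⟨e, rfl⟩ := Nat.exists_eq_add_of_lt hd
  rw [zero_add, pow_succ', mul_le_mul_iff_right₀ hA1] at key
  have hdet' : ‖α * δ - β * γ‖ ≤ A ^ 2 := by
    refine norm_sub_le_of_le ?_ ?_ <;> rw [norm_mul, pow_two] <;> gcongr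
  rw [zero_add, Nat.add_sub_cancel]
  calc ‖α * δ - β * γ‖ ^ e ≤ (A ^ 2) ^ e := by gcongr
    _ = (A ^ e) ^ 2 := by rw [← pow_mul, ← pow_mul, mul_comm]
    _ ≤ T ^ 2 := by gcongr

lemma norm_pow_det_le_of_lt [IsAlgClosed K] {d p p' : ℕ} (hd : 0 < d)
    {F G : MvPolynomial (Fin 2) K} (hF : F.IsHomogeneous d) (hG : G.IsHomogeneous d)
    (hFm : NearMono d p F) (hGm : NearMono d p' G) (hp : 2 * p' + 1 ≤ d ∨ 2 * p ≤ d + 1)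
    {α β γ δ : K} (hdet : α * δ - β * γ ≠ 0) {T : ℝ} (hT : BoundedConj F G α β γ δ T)
    (hα : ‖α‖ < ‖δ‖) (hβ : ‖β‖ < ‖δ‖) (hγ : ‖γ‖ ≤ ‖δ‖) :
    ‖α * δ - β * γ‖ ^ (d - 1) ≤ T ^ 2 := by
  have hδ : 0 < ‖δ‖ := (norm_nonneg _).trans_lt hα
  have hδ0 : δ ≠ 0 := norm_pos_iff.1 hδ
  set D := α * δ - β * γ with hD
  set c := D / δ ^ 2 with hc
  set z := β / δ with hz
  have hz1 : ‖z‖ < 1 := by rw [hz, norm_div, div_lt_one hδ]; exact hβ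
  have hc0 : 0 < ‖c‖ := norm_pos_iff.2 (div_ne_zero hdet (pow_ne_zero _ hδ0))
  have hDc : ‖D‖ = ‖δ‖ ^ 2 * ‖c‖ := by
    rw [hc, norm_div, norm_pow, mul_div_cancel₀]
    positivity
  have hc1 : ‖c‖ ≤ 1 := by
    rw [hc, norm_div, norm_pow, div_le_one (by positivity), pow_two]
    refine norm_sub_le_of_le ?_ ?_ <;> rw [norm_mul]
    · gcongr
    · gcongr
  set g : Polynomial K := MvPolynomial.aeval ![Polynomial.X + Polynomial.C z, 1] G with hg
  set f : Polynomial K := MvPolynomial.aeval ![Polynomial.X + Polynomial.C z, 1] F with hf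
  have heval (H : MvPolynomial (Fin 2) K) (u : K) :
      (MvPolynomial.aeval ![Polynomial.X + Polynomial.C z, 1] H : Polynomial K).eval u =
        MvPolynomial.eval ![u + z, 1] H := by
    rw [← Polynomial.coe_aeval_eq_eval, MvPolynomial.comp_aeval_apply,
      ← MvPolynomial.coe_aeval_eq_eval, RingHom.coe_coe]
    congr 2
    funext i
    fin_cases i <;> simp
  have hcoef {H : MvPolynomial (Fin 2) K} {r : ℕ} (hH : NearMono d r H) (e : K) (h : Polynomial K)
      (hh : ∀ u : K, ‖u‖ ≤ 1 → h.eval u = MvPolynomial.eval ![u + z, 1] H -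
        z * (e * MvPolynomial.eval ![u + z, 1] G)) (he : ‖e‖ ≤ 1) : ‖h.coeff r‖ = 1 := by
    obtain ⟨-, a, ha, hH⟩ := hH
    have := norm_coeff_lt_of_eval (f := h - Polynomial.C a * Polynomial.X ^ r) (T := 1) (fun u hu => by
      have huz : ‖u + z‖ ≤ 1 := norm_add_le_of_le hu.le hz1.le
      have h1 := hH (u + z) 1 huz norm_one.le
      have h2 : ‖a * (u + z) ^ r - a * u ^ r‖ < 1 := by
        rw [← mul_sub, norm_mul, ha, one_mul]
        refine (norm_pow_sub_pow_le huz hu.le r).trans_lt ?_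
        rwa [add_sub_cancel_left]
      have h3 : ‖z * (e * MvPolynomial.eval ![u + z, 1] G)‖ < 1 := by
        rw [norm_mul, norm_mul]
        exact mul_lt_one_of_nonneg_of_lt_one_left (norm_nonneg _) hz1
          (mul_le_one₀ he (norm_nonneg _) (hGm.norm_eval_le huz norm_one.le))
      rw [Polynomial.eval_sub, hh u hu.le]
      simp only [Polynomial.eval_mul, Polynomial.eval_C, Polynomial.eval_pow, Polynomial.eval_X]
      convert norm_sub_lt_of_lt (norm_add_lt_of_lt h1 h2) h3 using 2
      ring) r
    refine norm_eq_one_of_norm_sub_lt ha ?_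
    simpa using this
  have hgp : ‖g.coeff p'‖ = 1 := hcoef hGm 0 g (fun u _ => by rw [hg, heval]; ring) (by simp)
  have hhp : ‖(f - Polynomial.C z * g).coeff p‖ = 1 := hcoef hFm 1 _ (fun u _ => by
    rw [hf, hg, Polynomial.eval_sub, Polynomial.eval_mul, heval, heval, Polynomial.eval_C]; ring)
    (by simp)
  have hbound (u : K) (hu : ‖u‖ = 1) : ‖δ‖ ^ (d - 1) * ‖g.eval (c * u)‖ ≤ T ∧
      ‖δ‖ ^ (d - 1) * ‖(f - Polynomial.C z * g).eval (c * u)‖ ≤ T * ‖c‖ := by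
    have hv : ![α * u + β * (1 - γ / δ * u), γ * u + δ * (1 - γ / δ * u)] =
        ![δ * (c * u + z), δ * 1] := by
      congr 1
      · rw [hc, hz, hD]; field_simp; ring
      · congr 1
        field_simp; ring
    have hy : ‖1 - γ / δ * u‖ ≤ 1 := by
      refine norm_sub_le_of_le norm_one.le ?_
      rw [norm_mul, hu, mul_one, norm_div]
      exact div_le_one_of_le₀ hγ (norm_nonneg _)
    have hT' := hT u (1 - γ / δ * u)
    rw [hv, eval_mul_mul hF, eval_mul_mul hG] at hT'
    rw [Polynomial.eval_sub, Polynomial.eval_mul, Polynomial.eval_C, hf, hg, heval, heval]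
    set Fv := MvPolynomial.eval ![c * u + z, 1] F
    set Gv := MvPolynomial.eval ![c * u + z, 1] G
    obtain ⟨h1, h2⟩ := hT' ((δ * (δ ^ d * Fv) - β * (δ ^ d * Gv)) / D)
      ((α * (δ ^ d * Gv) - γ * (δ ^ d * Fv)) / D) hu.le hy (cramer hD hdet _ _).1 (cramer hD hdet _ _).2
    have hT0 := (norm_nonneg _).trans h1
    obtain ⟨e, rfl⟩ := Nat.exists_eq_add_of_lt hd
    simp only [zero_add, Nat.add_sub_cancel] at h1 h2 ⊢
    constructor
    · refine le_of_mul_le_mul_left ?_ hδ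
      have : γ * ((δ * (δ ^ (e + 1) * Fv) - β * (δ ^ (e + 1) * Gv)) / D) +
          δ * ((α * (δ ^ (e + 1) * Gv) - γ * (δ ^ (e + 1) * Fv)) / D) = δ ^ (e + 1) * Gv :=
        (cramer hD hdet _ _).2
      rw [← mul_assoc, ← pow_succ', ← norm_pow, ← norm_mul, ← this]
      refine norm_add_le_of_le ?_ ?_ <;> rw [norm_mul] <;> gcongr
    · have : δ ^ e * (Fv - z * Gv) = (δ * (δ ^ (e + 1) * Fv) - β * (δ ^ (e + 1) * Gv)) / D * c := by
        rw [hc, hz]; field_simp; ring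
      rw [← norm_pow, ← norm_mul, this, norm_mul]
      gcongr
  have hδd : 0 < ‖δ‖ ^ (d - 1) := by positivity
  have hcomp {h : Polynomial K} {T' : ℝ} (r : ℕ) (hr : ‖h.coeff r‖ = 1)
      (hb : ∀ u : K, ‖u‖ = 1 → ‖δ‖ ^ (d - 1) * ‖h.eval (c * u)‖ ≤ T') :
      ‖δ‖ ^ (d - 1) * ‖c‖ ^ r ≤ T' := by
    have := norm_coeff_le_of_eval (f := h.comp (Polynomial.C c * Polynomial.X))
      (T := T' / ‖δ‖ ^ (d - 1)) (fun u hu => by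
        rw [le_div_iff₀' hδd]
        simpa using hb u hu) r
    rw [Polynomial.comp_C_mul_X_coeff, norm_mul, hr, one_mul, norm_pow, le_div_iff₀' hδd] at this
    exact this
  have h1 := hcomp p' hgp fun u hu => (hbound u hu).1
  have h2 := hcomp p hhp fun u hu => (hbound u hu).2
  have hT0 : 0 ≤ T := le_trans (by positivity) h1
  have hfin : ‖D‖ ^ (d - 1) = (‖δ‖ ^ (d - 1)) ^ 2 * ‖c‖ ^ (d - 1) := by
    rw [hDc, mul_pow, ← pow_mul, ← pow_mul, mul_comm 2]
  rw [hfin]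
  rcases hp with hp | hp
  · calc (‖δ‖ ^ (d - 1)) ^ 2 * ‖c‖ ^ (d - 1) ≤ (‖δ‖ ^ (d - 1)) ^ 2 * ‖c‖ ^ (2 * p') := by
          gcongr ?_ * ?_
          exact pow_le_pow_of_le_one hc0.le hc1 (by omega)
      _ = (‖δ‖ ^ (d - 1) * ‖c‖ ^ p') ^ 2 := by rw [mul_pow, ← pow_mul ‖c‖, mul_comm 2]
      _ ≤ T ^ 2 := by gcongr
  · refine le_of_mul_le_mul_right ?_ (pow_pos hc0 2)
    calc (‖δ‖ ^ (d - 1)) ^ 2 * ‖c‖ ^ (d - 1) * ‖c‖ ^ 2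
        = (‖δ‖ ^ (d - 1)) ^ 2 * ‖c‖ ^ (d + 1) := by
          rw [mul_assoc, ← pow_add, show d - 1 + 2 = d + 1 by omega]
      _ ≤ (‖δ‖ ^ (d - 1)) ^ 2 * ‖c‖ ^ (2 * p) := by
          gcongr ?_ * ?_
          exact pow_le_pow_of_le_one hc0.le hc1 (by omega)
      _ = (‖δ‖ ^ (d - 1) * ‖c‖ ^ p) ^ 2 := by rw [mul_pow, ← pow_mul ‖c‖, mul_comm 2]
      _ ≤ (T * ‖c‖) ^ 2 := by gcongr
      _ = T ^ 2 * ‖c‖ ^ 2 := mul_pow _ _ _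

lemma norm_pow_det_le_of_max_lt [IsAlgClosed K] {d p p' : ℕ} (hd : 0 < d)
    {F G : MvPolynomial (Fin 2) K} (hF : F.IsHomogeneous d) (hG : G.IsHomogeneous d)
    (hFm : NearMono d p F) (hGm : NearMono d p' G) (hp : 2 * p' + 1 ≤ d ∨ 2 * p ≤ d + 1)
    {α β γ δ : K} (hdet : α * δ - β * γ ≠ 0) {T : ℝ} (hT : BoundedConj F G α β γ δ T)
    (h : max ‖α‖ ‖β‖ < max ‖γ‖ ‖δ‖) :
    ‖α * δ - β * γ‖ ^ (d - 1) ≤ T ^ 2 := by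
  have hα := (le_max_left _ _).trans_lt h
  have hβ := (le_max_right _ _).trans_lt h
  rcases le_total ‖γ‖ ‖δ‖ with hle | hle
  · rw [max_eq_right hle] at hα hβ
    exact norm_pow_det_le_of_lt hd hF hG hFm hGm hp hdet hT hα hβ hle
  · rw [max_eq_left hle] at hα hβ
    rw [norm_sub_rev]
    refine norm_pow_det_le_of_lt hd hF hG hFm hGm hp ?_ hT.swap_cols hβ hα hle
    rw [← neg_sub]
    exact neg_ne_zero.2 hdet

lemma norm_pow_det_le [IsAlgClosed K] {d p p' : ℕ} (hd : 0 < d)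
    {F G : MvPolynomial (Fin 2) K} (hF : F.IsHomogeneous d) (hG : G.IsHomogeneous d)
    (hFm : NearMono d p F) (hGm : NearMono d p' G) (hp : 2 * p' + 1 ≤ d ∨ 2 * p ≤ d + 1)
    (hp' : 2 * (d - p) + 1 ≤ d ∨ 2 * (d - p') ≤ d + 1)
    {α β γ δ : K} (hdet : α * δ - β * γ ≠ 0) {T : ℝ} (hT : BoundedConj F G α β γ δ T) :
    ‖α * δ - β * γ‖ ^ (d - 1) ≤ T ^ 2 := by
  rcases lt_trichotomy (max ‖α‖ ‖β‖) (max ‖γ‖ ‖δ‖) with h | h | h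
  · exact norm_pow_det_le_of_max_lt hd hF hG hFm hGm hp hdet hT h
  · exact norm_pow_det_le_of_eq hd hF hFm hdet hT h
  · have e : γ * β - δ * α = -(α * δ - β * γ) := by ring
    have := norm_pow_det_le_of_max_lt hd (isHomogeneous_swapVars hG) (isHomogeneous_swapVars hF)
      hGm.swapVars hFm.swapVars hp' (by rw [e]; exact neg_ne_zero.2 hdet) hT.swap_rows h
    rwa [e, norm_neg] at this

/-- A pair with monomial reduction attains the minimal resultant under these conditions on the
exponents. -/
lemma Rmin_eq_of_monoPair [IsAlgClosed K] {d p p' : ℕ} (hd : 0 < d) {P : FormPair K}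
    (hP : HomPair d P) (h0 : bres d P.1 P.2 ≠ 0) (hm : MonoPair d p p' P)
    (hp : 2 * p' + 1 ≤ d ∨ 2 * p ≤ d + 1) (hp' : 2 * (d - p) + 1 ≤ d ∨ 2 * (d - p') ≤ d + 1) :
    Rmin K d P.1 P.2 = ordv K (bres d P.1 P.2) := by
  have h1 := Rpair_conjP hP h0 1
  refine le_antisymm ?_ ?_
  · have := Rmin_le hP h0 1
    rw [h1, conjP_one, maxNorm_eq_one hP hm] at this
    simpa using this
  · rw [Rmin_eq]
    refine le_ciInf fun M => ?_
    rw [Rpair_conjP hP h0 M]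
    set T := maxNorm K d (conjP M P).1 (conjP M P).2 with hTdef
    have hTpos : 0 < T := maxNorm_pos hd (bres_conjP_ne_zero hP h0 M)
    have hdet := det_ne_zero M
    have hb : BoundedConj P.1 P.2 (M.1 0 0) (M.1 0 1) (M.1 1 0) (M.1 1 1) T := by
      intro x y c₁ c₂ hx hy h1 h2
      obtain ⟨e1, e2⟩ := conjP_eval M P x y
      rw [← e1] at h1
      rw [← e2] at h2
      have hB := norm_eval_le_maxNorm (hP.conjP M) hx hy
      rw [Matrix.det_fin_two] at hdet
      have h3 : c₁ = MvPolynomial.eval ![x, y] (conjP M P).1 := by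
        refine mul_left_cancel₀ hdet ?_
        linear_combination M.1 1 1 * h1 - M.1 0 1 * h2
      have h4 : c₂ = MvPolynomial.eval ![x, y] (conjP M P).2 := by
        refine mul_left_cancel₀ hdet ?_
        linear_combination M.1 0 0 * h2 - M.1 1 0 * h1
      rw [h3, h4]
      exact hB
    have key := norm_pow_det_le hd hP.1 hP.2 hm.1 hm.2 hp hp'
      (by rwa [Matrix.det_fin_two] at hdet) hb
    rw [← Matrix.det_fin_two] at key
    have hlog := Real.log_le_log (pow_pos (norm_pos_iff.2 hdet) _) key
    rw [Real.log_pow, Real.log_pow, Nat.cast_sub (show 1 ≤ d from hd)] at hlog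
    have := mul_le_mul_of_nonneg_left hlog (Nat.cast_nonneg d : (0 : ℝ) ≤ d)
    push_cast at this
    linarith

lemma NearMono.exists_bound [IsAlgClosed K] {d p : ℕ} {F : MvPolynomial (Fin 2) K}
    (hF : F.IsHomogeneous d) (h : NearMono d p F) : ∃ a : K, ∃ θ : ℝ, ‖a‖ = 1 ∧ θ < 1 ∧ 0 ≤ θ ∧
      ∀ x y : K, ‖x‖ ≤ 1 → ‖y‖ ≤ 1 →
        ‖MvPolynomial.eval ![x, y] F - a * x ^ p * y ^ (d - p)‖ ≤ θ := by
  obtain ⟨hp, a, ha, h⟩ := h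
  set H := F - C a * X 0 ^ p * X 1 ^ (d - p) with hH
  have hev (x y : K) : MvPolynomial.eval ![x, y] H =
      MvPolynomial.eval ![x, y] F - a * x ^ p * y ^ (d - p) := by simp [hH]
  have hHd : H.IsHomogeneous d := by
    refine hF.sub ?_
    have := ((isHomogeneous_C (Fin 2) a).mul ((isHomogeneous_X K (0 : Fin 2)).pow p)).mul
      ((isHomogeneous_X K (1 : Fin 2)).pow (d - p))
    rwa [zero_add, one_mul, one_mul, Nat.add_sub_of_le hp] at this
  obtain ⟨u, hu, hc⟩ := exists_norm_one_coeff_le_eval (dehom H)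
  refine ⟨a, ‖(dehom H).eval u‖, ha, ?_, norm_nonneg _, fun x y hx hy => ?_⟩
  · rw [eval_dehom, hev]
    exact h 1 u norm_one.le hu.le
  · rw [← hev]
    refine (norm_eval_le_maxNorm (P := (H, H)) ⟨hHd, hHd⟩ hx hy).1.trans
      (maxNorm_le fun i hi => ?_)
    have := hc i
    rw [dehom_coeff hHd, if_pos hi] at this
    exact ⟨this, this⟩

omit [IsUltrametricDist K] in
lemma exists_norm_lt_one_pow_gt [IsAlgClosed K] {θ : ℝ} (hθ : θ < 1) (N : ℕ) :
    ∃ c : K, c ≠ 0 ∧ ‖c‖ < 1 ∧ θ < ‖c‖ ^ N := by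
  obtain ⟨c₀, hc0, hc1⟩ := NormedField.exists_norm_lt_one K
  have ht : Filter.Tendsto (fun n : ℕ => (‖c₀‖ ^ ((n : ℝ) + 1)⁻¹) ^ N) Filter.atTop
      (nhds ((‖c₀‖ ^ (0 : ℝ)) ^ N)) := by
    refine Filter.Tendsto.pow (Filter.Tendsto.rpow tendsto_const_nhds ?_ (Or.inl hc0.ne')) N
    exact tendsto_inv_atTop_zero.comp
      (Filter.tendsto_atTop_add_const_right _ _ tendsto_natCast_atTop_atTop)
  rw [Real.rpow_zero, one_pow] at ht
  obtain ⟨n, hn⟩ := (ht.eventually (lt_mem_nhds hθ)).exists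
  obtain ⟨c, hc⟩ := IsAlgClosed.exists_pow_nat_eq c₀ (Nat.succ_pos n)
  have hcn : ‖c‖ ^ (n + 1) = ‖c₀‖ := by rw [← norm_pow, ← hc]
  have hcn' : ‖c‖ = ‖c₀‖ ^ ((n : ℝ) + 1)⁻¹ := by
    rw [← hcn, ← Real.rpow_natCast, ← Real.rpow_mul (norm_nonneg _)]
    push_cast
    rw [mul_inv_cancel₀ (by positivity), Real.rpow_one]
  refine ⟨c, ?_, ?_, ?_⟩
  · rintro rfl
    rw [norm_zero, zero_pow (Nat.succ_ne_zero n)] at hcn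
    exact hc0.ne hcn
  · rw [← hcn] at hc1
    exact (pow_lt_one_iff_of_nonneg (norm_nonneg _) (Nat.succ_ne_zero n)).1 hc1
  · rwa [hcn']

/-- A pair with monomial reduction and large exponents does not attain the minimal resultant. -/
lemma Rmin_lt_of_monoPair [IsAlgClosed K] {d p p' : ℕ} (hd : 0 < d) {P : FormPair K}
    (hP : HomPair d P) (h0 : bres d P.1 P.2 ≠ 0) (hm : MonoPair d p p' P)
    (hp : d + 1 < 2 * p) (hp' : d < 2 * p' + 1) :
    Rmin K d P.1 P.2 < ordv K (bres d P.1 P.2) := by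
  obtain ⟨a, θ₁, ha, hθ₁, hθ₁', hF⟩ := hm.1.exists_bound hP.1
  obtain ⟨b, θ₂, hb, hθ₂, hθ₂', hG⟩ := hm.2.exists_bound hP.2
  set θ := max θ₁ θ₂
  have hθ : θ < 1 := max_lt hθ₁ hθ₂
  have hθ' : 0 ≤ θ := hθ₁'.trans (le_max_left _ _)
  obtain ⟨c, hc0, hc1, hc⟩ := exists_norm_lt_one_pow_gt (K := K) (θ := θ ^ 2)
    (pow_lt_one₀ hθ' hθ two_ne_zero) (d + 1)
  have hcpos : 0 < ‖c‖ := norm_pos_iff.2 hc0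
  let M : GL (Fin 2) K := GeneralLinearGroup.mkOfDetNeZero !![c, 0; 0, 1] (by simpa using hc0)
  have hMdet : M.1.det = c := by simp [M, GeneralLinearGroup.mkOfDetNeZero]
  have hev (x y : K) : c * MvPolynomial.eval ![x, y] (conjP M P).1 =
        MvPolynomial.eval ![c * x, y] P.1 ∧
      MvPolynomial.eval ![x, y] (conjP M P).2 = MvPolynomial.eval ![c * x, y] P.2 := by
    have := conjP_eval M P x y
    have e : M.1 = !![c, 0; 0, 1] := rfl
    rw [e] at this
    simpa using this
  set T := max (‖c‖ ^ (p - 1)) (max (‖c‖ ^ p') (θ / ‖c‖)) with hT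
  have hTpos : 0 < T := lt_of_lt_of_le (by positivity) (le_max_left _ _)
  have hcT : max (‖c‖ ^ p) θ ≤ ‖c‖ * T := by
    refine max_le ?_ ?_
    · obtain ⟨r, rfl⟩ : ∃ r, p = r + 1 := ⟨p - 1, by omega⟩
      rw [pow_succ']
      exact mul_le_mul_of_nonneg_left (le_max_left _ _) (norm_nonneg _)
    · rw [← div_le_iff₀' hcpos]
      exact (le_max_right _ _).trans (le_max_right _ _)
  have hcT' : max (‖c‖ ^ p') θ ≤ T := by
    refine max_le ((le_max_left _ _).trans (le_max_right _ _)) ?_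
    refine le_trans ?_ ((le_max_right _ _).trans (le_max_right _ _))
    rw [le_div_iff₀ hcpos]
    exact mul_le_of_le_one_right hθ' hc1.le
  have hmon {H : MvPolynomial (Fin 2) K} {r : ℕ} {e : K} {η : ℝ} (he : ‖e‖ = 1) (hη : η ≤ θ)
      (hH : ∀ x y : K, ‖x‖ ≤ 1 → ‖y‖ ≤ 1 →
        ‖MvPolynomial.eval ![x, y] H - e * x ^ r * y ^ (d - r)‖ ≤ η) {x y : K} (hx : ‖x‖ ≤ 1)
      (hy : ‖y‖ ≤ 1) : ‖MvPolynomial.eval ![c * x, y] H‖ ≤ max (‖c‖ ^ r) θ := by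
    have hcx : ‖c * x‖ ≤ 1 := by
      rw [norm_mul]
      exact mul_le_one₀ hc1.le (norm_nonneg _) hx
    have h1 := (hH (c * x) y hcx hy).trans hη
    have h2 : ‖e * (c * x) ^ r * y ^ (d - r)‖ ≤ ‖c‖ ^ r := by
      have := norm_monomial_le he hx hy r (d - r)
      rw [show e * (c * x) ^ r * y ^ (d - r) = c ^ r * (e * x ^ r * y ^ (d - r)) by ring,
        norm_mul, norm_pow]
      exact mul_le_of_le_one_right (by positivity) this
    rw [← sub_add_cancel (MvPolynomial.eval ![c * x, y] H) (e * (c * x) ^ r * y ^ (d - r))]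
    exact norm_add_le_of_le (h1.trans (le_max_right _ _)) (h2.trans (le_max_left _ _))
  have hmax : maxNorm K d (conjP M P).1 (conjP M P).2 ≤ T := by
    refine maxNorm_le_of_eval (hP.conjP M) fun x y hx hy => ⟨?_, ?_⟩
    · have h1 := (hmon ha (le_max_left _ _) hF hx hy).trans hcT
      rw [← (hev x y).1, norm_mul] at h1
      exact le_of_mul_le_mul_left h1 hcpos
    · rw [(hev x y).2]
      exact (hmon hb (le_max_right _ _) hG hx hy).trans hcT'
  have hT2 : T ^ 2 < ‖c‖ ^ (d - 1) := by
    have h1 : (‖c‖ ^ (p - 1)) ^ 2 < ‖c‖ ^ (d - 1) := by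
      rw [← pow_mul]
      exact pow_lt_pow_right_of_lt_one₀ hcpos hc1 (by omega)
    have h2 : (‖c‖ ^ p') ^ 2 < ‖c‖ ^ (d - 1) := by
      rw [← pow_mul]
      exact pow_lt_pow_right_of_lt_one₀ hcpos hc1 (by omega)
    have h3 : (θ / ‖c‖) ^ 2 < ‖c‖ ^ (d - 1) := by
      rw [div_pow, div_lt_iff₀ (by positivity), ← pow_add, show d - 1 + 2 = d + 1 by omega]
      exact hc
    rcases max_choice (‖c‖ ^ (p - 1)) (max (‖c‖ ^ p') (θ / ‖c‖)) with h | h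
    · rw [hT, h]
      exact h1
    · rw [hT, h]
      rcases max_choice (‖c‖ ^ p') (θ / ‖c‖) with h | h <;> rw [h]
      exacts [h2, h3]
  refine (Rmin_le hP h0 M).trans_lt ?_
  rw [Rpair_conjP hP h0 M, hMdet]
  have hmp := maxNorm_pos hd (bres_conjP_ne_zero hP h0 M)
  have hl1 := Real.log_le_log hmp hmax
  have hl2 := Real.log_lt_log (by positivity) hT2
  rw [Real.log_pow, Real.log_pow, Nat.cast_sub (show 1 ≤ d from hd)] at hl2
  push_cast at hl2
  have hd' : (0 : ℝ) < d := Nat.cast_pos.2 hd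
  nlinarith [mul_lt_mul_of_pos_left hl2 hd', mul_le_mul_of_nonneg_left hl1 hd'.le]

omit [IsUltrametricDist K] in
lemma exists_norm_coeff_max (f : Polynomial K) : ∃ k, ∀ i, ‖f.coeff i‖ ≤ ‖f.coeff k‖ := by
  obtain ⟨k, hk⟩ := dominant_nonempty one_pos f
  exact ⟨k, fun i => by simpa using hk i⟩

lemma exists_gauss_norm [IsAlgClosed K] {P Q : Polynomial K} {e : K} (he : e ≠ 0) (a b : ℕ)
    (h : ∀ u : K, ‖u‖ = 1 → ∃ z ξ : K, ‖z‖ ≤ 1 ∧ ‖u - z‖ < 1 ∧ Q.eval z ≠ 0 ∧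
      P.eval z = ξ * Q.eval z ∧ ‖ξ * u ^ a - e * u ^ b‖ < ‖e‖) :
    ∃ B : ℝ, 0 < B ∧ (∀ i, ‖Q.coeff i‖ ≤ B) ∧ (∃ i, ‖Q.coeff i‖ = B) ∧
      (∀ i, ‖P.coeff i‖ ≤ ‖e‖ * B) ∧ (∃ i, ‖P.coeff i‖ = ‖e‖ * B) ∧
      ∀ k, ‖(Polynomial.X ^ a * P).coeff k‖ = ‖e‖ * B ↔
        ‖(Polynomial.X ^ b * Q).coeff k‖ = B := by
  have he' : 0 < ‖e‖ := norm_pos_iff.2 he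
  obtain ⟨k, hk⟩ := exists_norm_coeff_max P
  obtain ⟨l, hl⟩ := exists_norm_coeff_max Q
  have hpos {R : Polynomial K} {j : ℕ} (hj : ∀ i, ‖R.coeff i‖ ≤ ‖R.coeff j‖) (hR : R ≠ 0) :
      0 < ‖R.coeff j‖ := by
    refine (norm_nonneg _).lt_of_ne' fun h0 => hR (Polynomial.ext fun i => ?_)
    have := hj i
    rw [h0] at this
    simpa using this
  obtain ⟨z, ξ, -, -, hQz, hPz, hξ⟩ := h 1 norm_one
  have hQ0 : Q ≠ 0 := by
    rintro rfl
    simp at hQz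
  have hP0 : P ≠ 0 := by
    rintro rfl
    rw [Polynomial.eval_zero, eq_comm, mul_eq_zero, or_iff_left hQz] at hPz
    simp [hPz] at hξ
  have hA := hpos hk hP0
  have hB := hpos hl hQ0
  set A := ‖P.coeff k‖ with hAdef
  set B := ‖Q.coeff l‖ with hBdef
  have hX (R : Polynomial K) (c : ℕ) {T : ℝ} (hT : 0 ≤ T) (hR : ∀ i, ‖R.coeff i‖ ≤ T) (i : ℕ) :
      ‖(Polynomial.X ^ c * R).coeff i‖ ≤ T := by
    rw [Polynomial.coeff_X_pow_mul']
    split_ifs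
    · exact hR _
    · simpa using hT
  have hc := comparison (P := Polynomial.X ^ a * P) (Q := Polynomial.C e * (Polynomial.X ^ b * Q))
    (A := A) (B := ‖e‖ * B) (hX P a hA.le hk) (fun i => by
      rw [Polynomial.coeff_C_mul, norm_mul]
      exact mul_le_mul_of_nonneg_left (hX Q b hB.le hl i) he'.le)
    ⟨k + a, by rw [Polynomial.coeff_X_pow_mul]⟩
    ⟨l + b, by rw [Polynomial.coeff_C_mul, norm_mul, Polynomial.coeff_X_pow_mul]⟩ (fun u hu => by
      obtain ⟨z, ξ, hz, huz, -, hPz, hξ⟩ := h u hu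
      simp only [Polynomial.eval_mul, Polynomial.eval_pow, Polynomial.eval_X, Polynomial.eval_C]
      rw [show u ^ a * P.eval u - e * (u ^ b * Q.eval u) = u ^ a * (P.eval u - P.eval z) +
        ((ξ * u ^ a - e * u ^ b) * Q.eval z + -(e * u ^ b * (Q.eval u - Q.eval z))) by
          rw [hPz]; ring]
      have h1 : ‖u ^ a * (P.eval u - P.eval z)‖ < A := by
        rw [norm_mul, norm_pow, hu, one_pow, one_mul]
        exact (norm_eval_sub_eval_le hA.le hk hu.le hz).trans_lt (mul_lt_of_lt_one_right hA huz)
      have h2 : ‖(ξ * u ^ a - e * u ^ b) * Q.eval z‖ < ‖e‖ * B := by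
        rw [norm_mul]
        exact mul_lt_mul_of_lt_of_le_of_nonneg_of_pos hξ (norm_eval_le hB.le hl hz)
          (norm_nonneg _) hB
      have h3 : ‖-(e * u ^ b * (Q.eval u - Q.eval z))‖ < ‖e‖ * B := by
        rw [norm_neg, norm_mul, norm_mul, norm_pow, hu, one_pow, mul_one]
        exact mul_lt_mul_of_pos_left ((norm_eval_sub_eval_le hB.le hl hu.le hz).trans_lt
          (mul_lt_of_lt_one_right hB huz)) he'
      exact norm_add_lt_of_lt (lt_max_of_lt_left h1)
        (lt_max_of_lt_right (norm_add_lt_of_lt h2 h3)))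
  refine ⟨B, hB, hl, ⟨l, rfl⟩, fun i => hc.1 ▸ hk i, ⟨k, hc.1⟩, fun j => ?_⟩
  rw [← hc.1, hc.2 j, Polynomial.coeff_C_mul, norm_mul, mul_right_inj' he'.ne']

/-- The elements whose `(2 * m)`-th power has absolute value strictly between those of `q ^ (i + 1)` and
`q ^ i`. -/
def annulus (q : K) (m i : ℕ) : Set K := {c | ‖q‖ ^ (i + 1) < ‖c‖ ^ (2 * m) ∧ ‖c‖ ^ (2 * m) < ‖q‖ ^ i}

section annulus

variable {q c : K} {m i : ℕ}

omit [IsUltrametricDist K] in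
lemma norm_pos_of_mem_annulus (hm : 2 ≤ m) (hq0 : q ≠ 0) (hc : c ∈ annulus q m i) : 0 < ‖c‖ := by
  refine (norm_nonneg _).lt_of_ne' fun h0 => ?_
  have h1 : 0 < ‖q‖ ^ (i + 1) := pow_pos (norm_pos_iff.2 hq0) _
  have h2 := hc.1
  rw [h0, zero_pow (by omega)] at h2
  exact lt_asymm h1 h2

omit [IsUltrametricDist K] in
lemma norm_lt_of_mem_annulus {c' : K} (hc : c ∈ annulus q m i)
    (hc' : c' ∈ annulus q m (i + 1)) : ‖c'‖ < ‖c‖ :=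
  lt_of_pow_lt_pow_left₀ (2 * m) (norm_nonneg _) (hc'.2.trans hc.1)

omit [IsUltrametricDist K] in
lemma pow_ne_zpow_of_mem_annulus (hq0 : q ≠ 0) (hq1 : ‖q‖ < 1) (hc : c ∈ annulus q m i) {w : K}
    (hw : ‖w‖ = ‖c‖) (n : ℤ) : w ^ m ≠ q ^ n := by
  intro h
  have hq : 0 < ‖q‖ := norm_pos_iff.2 hq0
  have h1 : ‖c‖ ^ (2 * m) = ‖q‖ ^ (n * 2) := by
    rw [_root_.zpow_mul, ← norm_zpow, ← h, norm_pow, hw, mul_comm, pow_mul]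
    norm_cast
  obtain ⟨h2, h3⟩ := hc
  rw [h1, ← zpow_natCast] at h2 h3
  rw [zpow_lt_zpow_iff_right_of_lt_one₀ hq hq1] at h2 h3
  push_cast at h2
  omega

omit [IsUltrametricDist K] in
lemma norm_sq_of_mem_annulus (hm : 2 ≤ m) (hi : i < m) (hq1 : ‖q‖ < 1)
    (hc : c ∈ annulus q m i) : ‖c‖ ^ 2 < 1 ∧ ‖q‖ < ‖c‖ ^ 2 := by
  obtain ⟨h1, h2⟩ := hc
  rw [pow_mul] at h1 h2
  constructor
  · exact (pow_lt_one_iff_of_nonneg (by positivity) (show m ≠ 0 by omega)).1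
      (h2.trans_le (pow_le_one₀ (norm_nonneg _) hq1.le))
  · exact lt_of_pow_lt_pow_left₀ m (by positivity)
      ((pow_le_pow_of_le_one (norm_nonneg _) hq1.le (by omega)).trans_lt h1)

omit [IsUltrametricDist K] in
lemma exists_mem_annulus [IsAlgClosed K] (hm : 2 ≤ m) (hq0 : q ≠ 0) (hq1 : ‖q‖ < 1) (i : ℕ) :
    ∃ c : K, c ∈ annulus q m i := by
  obtain ⟨t, ht⟩ := IsAlgClosed.exists_pow_nat_eq q (show 0 < 4 * m by omega)
  have ht' : ‖t‖ ^ (4 * m) = ‖q‖ := by rw [← norm_pow, ht]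
  have ht1 : ‖t‖ < 1 := by
    rw [← ht'] at hq1
    exact (pow_lt_one_iff_of_nonneg (norm_nonneg _) (by omega)).1 hq1
  have ht0 : 0 < ‖t‖ := by
    refine norm_pos_iff.2 ?_
    rintro rfl
    rw [zero_pow (by omega)] at ht
    exact hq0 ht.symm
  refine ⟨t ^ (2 * i + 1), ?_, ?_⟩ <;> rw [norm_pow, ← ht', ← pow_mul, ← pow_mul] <;>
    refine pow_lt_pow_right_of_lt_one₀ ht0 ht1 ?_ <;> nlinarith

end annulus

/-- The pair `P` lifts a map `ψ` with `ψ (x w) = x (w ^ m)`. -/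
def LattesPair (q : K) (m : ℕ) (P : FormPair K) : Prop :=
  ∀ w : K, w ≠ 0 → (∀ n : ℤ, w ≠ q ^ n) → (∀ n : ℤ, w ^ m ≠ q ^ n) →
    MvPolynomial.eval ![xTate K q w, 1] P.2 ≠ 0 ∧
    MvPolynomial.eval ![xTate K q w, 1] P.1 =
      xTate K q (w ^ m) * MvPolynomial.eval ![xTate K q w, 1] P.2

/-- The polynomial `F(z, 1)`. -/
def affine (F : MvPolynomial (Fin 2) K) : Polynomial K := dehom (swapVars F)

omit [IsUltrametricDist K] in
lemma eval_affine (F : MvPolynomial (Fin 2) K) (z : K) :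
    (affine F).eval z = MvPolynomial.eval ![z, 1] F := by
  rw [affine, eval_dehom, eval_swapVars]

omit [IsUltrametricDist K] in
lemma eval_eq_sum_affine {d : ℕ} {F : MvPolynomial (Fin 2) K} (hF : F.IsHomogeneous d) (x y : K) :
    MvPolynomial.eval ![x, y] F =
      ∑ k ∈ Finset.range (d + 1), (affine F).coeff k * x ^ k * y ^ (d - k) := by
  rw [← eval_swapVars, eval_eq_sum (isHomogeneous_swapVars hF)]
  refine Finset.sum_congr rfl fun k hk => ?_
  rw [affine, dehom_coeff (isHomogeneous_swapVars hF),
    if_pos (Nat.lt_succ_iff.1 (Finset.mem_range.1 hk))]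
  ring

omit [IsUltrametricDist K] in
lemma affine_coeff_eq_zero {d : ℕ} {F : MvPolynomial (Fin 2) K} (hF : F.IsHomogeneous d) {k : ℕ}
    (hk : d < k) : (affine F).coeff k = 0 := by
  rw [affine, dehom_coeff (isHomogeneous_swapVars hF), if_neg (by omega)]

lemma LattesPair.sample {q : K} {m : ℕ} {P : FormPair K} (hL : LattesPair q m P) (hm : 2 ≤ m)
    (hq0 : q ≠ 0) (hq1 : ‖q‖ < 1) {i : ℕ} (hi : i < m) {c : K} (hc : c ∈ annulus q m i)
    {u : K} (hu : ‖u‖ = 1) :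
    ∃ z : K, ‖z‖ ≤ 1 ∧ ‖u - z‖ < 1 ∧ (affine P.2).eval (c * z) ≠ 0 ∧
      (affine P.1).eval (c * z) = xTate K q ((c * u) ^ m) * (affine P.2).eval (c * z) := by
  have hc0 := norm_pos_of_mem_annulus hm hq0 hc
  have hw : ‖c * u‖ = ‖c‖ := by rw [norm_mul, hu, mul_one]
  obtain ⟨hc1, hc2⟩ := norm_sq_of_mem_annulus hm hi hq1 hc
  have hpow := pow_ne_zpow_of_mem_annulus hq0 hq1 hc hw
  have hx := norm_xTate_sub_lt (q := q) (w := c * u) (by rwa [hw]) (by rwa [hw])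
  have hc0' := norm_pos_iff.1 hc0
  have hz : ‖u - xTate K q (c * u) / c‖ < 1 := by
    rw [norm_sub_rev, show xTate K q (c * u) / c - u = (xTate K q (c * u) - c * u) / c by
      field_simp, norm_div, div_lt_one hc0, ← hw]
    exact hx
  have h := hL (c * u) (norm_pos_iff.1 (hw ▸ hc0)) (fun n hn => hpow (n * m) (by
    rw [hn, _root_.zpow_mul, zpow_natCast])) hpow
  refine ⟨xTate K q (c * u) / c, ?_, hz, ?_⟩
  · rw [norm_sub_rev] at hz
    exact (norm_eq_one_of_norm_sub_lt hu hz).le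
  · rwa [mul_div_cancel₀ _ hc0', eval_affine, eval_affine]

lemma xTate_pow_even [CompleteSpace K] {q : K} {m j : ℕ} (hq0 : q ≠ 0)
    (hq1 : ‖q‖ < 1) {c : K} (hc : c ∈ annulus q m (2 * j)) {u : K} (hu : ‖u‖ = 1) :
    ‖xTate K q ((c * u) ^ m) * u ^ 0 - c ^ m / q ^ j * u ^ m‖ < ‖c ^ m / q ^ j‖ := by
  have hq : 0 < ‖q‖ := norm_pos_iff.2 hq0
  obtain ⟨h1, h2⟩ := hc
  have hn : ‖c ^ m / q ^ j * u ^ m‖ = ‖c ^ m / q ^ j‖ := by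
    rw [norm_mul, norm_pow u, hu, one_pow, mul_one]
  have hn2 : ‖c ^ m / q ^ j‖ ^ 2 = ‖c‖ ^ (2 * m) / ‖q‖ ^ (2 * j) := by
    rw [norm_div, norm_pow, norm_pow, div_pow, ← pow_mul, ← pow_mul, mul_comm m, mul_comm j]
  rw [show (c * u) ^ m = q ^ j * (c ^ m / q ^ j * u ^ m) by field_simp; ring,
    xTate_q_pow_mul hq0 hq1, pow_zero, mul_one]
  refine (norm_xTate_sub_lt ?_ ?_).trans_eq hn <;> rw [hn, hn2]
  · rw [div_lt_one (by positivity)]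
    exact h2
  · rw [lt_div_iff₀ (by positivity), ← pow_succ']
    exact h1

lemma xTate_pow_odd [CompleteSpace K] {q : K} {m j : ℕ} (hm : 2 ≤ m) (hq0 : q ≠ 0)
    (hq1 : ‖q‖ < 1) {c : K} (hc : c ∈ annulus q m (2 * j + 1)) {u : K} (hu : ‖u‖ = 1) :
    ‖xTate K q ((c * u) ^ m) * u ^ m - q ^ (j + 1) / c ^ m * u ^ 0‖ < ‖q ^ (j + 1) / c ^ m‖ := by
  have hq : 0 < ‖q‖ := norm_pos_iff.2 hq0
  have hc0 := norm_pos_of_mem_annulus hm hq0 hc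
  have hc0' := norm_pos_iff.1 hc0
  have hu0 : u ≠ 0 := norm_pos_iff.1 (hu ▸ one_pos)
  obtain ⟨h1, h2⟩ := hc
  have hn : ‖q ^ (j + 1) / c ^ m * (u ^ m)⁻¹‖ = ‖q ^ (j + 1) / c ^ m‖ := by
    rw [norm_mul, norm_inv, norm_pow u, hu, one_pow, inv_one, mul_one]
  have hn2 : ‖q ^ (j + 1) / c ^ m‖ ^ 2 = ‖q‖ ^ (2 * j + 2) / ‖c‖ ^ (2 * m) := by
    rw [norm_div, norm_pow, norm_pow, div_pow, ← pow_mul, ← pow_mul, mul_comm m, mul_comm (j + 1),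
      mul_add, mul_one]
  have hx : ‖xTate K q ((c * u) ^ m) - q ^ (j + 1) / c ^ m * (u ^ m)⁻¹‖ <
      ‖q ^ (j + 1) / c ^ m‖ := by
    rw [show (c * u) ^ m = q ^ (j + 1) * (q ^ (j + 1) / c ^ m * (u ^ m)⁻¹)⁻¹ by field_simp; ring,
      xTate_q_pow_mul hq0 hq1, xTate_inv]
    refine (norm_xTate_sub_lt ?_ ?_).trans_eq hn <;> rw [hn, hn2]
    · rw [div_lt_one (by positivity)]
      exact h1
    · rw [lt_div_iff₀ (by positivity)]
      calc ‖q‖ * ‖c‖ ^ (2 * m) < ‖q‖ * ‖q‖ ^ (2 * j + 1) := by gcongr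
        _ = ‖q‖ ^ (2 * j + 2) := by ring
  have e : xTate K q ((c * u) ^ m) * u ^ m - q ^ (j + 1) / c ^ m * u ^ 0 =
      (xTate K q ((c * u) ^ m) - q ^ (j + 1) / c ^ m * (u ^ m)⁻¹) * u ^ m := by
    rw [pow_zero, sub_mul, mul_assoc _ _ (u ^ m), inv_mul_cancel₀ (pow_ne_zero _ hu0)]
  rw [e, norm_mul, norm_pow, hu, one_pow, mul_one]
  exact hx

/-- The Gauss norms of `f` and `g` on the circle of radius `‖c‖`, and the places where they are
attained, are related by the factor `e * z ^ (b - a)`. -/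
def GaussRel (c e : K) (a b : ℕ) (f g : Polynomial K) : Prop :=
  ∃ B : ℝ, 0 < B ∧ (∀ i, ‖g.coeff i‖ * ‖c‖ ^ i ≤ B) ∧ (∃ i, ‖g.coeff i‖ * ‖c‖ ^ i = B) ∧
    (∀ i, ‖f.coeff i‖ * ‖c‖ ^ i ≤ ‖e‖ * B) ∧ (∃ i, ‖f.coeff i‖ * ‖c‖ ^ i = ‖e‖ * B) ∧
    ∀ k, (a ≤ k ∧ ‖f.coeff (k - a)‖ * ‖c‖ ^ (k - a) = ‖e‖ * B) ↔
      (b ≤ k ∧ ‖g.coeff (k - b)‖ * ‖c‖ ^ (k - b) = B)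

lemma gaussRel_of_sample [IsAlgClosed K] {c e : K} (he : e ≠ 0) {a b : ℕ} {f g : Polynomial K}
    (h : ∀ u : K, ‖u‖ = 1 → ∃ z ξ : K, ‖z‖ ≤ 1 ∧ ‖u - z‖ < 1 ∧ g.eval (c * z) ≠ 0 ∧
      f.eval (c * z) = ξ * g.eval (c * z) ∧ ‖ξ * u ^ a - e * u ^ b‖ < ‖e‖) :
    GaussRel c e a b f g := by
  obtain ⟨B, hB, h1, h2, h3, h4, h5⟩ := exists_gauss_norm
    (P := f.comp (Polynomial.C c * Polynomial.X)) (Q := g.comp (Polynomial.C c * Polynomial.X))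
    he a b (by simpa using h)
  simp only [Polynomial.comp_C_mul_X_coeff, norm_mul, norm_pow] at h1 h2 h3 h4
  refine ⟨B, hB, h1, h2, h3, h4, fun k => ?_⟩
  have hX (R : Polynomial K) (r : ℕ) {T : ℝ} (hT : 0 < T) :
      ‖(Polynomial.X ^ r * R.comp (Polynomial.C c * Polynomial.X)).coeff k‖ = T ↔
        (r ≤ k ∧ ‖R.coeff (k - r)‖ * ‖c‖ ^ (k - r) = T) := by
    rw [Polynomial.coeff_X_pow_mul']
    split_ifs with hr
    · simp [hr, Polynomial.comp_C_mul_X_coeff]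
    · simp [hr, hT.ne]
  rw [← hX f a (mul_pos (norm_pos_iff.2 he) hB), ← hX g b hB]
  exact h5 k

lemma LattesPair.gaussRel_even [IsAlgClosed K] [CompleteSpace K] {q : K} {m : ℕ} {P : FormPair K}
    (hL : LattesPair q m P) (hm : 2 ≤ m) (hq0 : q ≠ 0) (hq1 : ‖q‖ < 1) {j : ℕ} (hj : 2 * j < m)
    {c : K} (hc : c ∈ annulus q m (2 * j)) :
    GaussRel c (c ^ m / q ^ j) 0 m (affine P.1) (affine P.2) := by
  have hc0 := norm_pos_iff.1 (norm_pos_of_mem_annulus hm hq0 hc)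
  refine gaussRel_of_sample (by positivity) fun u hu => ?_
  obtain ⟨z, h1, h2, h3, h4⟩ := hL.sample hm hq0 hq1 hj hc hu
  exact ⟨z, _, h1, h2, h3, h4, xTate_pow_even hq0 hq1 hc hu⟩

lemma LattesPair.gaussRel_odd [IsAlgClosed K] [CompleteSpace K] {q : K} {m : ℕ} {P : FormPair K}
    (hL : LattesPair q m P) (hm : 2 ≤ m) (hq0 : q ≠ 0) (hq1 : ‖q‖ < 1) {j : ℕ} (hj : 2 * j + 1 < m)
    {c : K} (hc : c ∈ annulus q m (2 * j + 1)) :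
    GaussRel c (q ^ (j + 1) / c ^ m) m 0 (affine P.1) (affine P.2) := by
  have hc0 := norm_pos_iff.1 (norm_pos_of_mem_annulus hm hq0 hc)
  refine gaussRel_of_sample (by positivity) fun u hu => ?_
  obtain ⟨z, h1, h2, h3, h4⟩ := hL.sample hm hq0 hq1 hj hc hu
  exact ⟨z, _, h1, h2, h3, h4, xTate_pow_odd hm hq0 hq1 hc hu⟩

omit [IsUltrametricDist K] in
lemma mem_dominant_iff_of_max {f : Polynomial K} {r A : ℝ} (h : ∀ i, ‖f.coeff i‖ * r ^ i ≤ A)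
    (h' : ∃ i, ‖f.coeff i‖ * r ^ i = A) (k : ℕ) :
    k ∈ dominant r f ↔ ‖f.coeff k‖ * r ^ k = A := by
  obtain ⟨l, hl⟩ := h'
  exact ⟨fun hk => (h k).antisymm (hl ▸ hk l), fun hk i => hk ▸ h i⟩

omit [IsUltrametricDist K] in
lemma GaussRel.ne_zero {c e : K} (he : e ≠ 0) {a b : ℕ} {f g : Polynomial K}
    (h : GaussRel c e a b f g) : f ≠ 0 ∧ g ≠ 0 := by
  obtain ⟨B, hB, -, ⟨i, hi⟩, -, ⟨j, hj⟩, -⟩ := h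
  constructor
  · rintro rfl
    simp [he] at hj
    exact hB.ne' hj
  · rintro rfl
    simp [hB.ne] at hi

omit [IsUltrametricDist K] in
lemma GaussRel.dominant_iff {c e : K} {a b : ℕ} {f g : Polynomial K}
    (h : GaussRel c e a b f g) (k : ℕ) :
    (a ≤ k ∧ k - a ∈ dominant ‖c‖ f) ↔ (b ≤ k ∧ k - b ∈ dominant ‖c‖ g) := by
  obtain ⟨B, -, h1, h2, h3, h4, h5⟩ := h
  rw [mem_dominant_iff_of_max h3 h4, mem_dominant_iff_of_max h1 h2]
  exact h5 k

section slopes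

variable [IsAlgClosed K] [CompleteSpace K] {q : K} {m : ℕ} {P : FormPair K}

lemma LattesPair.affine_ne_zero (hL : LattesPair q m P) (hm : 2 ≤ m) (hq0 : q ≠ 0)
    (hq1 : ‖q‖ < 1) : affine P.1 ≠ 0 ∧ affine P.2 ≠ 0 := by
  obtain ⟨c, hc⟩ := exists_mem_annulus hm hq0 hq1 (2 * 0)
  have hc0 := norm_pos_iff.1 (norm_pos_of_mem_annulus hm hq0 hc)
  exact (hL.gaussRel_even hm hq0 hq1 (by omega) hc).ne_zero (by positivity)

lemma LattesPair.dominant_even (hL : LattesPair q m P) (hm : 2 ≤ m) (hq0 : q ≠ 0)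
    (hq1 : ‖q‖ < 1) {j : ℕ} (hj : 2 * j < m) {c : K} (hc : c ∈ annulus q m (2 * j)) (k : ℕ) :
    k ∈ dominant ‖c‖ (affine P.1) ↔ m ≤ k ∧ k - m ∈ dominant ‖c‖ (affine P.2) := by
  simpa using (hL.gaussRel_even hm hq0 hq1 hj hc).dominant_iff k

lemma LattesPair.dominant_odd (hL : LattesPair q m P) (hm : 2 ≤ m) (hq0 : q ≠ 0)
    (hq1 : ‖q‖ < 1) {j : ℕ} (hj : 2 * j + 1 < m) {c : K} (hc : c ∈ annulus q m (2 * j + 1)) (k : ℕ) :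
    k ∈ dominant ‖c‖ (affine P.2) ↔ m ≤ k ∧ k - m ∈ dominant ‖c‖ (affine P.1) := by
  simpa using ((hL.gaussRel_odd hm hq0 hq1 hj hc).dominant_iff k).symm

lemma LattesPair.dominant_le (hL : LattesPair q m P) (hm : 2 ≤ m) (hq0 : q ≠ 0) (hq1 : ‖q‖ < 1)
    (hP : HomPair (m ^ 2) P) (i : ℕ) (hi : i < m) {c : K} (hc : c ∈ annulus q m i) {k : ℕ}
    (hk : k ∈ dominant ‖c‖ (affine P.2)) : k + m + 2 * m * (i / 2) ≤ m ^ 2 := by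
  obtain ⟨hf, hg⟩ := hL.affine_ne_zero hm hq0 hq1
  induction i generalizing c k with
  | zero =>
    have hk' : k + m ∈ dominant ‖c‖ (affine P.1) :=
      (hL.dominant_even hm hq0 hq1 (j := 0) hi hc _).2
        ⟨Nat.le_add_left _ _, by rwa [Nat.add_sub_cancel]⟩
    have := coeff_ne_zero_of_mem_dominant (norm_pos_of_mem_annulus hm hq0 hc) hf hk'
    by_contra! hlt
    exact this (affine_coeff_eq_zero hP.1 (by simpa using hlt))
  | succ i ih =>
    obtain ⟨c', hc'⟩ := exists_mem_annulus hm hq0 hq1 i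
    have hlt := norm_lt_of_mem_annulus hc' hc
    have hpos := norm_pos_of_mem_annulus hm hq0 hc
    have hpos' := norm_pos_of_mem_annulus hm hq0 hc'
    obtain ⟨j, rfl | rfl⟩ := Nat.even_or_odd' i
    · obtain ⟨k', hk'⟩ := dominant_nonempty hpos' (affine P.2)
      have h1 := ih (by omega) hc' hk'
      have h2 := dominant_mono hpos hlt hg hk' hk
      rw [show (2 * j + 1) / 2 = j by omega]
      rw [show 2 * j / 2 = j by omega] at h1
      omega
    · obtain ⟨l, hl⟩ := dominant_nonempty hpos' (affine P.1)
      have hl' : l + m ∈ dominant ‖c'‖ (affine P.2) :=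
        (hL.dominant_odd hm hq0 hq1 (by omega) hc' _).2
          ⟨Nat.le_add_left _ _, by rwa [Nat.add_sub_cancel]⟩
      have h1 := ih (by omega) hc' hl'
      have hk' : k + m ∈ dominant ‖c‖ (affine P.1) :=
        (hL.dominant_even hm hq0 hq1 (j := j + 1) (by omega) hc _).2
          ⟨Nat.le_add_left _ _, by rwa [Nat.add_sub_cancel]⟩
      have h2 := dominant_mono hpos hlt hf hl hk'
      rw [show (2 * j + 1 + 1) / 2 = j + 1 by omega, mul_add]
      rw [show (2 * j + 1) / 2 = j by omega] at h1
      omega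

lemma LattesPair.le_dominant (hL : LattesPair q m P) (hm : 2 ≤ m) (hq0 : q ≠ 0) (hq1 : ‖q‖ < 1)
    (t i : ℕ) (hi : i + t + 1 = m) {c : K} (hc : c ∈ annulus q m i) {k : ℕ}
    (hk : k ∈ dominant ‖c‖ (affine P.2)) : m ^ 2 ≤ k + m + 2 * m * (i / 2) := by
  obtain ⟨hf, hg⟩ := hL.affine_ne_zero hm hq0 hq1
  induction t generalizing i c k with
  | zero =>
    obtain ⟨j, rfl | rfl⟩ := Nat.even_or_odd' i
    · rw [show 2 * j / 2 = j by omega, ← hi]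
      nlinarith
    · have h1 := ((hL.dominant_odd hm hq0 hq1 (by omega) hc _).1 hk).1
      rw [show (2 * j + 1) / 2 = j by omega]
      have : m * m = m * (2 * j) + 2 * m := by rw [← hi]; ring
      nlinarith
  | succ t ih =>
    obtain ⟨c', hc'⟩ := exists_mem_annulus hm hq0 hq1 (i + 1)
    have hlt := norm_lt_of_mem_annulus hc hc'
    have hpos' := norm_pos_of_mem_annulus hm hq0 hc'
    obtain ⟨k', hk'⟩ := dominant_nonempty hpos' (affine P.2)
    have h1 := ih (i + 1) (by omega) hc' hk'
    obtain ⟨j, rfl | rfl⟩ := Nat.even_or_odd' i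
    · have h2 := dominant_mono hpos' hlt hg hk hk'
      rw [show (2 * j + 1) / 2 = j by omega] at h1
      rw [show 2 * j / 2 = j by omega]
      omega
    · obtain ⟨h3, h4⟩ := (hL.dominant_odd hm hq0 hq1 (by omega) hc _).1 hk
      have hk'' : k' + m ∈ dominant ‖c'‖ (affine P.1) :=
        (hL.dominant_even hm hq0 hq1 (j := j + 1) (by omega) hc' _).2
          ⟨Nat.le_add_left _ _, by rwa [Nat.add_sub_cancel]⟩
      have h2 := dominant_mono hpos' hlt hf h4 hk''
      rw [show (2 * j + 1 + 1) / 2 = j + 1 by omega, mul_add] at h1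
      rw [show (2 * j + 1) / 2 = j by omega]
      omega

lemma LattesPair.dominant_eq (hL : LattesPair q m P) (hm : 2 ≤ m) (hq0 : q ≠ 0) (hq1 : ‖q‖ < 1)
    (hP : HomPair (m ^ 2) P) {i : ℕ} (hi : i < m) {c : K} (hc : c ∈ annulus q m i) {k : ℕ}
    (hk : k ∈ dominant ‖c‖ (affine P.2)) : k + m + 2 * m * (i / 2) = m ^ 2 :=
  (hL.dominant_le hm hq0 hq1 hP i hi hc hk).antisymm
    (hL.le_dominant hm hq0 hq1 (m - i - 1) i (by omega) hc hk)

end slopes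

lemma nearMono_of_coeff {d p : ℕ} {F : MvPolynomial (Fin 2) K} (hp : p ≤ d) (a : ℕ → K)
    (h : ∀ x y : K, MvPolynomial.eval ![x, y] F =
      ∑ k ∈ Finset.range (d + 1), a k * x ^ k * y ^ (d - k))
    (h1 : ‖a p‖ = 1) (h2 : ∀ k, k ≠ p → ‖a k‖ < 1) : NearMono d p F := by
  refine ⟨hp, a p, h1, fun x y hx hy => ?_⟩
  rw [h, ← Finset.add_sum_erase _ _ (Finset.mem_range.2 (Nat.lt_succ_iff.2 hp)),
    add_sub_cancel_left]
  refine Finset.sum_induction _ (fun z => ‖z‖ < 1) (fun _ _ => norm_add_lt_of_lt) (by simp)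
    fun k hk => ?_
  have hxy : ‖x ^ k * y ^ (d - k)‖ ≤ 1 := by
    simpa using norm_monomial_le (norm_one (α := K)) hx hy k (d - k)
  rw [mul_assoc, norm_mul]
  exact mul_lt_one_of_nonneg_of_lt_one_left (norm_nonneg _) (h2 k (Finset.ne_of_mem_erase hk)) hxy

/-- If the Gauss norms of the two components differ exactly by `‖c‖` and are attained only once,
then a suitable diagonal conjugate has monomial reduction. -/
lemma exists_monoPair_of_gaussRel [IsAlgClosed K] {d p s a b : ℕ} (hd : 2 ≤ d) {P : FormPair K}
    (hP : HomPair d P) {c : K} (hc : c ≠ 0) (h : GaussRel c c a b (affine P.1) (affine P.2))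
    (hf : ∀ k ∈ dominant ‖c‖ (affine P.1), k = p) (hg : ∀ k ∈ dominant ‖c‖ (affine P.2), k = s) :
    ∃ M : GL (Fin 2) K, MonoPair d p s (conjP M P) := by
  obtain ⟨hf0, hg0⟩ := h.ne_zero hc
  have hc' : 0 < ‖c‖ := norm_pos_iff.2 hc
  obtain ⟨B, hB, h1, h2, h3, h4, -⟩ := h
  have hfd := mem_dominant_iff_of_max h3 h4
  have hgd := mem_dominant_iff_of_max h1 h2
  have hp : ‖(affine P.1).coeff p‖ * ‖c‖ ^ p = ‖c‖ * B := by
    obtain ⟨k, hk⟩ := h4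
    exact hf k ((hfd k).2 hk) ▸ hk
  have hs : ‖(affine P.2).coeff s‖ * ‖c‖ ^ s = B := by
    obtain ⟨k, hk⟩ := h2
    exact hg k ((hgd k).2 hk) ▸ hk
  have hpd : p ≤ d := by
    by_contra! hlt
    rw [affine_coeff_eq_zero hP.1 hlt, norm_zero, zero_mul] at hp
    exact (mul_pos hc' hB).ne hp
  have hsd : s ≤ d := by
    by_contra! hlt
    rw [affine_coeff_eq_zero hP.2 hlt, norm_zero, zero_mul] at hs
    exact hB.ne hs
  obtain ⟨e, rfl⟩ : ∃ e, d = e + 1 := ⟨d - 1, by omega⟩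
  obtain ⟨l, hl⟩ := IsAlgClosed.exists_pow_nat_eq ((affine P.2).coeff s * c ^ s)⁻¹
    (show 0 < e by omega)
  have hln : ‖l‖ ^ e = B⁻¹ := by rw [← norm_pow, hl, norm_inv, norm_mul, norm_pow, hs]
  have hl0 : l ≠ 0 := by
    rintro rfl
    rw [norm_zero, zero_pow (by omega), eq_comm, inv_eq_zero] at hln
    exact hB.ne' hln
  let M : GL (Fin 2) K := GeneralLinearGroup.mkOfDetNeZero !![l * c, 0; 0, l]
    (by simp [hl0, hc])
  have hev (x y : K) : l * c * MvPolynomial.eval ![x, y] (conjP M P).1 =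
        l ^ (e + 1) * MvPolynomial.eval ![c * x, y] P.1 ∧
      l * MvPolynomial.eval ![x, y] (conjP M P).2 =
        l ^ (e + 1) * MvPolynomial.eval ![c * x, y] P.2 := by
    have := conjP_eval M P x y
    have hM : M.1 = !![l * c, 0; 0, l] := rfl
    rw [hM] at this
    rw [← eval_mul_mul hP.1, ← eval_mul_mul hP.2]
    simpa [mul_assoc] using this
  refine ⟨M, nearMono_of_coeff hpd (fun k => l ^ e / c * ((affine P.1).coeff k * c ^ k)) ?_ ?_ ?_,
    nearMono_of_coeff hsd (fun k => l ^ e * ((affine P.2).coeff k * c ^ k)) ?_ ?_ ?_⟩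
  · intro x y
    refine mul_left_cancel₀ (mul_ne_zero hl0 hc) ?_
    rw [(hev x y).1, eval_eq_sum_affine hP.1, Finset.mul_sum, Finset.mul_sum]
    refine Finset.sum_congr rfl fun k _ => ?_
    field_simp
    ring
  · rw [norm_mul, norm_mul, norm_pow c, hp, norm_div, norm_pow, hln]
    field_simp
  · intro k hk
    have hlt := (h3 k).lt_of_ne fun he => hk (hf k ((hfd k).2 he))
    rw [norm_mul, norm_mul, norm_pow c, norm_div, norm_pow, hln, div_mul_eq_mul_div, div_lt_one hc',
      inv_mul_lt_iff₀ hB, mul_comm B]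
    exact hlt
  · intro x y
    refine mul_left_cancel₀ hl0 ?_
    rw [(hev x y).2, eval_eq_sum_affine hP.2, Finset.mul_sum, Finset.mul_sum]
    refine Finset.sum_congr rfl fun k _ => ?_
    ring
  · rw [norm_mul, norm_mul, norm_pow c, hs, norm_pow, hln, inv_mul_cancel₀ hB.ne']
  · intro k hk
    have hlt := (h1 k).lt_of_ne fun he => hk (hg k ((hgd k).2 he))
    rw [norm_mul, norm_mul, norm_pow c, norm_pow, hln, inv_mul_lt_iff₀ hB, mul_one]
    exact hlt

section monomial

variable [IsAlgClosed K] [CompleteSpace K] {q : K} {m : ℕ} {P : FormPair K}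

lemma LattesPair.exists_monoPair_even_annulus (hL : LattesPair q m P) (hm : 2 ≤ m) (hq0 : q ≠ 0)
    (hq1 : ‖q‖ < 1) (hP : HomPair (m ^ 2) P) {j : ℕ} (hj : 2 * j < m) {c : K}
    (hc : c ∈ annulus q m (2 * j)) (he : c ^ m = c * q ^ j) :
    ∃ (M : GL (Fin 2) K) (p s : ℕ), MonoPair (m ^ 2) p s (conjP M P) ∧
      s + m + 2 * m * j = m ^ 2 ∧ p = s + m := by
  have hc0 := norm_pos_iff.1 (norm_pos_of_mem_annulus hm hq0 hc)
  have hrel := hL.gaussRel_even hm hq0 hq1 hj hc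
  rw [he, mul_div_cancel_right₀ _ (pow_ne_zero _ hq0)] at hrel
  obtain ⟨s, hs⟩ := dominant_nonempty (norm_pos_iff.2 hc0) (affine P.2)
  have heq {k : ℕ} (hk : k ∈ dominant ‖c‖ (affine P.2)) : k + m + 2 * m * j = m ^ 2 := by
    simpa using hL.dominant_eq hm hq0 hq1 hP hj hc hk
  obtain ⟨M, hM⟩ := exists_monoPair_of_gaussRel (p := s + m) (s := s) (by nlinarith) hP hc0 hrel
    (fun k hk => by
      obtain ⟨h1, h2⟩ := (hL.dominant_even hm hq0 hq1 hj hc k).1 hk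
      have := heq h2
      have := heq hs
      omega)
    (fun k hk => by
      have := heq hk
      have := heq hs
      omega)
  exact ⟨M, _, s, hM, heq hs, rfl⟩

lemma LattesPair.exists_monoPair_odd_annulus (hL : LattesPair q m P) (hm : 2 ≤ m) (hq0 : q ≠ 0)
    (hq1 : ‖q‖ < 1) (hP : HomPair (m ^ 2) P) {j : ℕ} (hj : 2 * j + 1 < m) {c : K}
    (hc : c ∈ annulus q m (2 * j + 1)) (he : q ^ (j + 1) = c * c ^ m) :
    ∃ (M : GL (Fin 2) K) (p s : ℕ), MonoPair (m ^ 2) p s (conjP M P) ∧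
      s + m + 2 * m * j = m ^ 2 ∧ p + m = s := by
  have hc0 := norm_pos_iff.1 (norm_pos_of_mem_annulus hm hq0 hc)
  have hrel := hL.gaussRel_odd hm hq0 hq1 hj hc
  rw [he, mul_div_cancel_right₀ _ (pow_ne_zero _ hc0)] at hrel
  obtain ⟨p, hp⟩ := dominant_nonempty (norm_pos_iff.2 hc0) (affine P.1)
  have hmem {k : ℕ} (hk : k ∈ dominant ‖c‖ (affine P.1)) : k + m ∈ dominant ‖c‖ (affine P.2) :=
    (hL.dominant_odd hm hq0 hq1 hj hc _).2 ⟨Nat.le_add_left _ _, by rwa [Nat.add_sub_cancel]⟩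
  have heq {k : ℕ} (hk : k ∈ dominant ‖c‖ (affine P.2)) : k + m + 2 * m * j = m ^ 2 := by
    have := hL.dominant_eq hm hq0 hq1 hP hj hc hk
    rwa [show (2 * j + 1) / 2 = j by omega] at this
  obtain ⟨M, hM⟩ := exists_monoPair_of_gaussRel (p := p) (s := p + m) (by nlinarith) hP hc0 hrel
    (fun k hk => by
      have := heq (hmem hk)
      have := heq (hmem hp)
      omega)
    (fun k hk => by
      have := heq hk
      have := heq (hmem hp)
      omega)
  exact ⟨M, p, _, hM, heq (hmem hp), rfl⟩

omit [IsUltrametricDist K] [CompleteSpace K] in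
lemma exists_root_norm_lt_one {r : ℕ} (hr : 0 < r) (hq0 : q ≠ 0) (hq1 : ‖q‖ < 1) :
    ∃ t : K, t ^ r = q ∧ 0 < ‖t‖ ∧ ‖t‖ < 1 := by
  obtain ⟨t, rfl⟩ := IsAlgClosed.exists_pow_nat_eq q hr
  refine ⟨t, rfl, norm_pos_iff.2 ?_, ?_⟩
  · rintro rfl
    exact hq0 (zero_pow hr.ne')
  · rw [norm_pow] at hq1
    exact (pow_lt_one_iff_of_nonneg (norm_nonneg _) hr.ne').1 hq1

omit [IsUltrametricDist K] [IsAlgClosed K] [CompleteSpace K] in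
lemma pow_mem_annulus {t : K} (h0 : 0 < ‖t‖) (h1 : ‖t‖ < 1) {r e i : ℕ}
    (hlt : r * i < e * (2 * m)) (hlt' : e * (2 * m) < r * (i + 1)) :
    t ^ e ∈ annulus (t ^ r) m i := by
  refine ⟨?_, ?_⟩ <;> rw [norm_pow, norm_pow, ← pow_mul, ← pow_mul]
  · exact pow_lt_pow_right_of_lt_one₀ h0 h1 hlt'
  · exact pow_lt_pow_right_of_lt_one₀ h0 h1 hlt

lemma LattesPair.exists_monoPair_of_odd (hL : LattesPair q m P) (hm : 2 ≤ m) (hq0 : q ≠ 0)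
    (hq1 : ‖q‖ < 1) (hP : HomPair (m ^ 2) P) (hodd : Odd m) :
    ∃ (M : GL (Fin 2) K) (p s : ℕ) (σ : ℤ), MonoPair (m ^ 2) p s (conjP M P) ∧
      (σ = 1 ∨ σ = -1) ∧ 2 * (p : ℤ) = m ^ 2 + σ * m ∧ 2 * (s : ℤ) = m ^ 2 - σ * m := by
  obtain ⟨t, rfl, ht0, ht1⟩ := exists_root_norm_lt_one (show 0 < 4 by norm_num) hq0 hq1
  obtain ⟨j, rfl | rfl⟩ : ∃ j, m = 4 * j + 1 ∨ m = 4 * j + 3 := by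
    obtain ⟨r, rfl⟩ := hodd
    obtain ⟨j, rfl | rfl⟩ := Nat.even_or_odd' r
    exacts [⟨j, Or.inl (by ring)⟩, ⟨j, Or.inr (by ring)⟩]
  · have hc : t ^ 1 ∈ annulus (t ^ 4) (4 * j + 1) (2 * j) :=
      pow_mem_annulus ht0 ht1 (by omega) (by omega)
    obtain ⟨M, p, s, hM, h1, rfl⟩ := hL.exists_monoPair_even_annulus hm hq0 hq1 hP (by omega) hc
      (by ring)
    refine ⟨M, _, s, 1, hM, Or.inl rfl, ?_, ?_⟩ <;> zify at h1 <;> push_cast <;>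
      linear_combination 2 * h1
  · have hc : t ^ 1 ∈ annulus (t ^ 4) (4 * j + 3) (2 * j + 1) :=
      pow_mem_annulus ht0 ht1 (by omega) (by omega)
    obtain ⟨M, p, s, hM, h1, rfl⟩ := hL.exists_monoPair_odd_annulus hm hq0 hq1 hP (by omega) hc
      (by ring)
    refine ⟨M, p, _, -1, hM, Or.inr rfl, ?_, ?_⟩ <;> zify at h1 <;> push_cast <;>
      linear_combination 2 * h1

lemma LattesPair.exists_monoPair_of_even (hL : LattesPair q m P) (hm : 2 ≤ m) (hq0 : q ≠ 0)
    (hq1 : ‖q‖ < 1) (hP : HomPair (m ^ 2) P) (heven : Even m) :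
    ∃ (M : GL (Fin 2) K) (p s : ℕ), MonoPair (m ^ 2) p s (conjP M P) ∧
      2 * p = m ^ 2 ∧ 2 * s = m ^ 2 + 2 * m := by
  obtain ⟨t, rfl, ht0, ht1⟩ := exists_root_norm_lt_one (show 0 < 4 * (m + 1) by omega) hq0 hq1
  obtain ⟨j, rfl | rfl⟩ : ∃ j, m = 4 * j + 4 ∨ m = 4 * j + 2 := by
    obtain ⟨r, rfl⟩ := heven
    obtain ⟨j, rfl | rfl⟩ := Nat.even_or_odd' r
    · exact ⟨j - 1, Or.inl (by omega)⟩
    · exact ⟨j, Or.inr (by ring)⟩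
  · have hc : t ^ (4 * j + 4) ∈ annulus (t ^ (4 * (4 * j + 4 + 1))) (4 * j + 4) (2 * j + 1) :=
      pow_mem_annulus ht0 ht1 (by nlinarith) (by nlinarith)
    obtain ⟨M, p, s, hM, h1, rfl⟩ := hL.exists_monoPair_odd_annulus hm hq0 hq1 hP (by omega) hc
      (by ring)
    exact ⟨M, p, _, hM, by nlinarith, by nlinarith⟩
  · have hc : t ^ (4 * j + 4) ∈ annulus (t ^ (4 * (4 * j + 2 + 1))) (4 * j + 2) (2 * j + 1) :=
      pow_mem_annulus ht0 ht1 (by nlinarith) (by nlinarith)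
    obtain ⟨M, p, s, hM, h1, rfl⟩ := hL.exists_monoPair_odd_annulus hm hq0 hq1 hP (by omega) hc
      (by ring)
    have hM' := hM.conjP_swapGL
    rw [← conjP_mul] at hM'
    have hd : (4 * j + 2) ^ 2 = 16 * j ^ 2 + 16 * j + 4 := by ring
    have e : 2 * (4 * j + 2) * j = 8 * j ^ 2 + 4 * j := by ring
    rw [hd, e] at h1
    refine ⟨_, _, _, hM', ?_, ?_⟩ <;> rw [hd] <;> omega

end monomial

lemma MonoPair.pairIter_odd {m p s : ℕ} {σ : ℤ} {P : FormPair K} (hP : MonoPair (m ^ 2) p s P)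
    (hσ : σ = 1 ∨ σ = -1) (hp : 2 * (p : ℤ) = m ^ 2 + σ * m) (hs : 2 * (s : ℤ) = m ^ 2 - σ * m)
    (n : ℕ) :
    ∃ (pn sn : ℕ) (τ : ℤ), MonoPair ((m ^ 2) ^ n) pn sn (pairIter P.1 P.2 n) ∧
      (τ = 1 ∨ τ = -1) ∧ 2 * (pn : ℤ) = (m ^ 2) ^ n + τ * m ^ n ∧
      2 * (sn : ℤ) = (m ^ 2) ^ n - τ * m ^ n := by
  induction n with
  | zero => exact ⟨1, 0, 1, by simpa using monoPair_pairIter_zero P, Or.inl rfl, by simp, by simp⟩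
  | succ n ih =>
    obtain ⟨u, v, τ, hQ, hτ, hu, hv⟩ := ih
    have h1 : m ^ 2 - p = s := by zify [hP.1.1]; linarith
    have h2 : m ^ 2 - s = p := by zify [hP.2.1]; linarith
    refine ⟨p * u + (m ^ 2 - p) * v, s * u + (m ^ 2 - s) * v, σ * τ, ?_, ?_, ?_, ?_⟩
    · rw [pairIter_succ, pow_succ']
      exact hP.comp hQ
    · rcases hσ with rfl | rfl <;> rcases hτ with rfl | rfl <;> simp
    · rw [h1]
      push_cast
      have : 4 * ((p : ℤ) * u + s * v) = (2 * p) * (2 * u) + (2 * s) * (2 * v) := by ring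
      rw [hp, hs, hu, hv] at this
      refine mul_left_cancel₀ (two_ne_zero' ℤ) ?_
      linear_combination this
    · rw [h2]
      push_cast
      have : 4 * ((s : ℤ) * u + p * v) = (2 * s) * (2 * u) + (2 * p) * (2 * v) := by ring
      rw [hp, hs, hu, hv] at this
      refine mul_left_cancel₀ (two_ne_zero' ℤ) ?_
      linear_combination this

lemma Rmin_eq_of_monoPair_odd [IsAlgClosed K] {D b p s : ℕ} {σ : ℤ} (hD : 0 < D) (hb : 0 < b)
    {P : FormPair K} (hP : HomPair D P) (h0 : bres D P.1 P.2 ≠ 0) (hm : MonoPair D p s P)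
    (hσ : σ = 1 ∨ σ = -1) (hp : 2 * (p : ℤ) = D + σ * b) (hs : 2 * (s : ℤ) = D - σ * b) :
    Rmin K D P.1 P.2 = ordv K (bres D P.1 P.2) := by
  refine Rmin_eq_of_monoPair hD hP h0 hm ?_ ?_ <;> rcases hσ with rfl | rfl <;> omega

omit [IsUltrametricDist K] in
lemma bres_pairIter_ne_zero [IsAlgClosed K] {d : ℕ} {P : FormPair K} (hP : HomPair d P)
    (h0 : bres d P.1 P.2 ≠ 0) (n : ℕ) :
    bres (d ^ n) (pairIter P.1 P.2 n).1 (pairIter P.1 P.2 n).2 ≠ 0 := by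
  obtain ⟨a, -, h⟩ := norm_bres_pairIter hP n
  rw [← norm_pos_iff, h]
  exact pow_pos (norm_pos_iff.2 h0) a

omit [IsUltrametricDist K] in
lemma ordv_bres_pairIter [IsAlgClosed K] {m : ℕ} (hm : 2 ≤ m) {P : FormPair K}
    (hP : HomPair (m ^ 2) P) (n : ℕ) :
    ordv K (bres ((m ^ 2) ^ n) (pairIter P.1 P.2 n).1 (pairIter P.1 P.2 n).2) =
      (((m : ℝ) ^ n) ^ 2 * (((m : ℝ) ^ n) ^ 2 - 1) / ((m : ℝ) ^ 2 * ((m : ℝ) ^ 2 - 1))) *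
        ordv K (bres (m ^ 2) P.1 P.2) := by
  obtain ⟨a, ha, h⟩ := norm_bres_pairIter hP n
  have hm' : (2 : ℝ) ≤ m := by exact_mod_cast hm
  have hpos : (0 : ℝ) < (m : ℝ) ^ 2 * ((m : ℝ) ^ 2 - 1) := by
    have : (0 : ℝ) < (m : ℝ) ^ 2 - 1 := by nlinarith
    positivity
  push_cast at ha
  rw [← pow_mul (m : ℝ), mul_comm n 2, pow_mul (m : ℝ), ← ha, mul_div_cancel_right₀ _ hpos.ne', ordv, ordv, h,
    Real.log_pow]
  ring

section lattes

variable [IsAlgClosed K] [CompleteSpace K] {q : K} {m : ℕ} {P : FormPair K}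

lemma LattesPair.Rmin_pairIter_of_odd (hL : LattesPair q m P) (hm : 2 ≤ m) (hq0 : q ≠ 0)
    (hq1 : ‖q‖ < 1) (hP : HomPair (m ^ 2) P) (h0 : bres (m ^ 2) P.1 P.2 ≠ 0) (hodd : Odd m)
    (n : ℕ) :
    Rmin K ((m ^ 2) ^ n) (pairIter P.1 P.2 n).1 (pairIter P.1 P.2 n).2 =
      (((m : ℝ) ^ n) ^ 2 * (((m : ℝ) ^ n) ^ 2 - 1) / ((m : ℝ) ^ 2 * ((m : ℝ) ^ 2 - 1))) *
        Rmin K (m ^ 2) P.1 P.2 := by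
  obtain ⟨M, p, s, σ, hM, hσ, hp, hs⟩ := hL.exists_monoPair_of_odd hm hq0 hq1 hP hodd
  have hQ := hP.conjP M
  have hQ0 := bres_conjP_ne_zero hP h0 M
  obtain ⟨u, v, τ, hMn, hτ, hu, hv⟩ := hM.pairIter_odd hσ hp hs n
  rw [← Rmin_conjP _ P M, ← Rmin_conjP _ (pairIter P.1 P.2 n) M, ← pairIter_conjP,
    Rmin_eq_of_monoPair_odd (b := m) (by positivity) (by omega) hQ hQ0 hM hσ (by exact_mod_cast hp)
      (by exact_mod_cast hs),
    Rmin_eq_of_monoPair_odd (b := m ^ n) (by positivity) (by positivity) (hQ.pairIter n)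
      (bres_pairIter_ne_zero hQ hQ0 n) hMn hτ (by exact_mod_cast hu) (by exact_mod_cast hv),
    ordv_bres_pairIter hm hQ]

lemma LattesPair.Rmin_pairIter_two_lt_of_even (hL : LattesPair q m P) (hm : 2 ≤ m) (hq0 : q ≠ 0)
    (hq1 : ‖q‖ < 1) (hP : HomPair (m ^ 2) P) (h0 : bres (m ^ 2) P.1 P.2 ≠ 0) (heven : Even m) :
    Rmin K ((m ^ 2) ^ 2) (pairIter P.1 P.2 2).1 (pairIter P.1 P.2 2).2 <
      (((m : ℝ) ^ 2) ^ 2 * (((m : ℝ) ^ 2) ^ 2 - 1) / ((m : ℝ) ^ 2 * ((m : ℝ) ^ 2 - 1))) *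
        Rmin K (m ^ 2) P.1 P.2 := by
  obtain ⟨M, p, s, hM, hp, hs⟩ := hL.exists_monoPair_of_even hm hq0 hq1 hP heven
  have hQ := hP.conjP M
  have hQ0 := bres_conjP_ne_zero hP h0 M
  have hd : 0 < m ^ 2 := by positivity
  have hsd := hM.2.1
  have hM2 : MonoPair ((m ^ 2) ^ 2) (p * p + (m ^ 2 - p) * s) (s * p + (m ^ 2 - s) * s)
      (pairIter (conjP M P).1 (conjP M P).2 2) := by
    have h1 := hM.comp (monoPair_pairIter_zero (conjP M P))
    simp only [mul_one, mul_zero, add_zero] at h1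
    rw [sq (m ^ 2)]
    exact hM.comp h1
  have e1 : m ^ 2 - p = p := by omega
  obtain ⟨r, hr⟩ := Nat.exists_eq_add_of_le hsd
  have e2 : m ^ 2 - s = r := by omega
  obtain rfl : s = p + m := by omega
  rw [e1, e2] at hM2
  rw [← Rmin_conjP _ P M, ← Rmin_conjP _ (pairIter P.1 P.2 2) M, ← pairIter_conjP,
    Rmin_eq_of_monoPair hd hQ hQ0 hM (by omega) (by omega), ← ordv_bres_pairIter hm hQ]
  refine Rmin_lt_of_monoPair (by positivity) (hQ.pairIter 2) (bres_pairIter_ne_zero hQ hQ0 2) hM2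
    ?_ ?_
  · rw [← hp]
    nlinarith
  · rw [← hp]
    have hrp : p = r + m := by omega
    subst hrp
    nlinarith

end lattes

end TateLattes

/-- In the setting of the Lattès map `ψ_m` for the Tate curve with parameter
`q`, the minimal resultant iteration formula
`R_{[(ψ_m)ⁿ]} = ((mⁿ)²((mⁿ)²−1)/(m²(m²−1))) · R_{[ψ_m]}` holds for every `n ≥ 1` iff `m` is
odd. -/
theorem lattes_iteration_formula_iff_odd {K : Type} [NontriviallyNormedField K] [IsAlgClosed K]
    [CompleteSpace K] [IsUltrametricDist K]
    (hK2 : ringChar K ≠ 2) (hK3 : ringChar K ≠ 3)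
    (hk2 : ringChar (kk K) ≠ 2) (hk3 : ringChar (kk K) ≠ 3)
    (q : K) (hq0 : q ≠ 0) (hq1 : ‖q‖ < 1) (m : ℕ) (hm : 2 ≤ m)
    (F G : MvPolynomial (Fin 2) K) (hlift : LiftPair K (m ^ 2) F G)
    (hnorm : Normalized K F G)
    (hsemi : ∀ w : K, w ≠ 0 → (∀ n : ℤ, w ≠ q ^ n) → (∀ n : ℤ, w ^ m ≠ q ^ n) →
      MvPolynomial.eval ![xTate K q w, 1] G ≠ 0 ∧
      MvPolynomial.eval ![xTate K q w, 1] F =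
        xTate K q (w ^ m) * MvPolynomial.eval ![xTate K q w, 1] G) :
    (∀ n : ℕ, 1 ≤ n →
        Rmin K ((m ^ 2) ^ n) (pairIter F G n).1 (pairIter F G n).2 =
          (((m : ℝ) ^ n) ^ 2 * (((m : ℝ) ^ n) ^ 2 - 1) /
              ((m : ℝ) ^ 2 * ((m : ℝ) ^ 2 - 1))) * Rmin K (m ^ 2) F G)
      ↔ Odd m := by
  have hP : TateLattes.HomPair (m ^ 2) (F, G) := ⟨hlift.1, hlift.2.1⟩
  have hL : TateLattes.LattesPair q m (F, G) := hsemi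
  have h0 : bres (m ^ 2) F G ≠ 0 :=
    TateLattes.bres_ne_zero (by positivity) hlift.1 hlift.2.1 hlift.2.2
  refine ⟨fun h => Nat.not_even_iff_odd.1 fun heven => ?_,
    fun hodd n _ => hL.Rmin_pairIter_of_odd hm hq0 hq1 hP h0 hodd n⟩
  exact (hL.Rmin_pairIter_two_lt_of_even hm hq0 hq1 hP h0 heven).ne (h 2 one_le_two)

end
end

section
/- Let p ≥ 3 be a prime and let K = ℂ_p be the completion of an algebraic closure of ℚ_p, with absolute value normalized so that ord(p) = 1. Let φ(z) = (z^p − z)/p, a rational map of degree p. Then the pair [F,G] with F = X^p − X·Y^{p−1} and G = p·Y^p is a normalized homogeneous lift of φ, the reduction φ_v lies outside the indeterminacy locus I(p), and consequently R_{φⁿ} = (pⁿ(pⁿ−1)/(p−1)) · ord(p) for every n ≥ 1. -/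
open MvPolynomial Matrix

noncomputable section

variable {R : Type*} [CommRing R]

variable (K : Type) [NontriviallyNormedField K] [IsUltrametricDist K]

theorem det_sylv_of_last (e : ℕ) (a b : Fin (e + 1) → R) (ha : a 0 = 1)
    (hb : ∀ i, i ≠ Fin.last e → b i = 0) :
    (sylv e a b).det = b (Fin.last e) ^ e := by
  have hupper : (sylv e a b).BlockTriangular id := by
    intro i j hij
    have hij' : (j : ℕ) < i := hij
    unfold sylv
    rw [Matrix.of_apply]
    split_ifs with h1 h2 h2
    · omega
    · rfl
    · apply hb
      intro h
      have := congrArg Fin.val h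
      simp only [Fin.val_last] at this
      omega
    · rfl
  rw [Matrix.det_of_isUpperTriangular hupper, Fin.prod_univ_add]
  have hleft : ∀ i : Fin e, sylv e a b (Fin.castAdd e i) (Fin.castAdd e i) = 1 := by
    intro i
    simp only [sylv, Matrix.of_apply, Fin.val_castAdd, i.2, dite_true]
    simp only [le_refl, Nat.le_add_right, and_self, dite_true, Nat.sub_self]
    exact ha
  have hright : ∀ i : Fin e,
      sylv e a b (Fin.natAdd e i) (Fin.natAdd e i) = b (Fin.last e) := by
    intro i
    simp only [sylv, Matrix.of_apply, Fin.val_natAdd]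
    rw [dif_neg (by omega), dif_pos (by omega)]
    congr 1
    ext
    simp
  simp only [hleft, hright, Finset.prod_const, one_pow, one_mul, Finset.card_univ, Fintype.card_fin]

theorem coeffVec_zero_of_X_dvd_sub (e : ℕ) (F : MvPolynomial (Fin 2) R)
    (h : X 1 ∣ F - X 0 ^ e) : coeffVec e F 0 = 1 := by
  obtain ⟨q, hq⟩ := h
  have h0 : coeff (Finsupp.single 0 e) (F - X 0 ^ e) = 0 := by
    rw [hq, coeff_X_mul', if_neg]
    simp
  have h1 : coeff (Finsupp.single 0 e) (X 0 ^ e : MvPolynomial (Fin 2) R) = 1 := by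
    simp [coeff_X_pow]
  rw [coeff_sub, h1, sub_eq_zero] at h0
  simpa [coeffVec] using h0

theorem coeffVec_C_mul_X_pow (e : ℕ) (c : R) (i : Fin (e + 1)) :
    coeffVec e (C c * X 1 ^ e) i = if i = Fin.last e then c else 0 := by
  rw [coeffVec, coeff_C_mul, coeff_X_pow]
  have hiff : Finsupp.single (1 : Fin 2) e =
      Finsupp.single 0 (e - (i : ℕ)) + Finsupp.single 1 (i : ℕ) ↔ i = Fin.last e := by
    constructor
    · intro h
      have := DFunLike.congr_fun h 1
      simp at this
      ext
      simp [← this]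
    · rintro rfl
      simp
  simp only [hiff, mul_ite, mul_one, mul_zero]

theorem bres_C_mul_X_pow (e : ℕ) (F : MvPolynomial (Fin 2) R) (c : R)
    (h : X 1 ∣ F - X 0 ^ e) : bres e F (C c * X 1 ^ e) = c ^ e := by
  rw [bres, det_sylv_of_last e _ _ (coeffVec_zero_of_X_dvd_sub e F h)
    fun i hi => by rw [coeffVec_C_mul_X_pow, if_neg hi], coeffVec_C_mul_X_pow, if_pos rfl]

theorem X_dvd_sub_X_pow (p : ℕ) (hp : 2 ≤ p) :
    (X 1 : MvPolynomial (Fin 2) R) ∣ (X 0 ^ p - X 0 * X 1 ^ (p - 1)) - X 0 ^ p := by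
  rw [sub_sub_cancel_left, dvd_neg]
  exact (dvd_pow_self _ (by omega)).mul_left _

theorem pairIter_snd (p n : ℕ) (F : MvPolynomial (Fin 2) R) (c : R) :
    (pairIter F (C c * X 1 ^ p) n).2 =
      C (c ^ (∑ i ∈ Finset.range n, p ^ i)) * X 1 ^ p ^ n := by
  induction n with
  | zero => simp [pairIter]
  | succ n ih =>
    have hstep : (pairIter F (C c * X 1 ^ p) (n + 1)).2 =
        C c * (pairIter F (C c * X 1 ^ p) n).2 ^ p := by
      simp [pairIter, comp2]
    rw [hstep, ih, mul_pow, ← map_pow, ← mul_assoc, ← map_mul, ← pow_mul, ← pow_mul, ← pow_succ',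
      geom_sum_succ, pow_succ p n, mul_comm p]

theorem pairIter_fst_succ (p n : ℕ) (G : MvPolynomial (Fin 2) R) :
    (pairIter (X 0 ^ p - X 0 * X 1 ^ (p - 1)) G (n + 1)).1 =
      (pairIter (X 0 ^ p - X 0 * X 1 ^ (p - 1)) G n).1 ^ p -
        (pairIter (X 0 ^ p - X 0 * X 1 ^ (p - 1)) G n).1 *
          (pairIter (X 0 ^ p - X 0 * X 1 ^ (p - 1)) G n).2 ^ (p - 1) := by
  simp [pairIter, comp2]

theorem X_dvd_pairIter_fst_sub (p n : ℕ) (hp : 2 ≤ p) (c : R) :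
    X 1 ∣ (pairIter (X 0 ^ p - X 0 * X 1 ^ (p - 1)) (C c * X 1 ^ p) n).1 - X 0 ^ p ^ n := by
  induction n with
  | zero => simp [pairIter]
  | succ n ih =>
    rw [pairIter_fst_succ, pairIter_snd, sub_right_comm, pow_succ p n, pow_mul]
    refine dvd_sub (ih.trans (sub_dvd_pow_sub_pow _ _ p)) (Dvd.dvd.mul_left ?_ _)
    exact dvd_pow ((dvd_pow_self _ (by positivity)).mul_left _) (by omega)

theorem norm_coeff_le_one_of_mem_range {F : MvPolynomial (Fin 2) K}
    (hF : F ∈ (MvPolynomial.map (σ := Fin 2) (intRing K).subtype).range) (m : Fin 2 →₀ ℕ) :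
    ‖F.coeff m‖ ≤ 1 := by
  obtain ⟨P, rfl⟩ := hF
  rw [MvPolynomial.coeff_map]
  exact (P.coeff m).2

theorem X_mem_range_map_subtype (i : Fin 2) :
    X i ∈ (MvPolynomial.map (σ := Fin 2) (intRing K).subtype).range :=
  ⟨X i, map_X _ _⟩

theorem C_mem_range_map_subtype {c : K} (hc : ‖c‖ ≤ 1) :
    C c ∈ (MvPolynomial.map (σ := Fin 2) (intRing K).subtype).range :=
  ⟨C ⟨c, hc⟩, map_C _ _⟩

theorem pairIter_fst_mem_range (p n : ℕ) {c : K} (hc : ‖c‖ ≤ 1) :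
    (pairIter (X 0 ^ p - X 0 * X 1 ^ (p - 1)) (C c * X 1 ^ p) n).1 ∈
      (MvPolynomial.map (σ := Fin 2) (intRing K).subtype).range := by
  induction n with
  | zero => exact X_mem_range_map_subtype K 0
  | succ n ih =>
    rw [pairIter_fst_succ, pairIter_snd]
    refine sub_mem (pow_mem ih p) (mul_mem ih (pow_mem (mul_mem ?_ ?_) _))
    · exact C_mem_range_map_subtype K (by
        rw [norm_pow]
        exact pow_le_one₀ (norm_nonneg c) hc)
    · exact pow_mem (X_mem_range_map_subtype K 1) _

theorem redPoly_map_subtype (P : MvPolynomial (Fin 2) (intRing K)) :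
    redPoly K (MvPolynomial.map (intRing K).subtype P) =
      MvPolynomial.map (Ideal.Quotient.mk (maxIdl K)) P := by
  have hred : ∀ x : intRing K, redCoeff K (x : K) = Ideal.Quotient.mk (maxIdl K) x :=
    fun x => dif_pos x.2
  have hsupp : (MvPolynomial.map (intRing K).subtype P).support = P.support :=
    support_map_of_injective P Subtype.val_injective
  conv_rhs => rw [P.as_sum, map_sum]
  rw [redPoly, hsupp]
  refine Finset.sum_congr rfl fun m _ => ?_
  rw [map_monomial, coeff_map, ← hred]
  rfl

instance : Nontrivial (kk K) :=
  Ideal.Quotient.nontrivial_iff.mpr <| (Ideal.ne_top_iff_one _).mpr fun h => by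
    have h1 : ‖((1 : intRing K) : K)‖ < 1 := h
    simp at h1

theorem redPoly_X_pow_sub (p : ℕ) :
    redPoly K (X 0 ^ p - X 0 * X 1 ^ (p - 1)) = X 0 ^ p - X 0 * X 1 ^ (p - 1) := by
  have h := redPoly_map_subtype K (X 0 ^ p - X 0 * X 1 ^ (p - 1))
  simp only [map_sub, map_mul, map_pow, map_X] at h
  exact h

theorem redPoly_C_mul_X_pow (p : ℕ) {c : K} (hc : ‖c‖ < 1) :
    redPoly K (C c * X 1 ^ p) = 0 := by
  have h := redPoly_map_subtype K (C ⟨c, hc.le⟩ * X 1 ^ p)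
  have h0 : Ideal.Quotient.mk (maxIdl K) ⟨c, hc.le⟩ = 0 := Ideal.Quotient.eq_zero_iff_mem.mpr hc
  simp only [map_mul, map_pow, map_X, map_C, h0, map_zero, zero_mul] at h
  exact h

theorem not_Ilocus_X_pow_sub (p : ℕ) (hp : 2 ≤ p) {c : K} (hc : ‖c‖ < 1) :
    ¬ Ilocus K p (X 0 ^ p - X 0 * X 1 ^ (p - 1)) (C c * X 1 ^ p) := by
  rintro ⟨a, b, Q, -, -, hF, hG, hev⟩
  rw [redPoly_X_pow_sub] at hF
  rw [redPoly_C_mul_X_pow K p hc] at hG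
  have hunit : a * eval ![1, 0] Q = 1 := by
    have h := congrArg (eval ![1, 0]) hF
    simp [zero_pow (show p - 1 ≠ 0 by omega)] at h
    exact h.symm
  have hb : b = 0 := by
    have h := congrArg (eval ![1, 0]) hG
    simp at h
    calc b = b * (a * eval ![1, 0] Q) := by rw [hunit, mul_one]
      _ = a * (b * eval ![1, 0] Q) := by ring
      _ = 0 := by rw [← h, mul_zero]
  subst hb
  have hpow : a ^ p = 0 := by
    have h := congrArg (eval ![a, 0]) hF
    simpa [zero_pow (show p - 1 ≠ 0 by omega), hev] using h
  exact not_isUnit_zero (hpow ▸ (IsUnit.of_mul_eq_one _ hunit).pow p)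

theorem liftPair_X_pow_sub (p : ℕ) (hp : 2 ≤ p) {c : K} (hc : c ≠ 0) :
    LiftPair K p (X 0 ^ p - X 0 * X 1 ^ (p - 1)) (C c * X 1 ^ p) := by
  refine ⟨(isHomogeneous_X_pow 0 p).sub ?_, ?_, ?_⟩
  · have h := (isHomogeneous_X K (0 : Fin 2)).mul (isHomogeneous_X_pow (R := K) (1 : Fin 2) (p - 1))
    rwa [show 1 + (p - 1) = p by omega] at h
  · exact (isHomogeneous_X_pow 1 p).C_mul c
  · rw [isRelPrime_mul_unit_left_right (hc.isUnit.map C)]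
    refine IsRelPrime.pow_right (IsRelPrime.symm ?_)
    rw [X_prime.irreducible.isRelPrime_iff_not_dvd]
    intro h
    have h2 := X_prime.dvd_of_dvd_pow ((dvd_sub_right h).mp (X_dvd_sub_X_pow p hp))
    simp [X_dvd_X] at h2

theorem maxNorm_eq_one (e : ℕ) (F G : MvPolynomial (Fin 2) K) (hF : ∀ m, ‖F.coeff m‖ ≤ 1)
    (hG : ∀ m, ‖G.coeff m‖ ≤ 1) (h : X 1 ∣ F - X 0 ^ e) : maxNorm K e F G = 1 := by
  refine le_antisymm (Finset.sup'_le _ _ fun i _ => max_le (hF _) (hG _)) ?_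
  refine Finset.le_sup'_of_le _ (Finset.mem_univ 0) (le_max_of_le_left ?_)
  rw [coeffVec_zero_of_X_dvd_sub e F h, norm_one]

/-- Let `p ≥ 3` be prime and `K = ℂ_p` (an algebraically closed, complete,
non-Archimedean field of characteristic zero and residue characteristic `p`, i.e. `|p| < 1`).
For `φ(z) = (z^p − z)/p`, the pair `[F,G]` with `F = X^p − X·Y^{p−1}`, `G = p·Y^p` is a
normalized homogeneous lift of `φ`, the reduction `φ_v` lies outside `I(p)`, and
`R_{φⁿ} = (pⁿ(pⁿ−1)/(p−1)) · ord(p)` for every `n ≥ 1`. -/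
theorem example_z_pow_p_sub_z_div_p {K : Type} [NontriviallyNormedField K] [IsAlgClosed K]
    [CompleteSpace K] [IsUltrametricDist K] [CharZero K]
    (p : ℕ) (hp : p.Prime) (hp3 : 3 ≤ p) (hnp : ‖(p : K)‖ < 1) :
    LiftPair K p (X 0 ^ p - X 0 * X 1 ^ (p - 1)) (C (p : K) * X 1 ^ p) ∧
    Normalized K (X 0 ^ p - X 0 * X 1 ^ (p - 1)) (C (p : K) * X 1 ^ p) ∧
    ¬ Ilocus K p (X 0 ^ p - X 0 * X 1 ^ (p - 1)) (C (p : K) * X 1 ^ p) ∧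
    ∀ n : ℕ, 1 ≤ n →
      Rpair K (p ^ n)
          (pairIter (X 0 ^ p - X 0 * X 1 ^ (p - 1)) (C (p : K) * X 1 ^ p) n).1
          (pairIter (X 0 ^ p - X 0 * X 1 ^ (p - 1)) (C (p : K) * X 1 ^ p) n).2 =
        ((p : ℝ) ^ n * ((p : ℝ) ^ n - 1) / ((p : ℝ) - 1)) * ordv K (p : K) := by
  have hp2 : 2 ≤ p := by omega
  have hp0 : (p : K) ≠ 0 := Nat.cast_ne_zero.mpr hp.ne_zero
  have hG (c : K) (hc : ‖c‖ ≤ 1) (e : ℕ) (m) :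
      ‖(C c * X 1 ^ e : MvPolynomial (Fin 2) K).coeff m‖ ≤ 1 :=
    norm_coeff_le_one_of_mem_range K (mul_mem (C_mem_range_map_subtype K hc)
      (pow_mem (X_mem_range_map_subtype K 1) e)) m
  refine ⟨liftPair_X_pow_sub K p hp2 hp0, ⟨?_, hG _ hnp.le p, ?_⟩,
    not_Ilocus_X_pow_sub K p hp2 hnp, fun n _ => ?_⟩
  · exact norm_coeff_le_one_of_mem_range K (sub_mem (pow_mem (X_mem_range_map_subtype K 0) p)
      (mul_mem (X_mem_range_map_subtype K 0) (pow_mem (X_mem_range_map_subtype K 1) (p - 1))))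
  · have h := coeffVec_zero_of_X_dvd_sub p (X 0 ^ p - X 0 * X 1 ^ (p - 1) : MvPolynomial (Fin 2) K)
      (X_dvd_sub_X_pow p hp2)
    exact ⟨_, Or.inl ((congrArg norm h).trans norm_one)⟩
  · have hdvd := X_dvd_pairIter_fst_sub p n hp2 (p : K)
    have hF := norm_coeff_le_one_of_mem_range K (pairIter_fst_mem_range K p n hnp.le)
    have hpow : ‖(p : K) ^ (∑ i ∈ Finset.range n, p ^ i)‖ ≤ 1 := by
      rw [norm_pow]
      exact pow_le_one₀ (norm_nonneg _) hnp.le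
    have hp1 : (p : ℝ) ≠ 1 := by exact_mod_cast hp.ne_one
    rw [Rpair, pairIter_snd, bres_C_mul_X_pow _ _ _ hdvd,
      maxNorm_eq_one K _ _ _ hF (hG _ hpow _) hdvd, Real.log_one, mul_zero, add_zero, ordv, ordv,
      norm_pow, norm_pow, Real.log_pow, Real.log_pow]
    push_cast
    rw [geom_sum_eq hp1]
    ring

end
end
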